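/- In the discharging of H defined by rules R1–R5 applied to the initial charge (every j-face charged with weight j), every minor 7-face f of H has final weight w(f) ≥ 10/3. -/

import Mathlib

open scoped Classical

noncomputable section

/-- A plane embedding (drawing) of a simple graph: vertices are mapped to distinct
points of the plane, every edge is drawn as a simple arc joining the points of its two
endvertices, arcs contain no vertex points other than their endpoints, and two distinct
arcs meet only in common endpoints. -/
structure PlaneEmbedding {V : Type*} (G : SimpleGraph V) where
  pos : V → ℝ × ℝ
  arc : V → V → Set (ℝ × ℝ)
  pos_injective : Function.Injective pos
  arc_symm : ∀ u v, arc u v = arc v u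
  arc_curve : ∀ u v, G.Adj u v → ∃ γ : ℝ → ℝ × ℝ,
      ContinuousOn γ (Set.Icc 0 1) ∧ Set.InjOn γ (Set.Icc 0 1) ∧
      γ 0 = pos u ∧ γ 1 = pos v ∧ γ '' Set.Icc 0 1 = arc u v
  arc_vertex : ∀ u v, G.Adj u v → ∀ w, pos w ∈ arc u v → w = u ∨ w = v
  arc_inter : ∀ u v x y, G.Adj u v → G.Adj x y → s(u, v) ≠ s(x, y) →
      arc u v ∩ arc x y ⊆ Set.range pos

/-- A graph is planar if it admits a plane embedding. -/
def SimpleGraph.IsPlanar {V : Type*} (G : SimpleGraph V) : Prop :=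
  Nonempty (PlaneEmbedding G)

/-- A graph is 3-connected if it has at least four vertices and deleting any set of at
most two vertices leaves a connected graph. -/
def ThreeConnected {V : Type*} [Fintype V] (G : SimpleGraph V) : Prop :=
  4 ≤ Fintype.card V ∧
    ∀ S : Finset V, S.card ≤ 2 → (G.induce ((↑S : Set V)ᶜ)).Connected

/-- `S` is a separator of `G`: deleting it leaves a disconnected graph. -/
def IsSeparator {V : Type*} [Fintype V] (G : SimpleGraph V) (S : Finset V) : Prop :=
  ¬ (G.induce ((↑S : Set V)ᶜ)).Connected

/-- A separator `S` is trivial if some component of `G - S` is a single vertex, i.e.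
some vertex outside `S` has all of its neighbours inside `S`. -/
def TrivialSeparator {V : Type*} [Fintype V] (G : SimpleGraph V) (S : Finset V) : Prop :=
  ∃ v : V, v ∉ S ∧ ∀ w : V, G.Adj v w → w ∈ S

/-- A graph is essentially 4-connected if it is 3-connected and every 3-separator is
trivial. -/
def EssentiallyFourConnected {V : Type*} [Fintype V] (G : SimpleGraph V) : Prop :=
  ThreeConnected G ∧
    ∀ S : Finset V, S.card = 3 → IsSeparator G S → TrivialSeparator G S

/-- A cycle `C` of `G` is isolating if every component of `G - V(C)` is a single vertex
of degree 3 in `G`, i.e. every vertex not on `C` has degree 3 in `G` and all of its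
neighbours on `C`. -/
def IsIsolating {V : Type*} [Fintype V] (G : SimpleGraph V) {x : V} (C : G.Walk x x) : Prop :=
  ∀ v : V, v ∉ C.support →
    (Finset.univ.filter fun w => G.Adj v w).card = 3 ∧ ∀ w : V, G.Adj v w → w ∈ C.support

/-- `C` is a longest isolating cycle of `G`. -/
def IsLongestIsolatingCycle {V : Type*} [Fintype V] (G : SimpleGraph V) {x : V}
    (C : G.Walk x x) : Prop :=
  C.IsCycle ∧ IsIsolating G C ∧
    ∀ (y : V) (C' : G.Walk y y), C'.IsCycle → IsIsolating G C' → C'.length ≤ C.length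

section PlaneSetup

variable {V : Type*} [Fintype V] {G : SimpleGraph V}

/-- The chords of the cycle `C`: edges of `G` not on `C` joining two vertices of `C`. -/
def chordSet {x : V} (C : G.Walk x x) : Set (Sym2 V) :=
  {e | e ∈ G.edgeSet ∧ e ∉ C.edges ∧ ∀ v ∈ e, v ∈ C.support}

/-- The plane graph `H` obtained from `G` by deleting all chords of `C`. -/
def Hgraph {x : V} (C : G.Walk x x) : SimpleGraph V :=
  G.deleteEdges (chordSet C)

/-- The arc drawing an edge, as a function of the unordered edge. -/
def arcSet (emb : PlaneEmbedding G) : Sym2 V → Set (ℝ × ℝ) :=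
  Sym2.lift ⟨emb.arc, emb.arc_symm⟩

/-- The point set of the drawing of the subgraph of `H'` induced on the vertex set `s`
(in the embedding `emb` of `G`). -/
def drawingOn (emb : PlaneEmbedding G) (H' : SimpleGraph V) (s : Set V) : Set (ℝ × ℝ) :=
  emb.pos '' s ∪
    ⋃ (u : V) (v : V) (_ : H'.Adj u v) (_ : u ∈ s) (_ : v ∈ s), emb.arc u v

/-- The drawing of `H`. -/
def drawingH (emb : PlaneEmbedding G) {x : V} (C : G.Walk x x) : Set (ℝ × ℝ) :=
  drawingOn emb (Hgraph C) Set.univ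

/-- `f` is a face of the drawing `D`: a connected component of its complement. -/
def IsFaceOf (D : Set (ℝ × ℝ)) (f : Set (ℝ × ℝ)) : Prop :=
  ∃ z : ℝ × ℝ, z ∉ D ∧ f = connectedComponentIn Dᶜ z

/-- The drawing of the cycle `C`. -/
def drawC (emb : PlaneEmbedding G) {x : V} (C : G.Walk x x) : Set (ℝ × ℝ) :=
  ⋃ e ∈ C.edges, arcSet emb e

/-- The open region strictly inside the closed curve given by `C`: the points off the
curve whose connected component in the complement is bounded. -/
def insideC (emb : PlaneEmbedding G) {x : V} (C : G.Walk x x) : Set (ℝ × ℝ) :=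
  {z | z ∉ drawC emb C ∧ Bornology.IsBounded (connectedComponentIn (drawC emb C)ᶜ z)}

/-- The vertices of `G` strictly inside `C`. -/
def Vminus (emb : PlaneEmbedding G) {x : V} (C : G.Walk x x) : Finset V :=
  Finset.univ.filter fun v => v ∉ C.support ∧ emb.pos v ∈ insideC emb C

/-- The vertices of `G` strictly outside `C`:  `V⁺ = V - V(C) - V⁻`. -/
def Vplus (emb : PlaneEmbedding G) {x : V} (C : G.Walk x x) : Finset V :=
  Finset.univ.filter fun v => v ∉ C.support ∧ v ∉ Vminus emb C

/-- A face `f` is incident with the vertex `v`. -/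
def incVertex (emb : PlaneEmbedding G) (f : Set (ℝ × ℝ)) (v : V) : Prop :=
  emb.pos v ∈ closure f

/-- A face `f` is incident with the edge `e` (the arc of `e` lies on the boundary). -/
def incEdge (emb : PlaneEmbedding G) (f : Set (ℝ × ℝ)) (e : Sym2 V) : Prop :=
  arcSet emb e ⊆ closure f

/-- A minor face of the drawing `D`: a face incident with exactly one vertex of
`V⁻ ∪ V⁺`. -/
def MinorFaceOf (emb : PlaneEmbedding G) {x : V} (C : G.Walk x x)
    (D : Set (ℝ × ℝ)) (f : Set (ℝ × ℝ)) : Prop :=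
  IsFaceOf D f ∧ ∃! v : V, v ∈ Vminus emb C ∪ Vplus emb C ∧ incVertex emb f v

/-- `M⁻`: the minor faces of `H⁻ = H - V⁺`. -/
def Mminus (emb : PlaneEmbedding G) {x : V} (C : G.Walk x x) : Set (Set (ℝ × ℝ)) :=
  {f | MinorFaceOf emb C (drawingOn emb (Hgraph C) ((↑(Vplus emb C) : Set V)ᶜ)) f}

/-- `M⁺`: the minor faces of `H⁺ = H - V⁻`. -/
def Mplus (emb : PlaneEmbedding G) {x : V} (C : G.Walk x x) : Set (Set (ℝ × ℝ)) :=
  {f | MinorFaceOf emb C (drawingOn emb (Hgraph C) ((↑(Vminus emb C) : Set V)ᶜ)) f}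

/-- A minor face of `H`. -/
def MinorFaceH (emb : PlaneEmbedding G) {x : V} (C : G.Walk x x) (f : Set (ℝ × ℝ)) : Prop :=
  MinorFaceOf emb C (drawingH emb C) f

/-- A major face of `H`: a face of `H` that is not minor. -/
def MajorFaceH (emb : PlaneEmbedding G) {x : V} (C : G.Walk x x) (f : Set (ℝ × ℝ)) : Prop :=
  IsFaceOf (drawingH emb C) f ∧ ¬ MinorFaceH emb C f

/-- The number of `C`-edges of a face `f` (so `f` is a `j`-face when this equals `j`). -/
def numCEdges (emb : PlaneEmbedding G) {x : V} (C : G.Walk x x) (f : Set (ℝ × ℝ)) : ℕ :=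
  (C.edges.toFinset.filter fun e => incEdge emb f e).card

/-- `m_{f,f'}`: the number of common `C`-edges of the faces `f` and `f'`. -/
def mEdges (emb : PlaneEmbedding G) {x : V} (C : G.Walk x x)
    (f f' : Set (ℝ × ℝ)) : ℕ :=
  (C.edges.toFinset.filter fun e => incEdge emb f e ∧ incEdge emb f' e).card

/-- `f'` is opposite to `f` (with respect to some `C`-edge incident with both). -/
def OppositeFaces (emb : PlaneEmbedding G) {x : V} (C : G.Walk x x)
    (f f' : Set (ℝ × ℝ)) : Prop :=
  f ≠ f' ∧ ∃ e ∈ C.edges, incEdge emb f e ∧ incEdge emb f' e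

/-- `e` is the middle `C`-edge of the face `f` (for a 3-face, the `C`-edge sharing an
endvertex with every other `C`-edge of `f`). -/
def IsMiddleCEdge (emb : PlaneEmbedding G) {x : V} (C : G.Walk x x)
    (f : Set (ℝ × ℝ)) (e : Sym2 V) : Prop :=
  e ∈ C.edges ∧ incEdge emb f e ∧
    ∀ e' ∈ C.edges, incEdge emb f e' → e' ≠ e → ∃ v : V, v ∈ e ∧ v ∈ e'

/-- The total weight sent from the face `f` to the face `f'` by the discharging rules
R1–R5 (each rule applied exactly once). -/
def sendWeight (emb : PlaneEmbedding G) {x : V} (C : G.Walk x x)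
    (f f' : Set (ℝ × ℝ)) : ℚ :=
  -- R1: a major face sends `m_{f,f'}` to every opposite minor face
  (if MajorFaceH emb C f ∧ MinorFaceH emb C f' ∧ OppositeFaces emb C f f'
    then (mEdges emb C f f' : ℚ) else 0)
  -- R2: a minor face sends `(2/3)·m_{f,f'}` to every opposite minor 2-face
  + (if MinorFaceH emb C f ∧ MinorFaceH emb C f' ∧ numCEdges emb C f' = 2 ∧
        OppositeFaces emb C f f'
    then 2 / 3 * (mEdges emb C f f' : ℚ) else 0)
  -- R3: a minor face sends 1 to every minor 3-face opposite with respect to its middle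
  -- `C`-edge
  + (if MinorFaceH emb C f ∧ MinorFaceH emb C f' ∧ numCEdges emb C f' = 3 ∧ f ≠ f' ∧
        (∃ e : Sym2 V, IsMiddleCEdge emb C f' e ∧ incEdge emb f e)
    then 1 else 0)
  -- R4
  + (if MinorFaceH emb C f ∧ 4 ≤ numCEdges emb C f ∧ MinorFaceH emb C f' ∧
        numCEdges emb C f' = 4 ∧ OppositeFaces emb C f' f ∧ mEdges emb C f' f = 2 ∧
        (∃ f₂ : Set (ℝ × ℝ), MinorFaceH emb C f₂ ∧
          (numCEdges emb C f₂ = 2 ∨ numCEdges emb C f₂ = 3) ∧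
          OppositeFaces emb C f' f₂ ∧ mEdges emb C f' f₂ = 2)
    then 2 / 3 else 0)
  -- R5
  + (if MinorFaceH emb C f ∧ 4 ≤ numCEdges emb C f ∧ MinorFaceH emb C f' ∧
        numCEdges emb C f' = 5 ∧ OppositeFaces emb C f' f ∧ mEdges emb C f' f = 2 ∧
        (∃ g₁ g₂ : Set (ℝ × ℝ), g₁ ≠ g₂ ∧
          MinorFaceH emb C g₁ ∧ numCEdges emb C g₁ = 2 ∧ OppositeFaces emb C f' g₁ ∧
          MinorFaceH emb C g₂ ∧ numCEdges emb C g₂ = 2 ∧ OppositeFaces emb C f' g₂)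
    then 1 / 3 else 0)

/-- The final weight of a face `f` after discharging: the initial charge `j` of a
`j`-face, minus everything sent, plus everything received. -/
def wFace (emb : PlaneEmbedding G) {x : V} (C : G.Walk x x) (f : Set (ℝ × ℝ)) : ℚ :=
  (numCEdges emb C f : ℚ) - (∑ᶠ f' : Set (ℝ × ℝ), sendWeight emb C f f')
    + ∑ᶠ f' : Set (ℝ × ℝ), sendWeight emb C f' f

end PlaneSetup


/-- The function `h` has a continuous logarithm on the set `K`. -/
def HasLog {X : Type*} [TopologicalSpace X] (K : Set X) (h : X → ℂ) : Prop :=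
  ∃ g : X → ℂ, ContinuousOn g K ∧ ∀ z ∈ K, h z = Complex.exp (g z)

section HasLog

variable {X Y : Type*} [TopologicalSpace X] [TopologicalSpace Y] {K L : Set X} {h h' : X → ℂ}

theorem HasLog.mono (H : HasLog K h) (hL : L ⊆ K) : HasLog L h := by
  obtain ⟨g, hg, hgh⟩ := H
  exact ⟨g, hg.mono hL, fun z hz => hgh z (hL hz)⟩

theorem HasLog.congr (H : HasLog K h) (hh : ∀ z ∈ K, h' z = h z) : HasLog K h' := by
  obtain ⟨g, hg, hgh⟩ := H
  exact ⟨g, hg, fun z hz => (hh z hz).trans (hgh z hz)⟩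

theorem HasLog.mul (H : HasLog K h) (H' : HasLog K h') : HasLog K (fun z => h z * h' z) := by
  obtain ⟨g, hg, hgh⟩ := H
  obtain ⟨g', hg', hgh'⟩ := H'
  refine ⟨fun z => g z + g' z, hg.add hg', fun z hz => ?_⟩
  simp only [Complex.exp_add, hgh z hz, hgh' z hz]

theorem HasLog.inv (H : HasLog K h) : HasLog K (fun z => (h z)⁻¹) := by
  obtain ⟨g, hg, hgh⟩ := H
  refine ⟨fun z => - g z, hg.neg, fun z hz => ?_⟩
  simp only [Complex.exp_neg, hgh z hz]

theorem HasLog.div (H : HasLog K h) (H' : HasLog K h') : HasLog K (fun z => h z / h' z) := by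
  simpa only [div_eq_mul_inv] using H.mul H'.inv

theorem HasLog.zpow (H : HasLog K h) (n : ℤ) : HasLog K (fun z => h z ^ n) := by
  obtain ⟨g, hg, hgh⟩ := H
  refine ⟨fun z => n * g z, continuousOn_const.mul hg, fun z hz => ?_⟩
  simp only [hgh z hz]
  rw [Complex.exp_int_mul]

theorem hasLog_const (K : Set X) {c : ℂ} (hc : c ≠ 0) : HasLog K (fun _ => c) :=
  ⟨fun _ => Complex.log c, continuousOn_const, fun _ _ => (Complex.exp_log hc).symm⟩

theorem HasLog.comp {M : Set Y} (H : HasLog K h) {φ : Y → X} (hφ : ContinuousOn φ M)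
    (hm : Set.MapsTo φ M K) : HasLog M (fun y => h (φ y)) := by
  obtain ⟨g, hg, hgh⟩ := H
  exact ⟨fun y => g (φ y), hg.comp hφ hm, fun z hz => hgh _ (hm hz)⟩

theorem HasLog.of_re_pos (hc : ContinuousOn h K) (hpos : ∀ z ∈ K, 0 < (h z).re) : HasLog K h := by
  refine ⟨fun z => Complex.log (h z), hc.clog fun z hz => Or.inl (hpos z hz), fun z hz => ?_⟩
  rw [Complex.exp_log]
  intro h0
  have := hpos z hz
  simp [h0] at this

theorem HasLog.of_norm_sub_lt (H : HasLog K h) (hc : ContinuousOn h K) (hc' : ContinuousOn h' K)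
    (hlt : ∀ z ∈ K, ‖h' z - h z‖ < ‖h z‖) : HasLog K h' := by
  have hne : ∀ z ∈ K, h z ≠ 0 := fun z hz h0 => by
    have := hlt z hz
    rw [h0, norm_zero] at this
    exact absurd this (not_lt.2 (norm_nonneg _))
  have hq : HasLog K (fun z => h' z / h z) := by
    refine HasLog.of_re_pos (hc'.div hc hne) fun z hz => ?_
    have h1 : h' z / h z = 1 + (h' z - h z) / h z := by field_simp [hne z hz]; ring
    have h2 : ‖(h' z - h z) / h z‖ < 1 := by
      rw [norm_div, div_lt_one (norm_pos_iff.2 (hne z hz))]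
      exact hlt z hz
    have h3 := (abs_le.1 (Complex.abs_re_le_norm ((h' z - h z) / h z))).1
    rw [h1, Complex.add_re, Complex.one_re]
    linarith
  refine (H.mul hq).congr fun z hz => ?_
  field_simp [hne z hz]

theorem hasLog_of_simplyConnected [SimplyConnectedSpace X] [LocallyPathConnectedSpace X]
    (hc : Continuous h) (h0 : ∀ z, h z ≠ 0) : HasLog Set.univ h := by
  obtain ⟨f, hf, hfe⟩ := Complex.exists_continuousOn_eqOn_exp_comp (U := (Set.univ : Set X))
    ((Homeomorph.Set.univ X).toHomotopyEquiv.simplyConnectedSpace_iff.2 ‹_›)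
    isOpen_univ hc.continuousOn (by simpa using h0)
  exact ⟨f, hf, fun z hz => (hfe hz).symm⟩

theorem ContinuousOn.piecewise_union {Z : Type*} [TopologicalSpace Z] (hK : IsClosed K)
    (hL : IsClosed L) {f g : X → Z} (hf : ContinuousOn f K) (hg : ContinuousOn g L)
    (hfg : ∀ z ∈ K, z ∈ L → f z = g z) : ContinuousOn (K.piecewise f g) (K ∪ L) := by
  refine ContinuousOn.union_of_isClosed ?_ ?_ hK hL
  · exact hf.congr fun z hz => Set.piecewise_eq_of_mem _ _ _ hz
  · refine hg.congr fun z hz => ?_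
    by_cases hzK : z ∈ K
    · rw [Set.piecewise_eq_of_mem _ _ _ hzK, hfg z hzK hz]
    · exact Set.piecewise_eq_of_notMem _ _ _ hzK

theorem IsPreconnected.eq_of_exp_eq_one (hK : IsPreconnected K) {g : X → ℂ} (hg : ContinuousOn g K)
    (h1 : ∀ z ∈ K, Complex.exp (g z) = 1) {x y : X} (hx : x ∈ K) (hy : y ∈ K) : g x = g y := by
  have hdisc : IsDiscrete (Set.range ((↑) : ℤ → ℝ)) :=
    Int.isClosedEmbedding_coe_real.isInducing.isDiscrete_range
  have hn : ∀ z ∈ K, ∃ n : ℤ, g z = n * (2 * Real.pi * Complex.I) := fun z hz =>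
    Complex.exp_eq_one_iff.1 (h1 z hz)
  have key : ∀ z ∈ K, ∀ n : ℤ, g z = n * (2 * Real.pi * Complex.I) →
      (g z / (2 * Real.pi * Complex.I)).re = n := by
    intro z hz n hn
    rw [hn, mul_div_assoc, div_self Complex.two_pi_I_ne_zero, mul_one]
    simp
  have := hK.constant_of_mapsTo hdisc (T := Set.range ((↑) : ℤ → ℝ))
    (f := fun z => (g z / (2 * Real.pi * Complex.I)).re)
    (Complex.continuous_re.comp_continuousOn (hg.div_const _))
    (fun z hz => by
      obtain ⟨n, hn⟩ := hn z hz
      exact ⟨n, (key z hz n hn).symm⟩) hx hy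
  obtain ⟨n, hnx⟩ := hn x hx
  obtain ⟨m, hmy⟩ := hn y hy
  simp only [key x hx n hnx, key y hy m hmy] at this
  rw [hnx, hmy]
  norm_cast at this
  rw [this]

theorem HasLog.union (hK : IsClosed K) (hL : IsClosed L) (hc : IsPreconnected (K ∩ L))
    (H : HasLog K h) (H' : HasLog L h) : HasLog (K ∪ L) h := by
  obtain ⟨g, hg, hgh⟩ := H
  obtain ⟨g', hg', hgh'⟩ := H'
  have hex : ∀ z ∈ K ∩ L, Complex.exp (g z - g' z) = 1 := fun z hz => by
    rw [Complex.exp_sub, ← hgh z hz.1, ← hgh' z hz.2, div_self]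
    rw [hgh z hz.1]
    exact Complex.exp_ne_zero _
  obtain ⟨d, hd, hd'⟩ : ∃ d : ℂ, Complex.exp d = 1 ∧ ∀ z ∈ K ∩ L, g z = g' z + d := by
    rcases (K ∩ L).eq_empty_or_nonempty with he | ⟨x, hx⟩
    · exact ⟨0, Complex.exp_zero, by simp [he]⟩
    · refine ⟨g x - g' x, hex x hx, fun z hz => ?_⟩
      have := hc.eq_of_exp_eq_one
        ((hg.mono Set.inter_subset_left).sub (hg'.mono Set.inter_subset_right)) hex hz hx
      simp only [Pi.sub_apply] at this
      rw [← this]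
      ring
  refine ⟨K.piecewise g (fun z => g' z + d),
    ContinuousOn.piecewise_union hK hL hg (hg'.add continuousOn_const)
      fun z h1 h2 => hd' z ⟨h1, h2⟩, fun z hz => ?_⟩
  by_cases hzK : z ∈ K
  · rw [Set.piecewise_eq_of_mem _ _ _ hzK, hgh z hzK]
  · rw [Set.piecewise_eq_of_notMem _ _ _ hzK, Complex.exp_add, hd, mul_one]
    exact hgh' z (hz.resolve_left hzK)

end HasLog

/-- The identification of the real plane with the complex plane. -/
def toC (z : ℝ × ℝ) : ℂ := ⟨z.1, z.2⟩

theorem continuous_toC : Continuous toC := Complex.equivRealProdCLM.symm.continuous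

theorem toC_injective : Function.Injective toC := Complex.equivRealProdCLM.symm.injective

theorem toC_sub_ne_zero {z a : ℝ × ℝ} (h : z ≠ a) : toC z - toC a ≠ 0 :=
  sub_ne_zero.2 fun e => h (toC_injective e)

theorem exponent_eq_zero_of_hasLog {U : Set (ℝ × ℝ)} (hU : IsOpen U)
    (hb : Bornology.IsBounded U) {a : ℝ × ℝ} (ha : a ∈ U) (n : ℤ) {φ : ℝ × ℝ → ℂ}
    (hφ : ContinuousOn φ (closure U)) (hφ0 : ∀ z ∈ closure U, φ z ≠ 0)
    (hlog : HasLog (frontier U) (fun z => (toC z - toC a) ^ n * φ z)) : n = 0 := by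
  obtain ⟨g, hg, hgh⟩ := hlog
  obtain ⟨G, hG⟩ := ContinuousMap.exists_restrict_eq (isClosed_frontier (s := U))
    (⟨(frontier U).domRestrict g, continuousOn_iff_continuous_domRestrict.1 hg⟩ : C(frontier U, ℂ))
  have hGg : ∀ z ∈ frontier U, G z = g z := fun z hz => by
    have := congrArg (fun F : C(frontier U, ℂ) => F ⟨z, hz⟩) hG
    simpa using this
  set F : ℝ × ℝ → ℂ := (closure U).piecewise (fun z => Complex.exp (G z) / φ z)
    (fun z => (toC z - toC a) ^ n) with hF
  have hane : ∀ z ∈ Uᶜ, toC z - toC a ≠ 0 := fun z hz =>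
    toC_sub_ne_zero fun e => hz (e ▸ ha)
  have hFc : Continuous F := by
    have := ContinuousOn.piecewise_union (f := fun z => Complex.exp (G z) / φ z)
      (g := fun z => (toC z - toC a) ^ n) (isClosed_closure (s := U)) hU.isClosed_compl
      ((Complex.continuous_exp.comp G.continuous).continuousOn.div hφ hφ0)
      (ContinuousOn.zpow₀ (continuous_toC.sub continuous_const).continuousOn n
        fun z hz => Or.inl (hane z hz))
      (fun z hz hz' => by
        have hzf : z ∈ frontier U := by
          rw [hU.frontier_eq]
          exact ⟨hz, hz'⟩
        rw [hGg z hzf, ← hgh z hzf, mul_div_assoc, div_self (hφ0 z hz), mul_one])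
    rw [← continuousOn_univ]
    refine this.mono fun z _ => ?_
    by_cases hz : z ∈ U
    · exact Or.inl (subset_closure hz)
    · exact Or.inr hz
  have hF0 : ∀ z, F z ≠ 0 := fun z => by
    by_cases hz : z ∈ closure U
    · rw [hF, Set.piecewise_eq_of_mem _ _ _ hz]
      exact div_ne_zero (Complex.exp_ne_zero _) (hφ0 z hz)
    · rw [hF, Set.piecewise_eq_of_notMem _ _ _ hz]
      exact zpow_ne_zero _ (hane z fun h => hz (subset_closure h))
  obtain ⟨l, hl, hlF⟩ := hasLog_of_simplyConnected hFc hF0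
  rw [continuousOn_univ] at hl
  obtain ⟨R, hR⟩ := hb.closure.subset_closedBall a
  set r : ℝ := |R| + 1 with hr
  have hr0 : 0 < r := by positivity
  set ζ : ℝ → ℝ × ℝ := fun t =>
    Complex.equivRealProdCLM (toC a + 2 * r * Complex.exp (t * Complex.I))
    with hζ
  have hζc : Continuous ζ := by fun_prop
  have hζC : ∀ t, toC (ζ t) = toC a + 2 * r * Complex.exp (t * Complex.I) := fun t => by
    simp only [hζ]
    exact Complex.equivRealProdCLM.symm_apply_apply _
  have hout : ∀ t, ζ t ∉ closure U := fun t ht => by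
    have h1 := hR ht
    have h2 : ‖toC (ζ t) - toC a‖ = 2 * r := by
      rw [hζC]
      simp [Complex.norm_exp_ofReal_mul_I, abs_of_pos hr0]
    have h3 : ‖toC (ζ t) - toC a‖ ≤ 2 * R := by
      rw [Metric.mem_closedBall, Prod.dist_eq, max_le_iff, Real.dist_eq, Real.dist_eq] at h1
      refine (Complex.norm_le_abs_re_add_abs_im _).trans ?_
      have e1 : (toC (ζ t) - toC a).re = (ζ t).1 - a.1 := rfl
      have e2 : (toC (ζ t) - toC a).im = (ζ t).2 - a.2 := rfl
      rw [e1, e2]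
      linarith [h1.1, h1.2]
    have := le_abs_self R
    linarith
  have hr2 : (2 * (r : ℂ)) ≠ 0 := by
    have : (r : ℂ) ≠ 0 := by exact_mod_cast hr0.ne'
    simpa using this
  have hval : ∀ t : ℝ, Complex.exp (l (ζ t)) =
      Complex.exp (n * (Complex.log (2 * r) + t * Complex.I)) := fun t => by
    rw [← hlF _ (Set.mem_univ _), hF, Set.piecewise_eq_of_notMem _ _ _ (hout t), hζC]
    rw [Complex.exp_int_mul, Complex.exp_add, Complex.exp_log hr2]
    ring_nf
  have hconst := (isPreconnected_univ (α := ℝ)).eq_of_exp_eq_one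
    (g := fun t : ℝ => l (ζ t) - n * (Complex.log (2 * r) + t * Complex.I))
    (by fun_prop) (fun t _ => by
      rw [Complex.exp_sub, hval, div_self (Complex.exp_ne_zero _)])
    (Set.mem_univ 0) (Set.mem_univ (2 * Real.pi))
  have hper : ζ (2 * Real.pi) = ζ 0 := by
    simp [hζ]
  simp only [hper] at hconst
  have h4 : (n : ℂ) * (2 * Real.pi * Complex.I) = 0 := by
    push_cast at hconst
    linear_combination hconst
  rcases mul_eq_zero.1 h4 with h5 | h5
  · exact_mod_cast h5
  · exact absurd h5 Complex.two_pi_I_ne_zero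

/-- The points `a` and `b` lie in a common component of the complement of `K`. -/
def SameComp (K : Set (ℝ × ℝ)) (a b : ℝ × ℝ) : Prop := b ∈ connectedComponentIn Kᶜ a

section SameComp

variable {K L S : Set (ℝ × ℝ)} {a b c : ℝ × ℝ}

theorem SameComp.left_notMem (h : SameComp K a b) : a ∉ K :=
  connectedComponentIn_nonempty_iff.1 ⟨b, h⟩

theorem SameComp.right_notMem (h : SameComp K a b) : b ∉ K := connectedComponentIn_subset _ _ h

theorem SameComp.comp_eq (h : SameComp K a b) :
    connectedComponentIn Kᶜ a = connectedComponentIn Kᶜ b := connectedComponentIn_eq h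

theorem SameComp.symm (h : SameComp K a b) : SameComp K b a := by
  rw [SameComp, ← h.comp_eq]
  exact mem_connectedComponentIn h.left_notMem

theorem SameComp.trans (h : SameComp K a b) (h' : SameComp K b c) : SameComp K a c := by
  rw [SameComp, h.comp_eq]
  exact h'

theorem IsPreconnected.sameComp (hS : IsPreconnected S) (hSK : Disjoint S K) (ha : a ∈ S)
    (hb : b ∈ S) : SameComp K a b :=
  hS.subset_connectedComponentIn ha hSK.subset_compl_right hb

theorem SameComp.mono (h : SameComp L a b) (hKL : K ⊆ L) : SameComp K a b :=
  isPreconnected_connectedComponentIn.sameComp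
    (Set.disjoint_left.2 fun _ hz hzK =>
      (connectedComponentIn_subset _ _ hz : _ ∈ Lᶜ) (hKL hzK))
    (mem_connectedComponentIn h.left_notMem) h

theorem isOpen_comp (hK : IsClosed K) (a : ℝ × ℝ) : IsOpen (connectedComponentIn Kᶜ a) :=
  hK.isOpen_compl.connectedComponentIn

theorem closure_comp_subset (hK : IsClosed K) (a : ℝ × ℝ) :
    closure (connectedComponentIn Kᶜ a) ⊆ connectedComponentIn Kᶜ a ∪ K := by
  intro z hz
  by_cases hzK : z ∈ K
  · exact Or.inr hzK
  · left
    obtain ⟨w, hw, hwa⟩ := mem_closure_iff.1 hz _ (isOpen_comp hK z)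
      (mem_connectedComponentIn hzK)
    exact SameComp.trans hwa (SameComp.symm hw)

theorem frontier_comp_subset (hK : IsClosed K) (a : ℝ × ℝ) :
    frontier (connectedComponentIn Kᶜ a) ⊆ K := by
  rw [(isOpen_comp hK a).frontier_eq]
  exact fun z hz => (closure_comp_subset hK a hz.1).resolve_left hz.2

theorem comp_eq_of_frontier_subset (hL : IsClosed L) (hKL : K ⊆ L) (ha : a ∉ L)
    (hf : frontier (connectedComponentIn Lᶜ a) ⊆ K) :
    connectedComponentIn Kᶜ a = connectedComponentIn Lᶜ a := by
  have hsub : connectedComponentIn Lᶜ a ⊆ connectedComponentIn Kᶜ a :=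
    fun z hz => SameComp.mono hz hKL
  refine Set.Subset.antisymm ?_ hsub
  refine (isPreconnected_connectedComponentIn (x := a) (F := Kᶜ)).subset_of_closure_inter_subset
    (isOpen_comp hL a) ⟨a, mem_connectedComponentIn fun h => ha (hKL h),
      mem_connectedComponentIn ha⟩ ?_
  rintro z ⟨hz, hzK⟩
  by_contra hzL
  exact connectedComponentIn_subset _ _ hzK (hf ⟨hz, fun h => hzL (interior_subset h)⟩)

end SameComp

theorem isPreconnected_compl_closedBall (R : ℝ) :
    IsPreconnected (Metric.closedBall (0 : ℝ × ℝ) R)ᶜ := by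
  rcases lt_or_ge R 0 with hR | hR
  · rw [Metric.closedBall_eq_empty.2 hR, Set.compl_empty]
    exact isPreconnected_univ
  have hrank : 1 < Module.rank ℝ (ℝ × ℝ) := by
    rw [rank_prod', Module.rank_self]
    norm_num
  have := ((isPreconnected_sphere hrank (0 : ℝ × ℝ) 1).prod (isPreconnected_Ioi (a := R))).image
    (fun x : (ℝ × ℝ) × ℝ => x.2 • x.1) (by fun_prop)
  convert this using 1
  ext z
  simp only [Set.mem_compl_iff, Metric.mem_closedBall, dist_zero_right, not_le, Set.mem_image,
    Set.mem_prod, mem_sphere_iff_norm, sub_zero, Set.mem_Ioi]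
  constructor
  · intro hz
    have hz0 : ‖z‖ ≠ 0 := by linarith
    exact ⟨(‖z‖⁻¹ • z, ‖z‖), ⟨by rw [norm_smul, norm_inv, norm_norm, inv_mul_cancel₀ hz0], hz⟩,
      by simp [smul_smul, mul_inv_cancel₀ hz0]⟩
  · rintro ⟨⟨s, r⟩, ⟨hs, hr⟩, rfl⟩
    simp only at hs hr ⊢
    rw [norm_smul, hs, mul_one, Real.norm_of_nonneg (by linarith)]
    exact hr

theorem sameComp_of_not_isBounded {K : Set (ℝ × ℝ)} (hK : IsCompact K) {a b : ℝ × ℝ}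
    (ha : ¬ Bornology.IsBounded (connectedComponentIn Kᶜ a))
    (hb : ¬ Bornology.IsBounded (connectedComponentIn Kᶜ b)) : SameComp K a b := by
  obtain ⟨R, hR⟩ := hK.isBounded.subset_closedBall 0
  have key : ∀ c, ¬ Bornology.IsBounded (connectedComponentIn Kᶜ c) →
      ∃ d, d ∉ Metric.closedBall (0 : ℝ × ℝ) R ∧ SameComp K c d := fun c hc => by
    by_contra! h
    exact hc (Metric.isBounded_closedBall.subset fun d hd => by_contra fun h' => h d h' hd)
  obtain ⟨a', ha', haa'⟩ := key a ha
  obtain ⟨b', hb', hbb'⟩ := key b hb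
  refine (haa'.trans ?_).trans hbb'.symm
  exact (isPreconnected_compl_closedBall R).sameComp
    (Set.disjoint_left.2 fun z hz hzK => hz (hR hzK)) ha' hb'

theorem dist_le_norm_toC_sub (z w : ℝ × ℝ) : dist z w ≤ ‖toC z - toC w‖ := by
  rw [Prod.dist_eq, max_le_iff, Real.dist_eq, Real.dist_eq]
  exact ⟨Complex.abs_re_le_norm (toC z - toC w), Complex.abs_im_le_norm (toC z - toC w)⟩

theorem continuousOn_div_toC {K : Set (ℝ × ℝ)} (a : ℝ × ℝ) {b : ℝ × ℝ} (hb : b ∉ K) :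
    ContinuousOn (fun z => (toC z - toC a) / (toC z - toC b)) K :=
  ContinuousOn.div (continuous_toC.sub continuous_const).continuousOn
    (continuous_toC.sub continuous_const).continuousOn
    fun _ hz => toC_sub_ne_zero fun e => hb (e ▸ hz)

theorem SameComp.hasLog {K : Set (ℝ × ℝ)} (hK : IsClosed K) {a b : ℝ × ℝ} (h : SameComp K a b) :
    HasLog K (fun z => (toC z - toC a) / (toC z - toC b)) := by
  refine (isPreconnected_connectedComponentIn (x := a) (F := Kᶜ)).induction₂
    (fun a b => HasLog K (fun z => (toC z - toC a) / (toC z - toC b))) ?_ ?_ ?_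
    (mem_connectedComponentIn h.left_notMem) h
  · intro x hx
    have hxK : x ∉ K := connectedComponentIn_subset _ _ hx
    obtain ⟨ε, hε, hball⟩ := Metric.isOpen_iff.1 hK.isOpen_compl x hxK
    have hfar : ∀ z ∈ K, ε ≤ ‖toC z - toC x‖ := fun z hz =>
      (not_lt.1 fun hlt => hball hlt hz).trans (dist_le_norm_toC_sub z x)
    refine nhdsWithin_le_nhds ?_
    have hcont : Filter.Tendsto (fun y => ‖toC y - toC x‖) (nhds x) (nhds 0) := by
      have : Continuous fun y => ‖toC y - toC x‖ := (continuous_toC.sub continuous_const).norm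
      simpa using this.tendsto x
    filter_upwards [hcont.eventually (gt_mem_nhds (half_pos hε))] with y hy
    have hlt : ∀ z ∈ K, ‖toC y - toC x‖ < ‖toC z - toC y‖ := fun z hz => by
      have h1 := hfar z hz
      have h2 : ‖toC z - toC x‖ ≤ ‖toC z - toC y‖ + ‖toC y - toC x‖ := by
        simpa using norm_add_le (toC z - toC y) (toC y - toC x)
      linarith
    have hyK : y ∉ K := fun h' => by
      have := hlt y h'
      simp only [sub_self, norm_zero] at this
      exact absurd this (not_lt.2 (norm_nonneg _))
    refine (hasLog_const K one_ne_zero).of_norm_sub_lt continuousOn_const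
      (continuousOn_div_toC x hyK) fun z hz => ?_
    have hne : toC z - toC y ≠ 0 := toC_sub_ne_zero fun e => hyK (e ▸ hz)
    rw [norm_one, div_sub_one hne, norm_div, div_lt_one (norm_pos_iff.2 hne)]
    simpa using hlt z hz
  · intro x y z _ hy _ hxy hyz
    refine (hxy.mul hyz).congr fun w hw => ?_
    have : toC w - toC y ≠ 0 :=
      toC_sub_ne_zero fun e => connectedComponentIn_subset _ _ hy (e ▸ hw)
    rw [div_mul_div_cancel₀ this]
  · intro x y _ _ hxy
    exact hxy.inv.congr fun w _ => (inv_div _ _).symm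

theorem sameComp_of_hasLog {K : Set (ℝ × ℝ)} (hK : IsCompact K) {a b : ℝ × ℝ} (ha : a ∉ K)
    (hb : b ∉ K) (h : HasLog K (fun z => (toC z - toC a) / (toC z - toC b))) : SameComp K a b := by
  have key : ∀ a b, a ∉ K → b ∉ K → HasLog K (fun z => (toC z - toC a) / (toC z - toC b)) →
      ¬ SameComp K a b → ¬ Bornology.IsBounded (connectedComponentIn Kᶜ a) := by
    intro a b ha hb h hn hbd
    have hbcl : ∀ z ∈ closure (connectedComponentIn Kᶜ a), toC z - toC b ≠ 0 := fun z hz =>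
      toC_sub_ne_zero fun e => by
        subst e
        exact (closure_comp_subset hK.isClosed a hz).elim hn hb
    have := exponent_eq_zero_of_hasLog (isOpen_comp hK.isClosed a) hbd
      (mem_connectedComponentIn ha) 1 (φ := fun z => (toC z - toC b)⁻¹)
      ((continuous_toC.sub continuous_const).continuousOn.inv₀ hbcl)
      (fun z hz => inv_ne_zero (hbcl z hz))
      ((h.mono (frontier_comp_subset hK.isClosed a)).congr fun z _ => by
        rw [zpow_one, div_eq_mul_inv])
    exact one_ne_zero this
  by_contra hn
  exact hn (sameComp_of_not_isBounded hK (key a b ha hb h hn)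
    (key b a hb ha (h.inv.congr fun z _ => (inv_div _ _).symm) fun h' => hn h'.symm))

theorem SameComp.union {K L : Set (ℝ × ℝ)} (hK : IsCompact K) (hL : IsCompact L)
    (hc : IsPreconnected (K ∩ L)) {a b : ℝ × ℝ} (h : SameComp K a b) (h' : SameComp L a b) :
    SameComp (K ∪ L) a b :=
  sameComp_of_hasLog (hK.union hL) (fun ha => ha.elim h.left_notMem h'.left_notMem)
    (fun hb => hb.elim h.right_notMem h'.right_notMem)
    ((h.hasLog hK.isClosed).union hK.isClosed hL.isClosed hc (h'.hasLog hL.isClosed))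

section Curve

variable {γ : ℝ → ℝ × ℝ} {s t : ℝ}

theorem exists_leftInverse_of_injOn (hc : ContinuousOn γ (Set.Icc s t))
    (hi : Set.InjOn γ (Set.Icc s t)) :
    ∃ σ : ℝ × ℝ → ℝ, ContinuousOn σ (γ '' Set.Icc s t) ∧ ∀ x ∈ Set.Icc s t, σ (γ x) = x := by
  refine ⟨Function.invFunOn γ (Set.Icc s t), ?_, fun x hx => hi.leftInvOn_invFunOn hx⟩
  rw [continuousOn_iff_isClosed]
  intro T hT
  refine ⟨γ '' (Set.Icc s t ∩ T),
    ((isCompact_Icc.inter_right hT).image_of_continuousOn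
      (hc.mono Set.inter_subset_left)).isClosed, ?_⟩
  ext z
  simp only [Set.mem_inter_iff, Set.mem_preimage]
  constructor
  · rintro ⟨hz, x, hx, rfl⟩
    rw [hi.leftInvOn_invFunOn hx] at hz
    exact ⟨⟨x, ⟨hx, hz⟩, rfl⟩, x, hx, rfl⟩
  · rintro ⟨⟨x, ⟨hx, hxT⟩, rfl⟩, h⟩
    exact ⟨by rwa [hi.leftInvOn_invFunOn hx], h⟩

theorem hasLog_image_Icc (hst : s ≤ t) (hc : ContinuousOn γ (Set.Icc s t))
    (hi : Set.InjOn γ (Set.Icc s t)) {f : ℝ × ℝ → ℂ} (hf : ContinuousOn f (γ '' Set.Icc s t))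
    (hf0 : ∀ z ∈ γ '' Set.Icc s t, f z ≠ 0) : HasLog (γ '' Set.Icc s t) f := by
  obtain ⟨σ, hσ, hσγ⟩ := exists_leftInverse_of_injOn hc hi
  have hcont : Continuous fun x : ℝ => f (γ (Set.projIcc s t hst x)) := by
    rw [← continuousOn_univ]
    exact hf.comp (hc.comp (continuous_subtype_val.comp continuous_projIcc).continuousOn
      fun x _ => (Set.projIcc s t hst x).2) fun x _ => ⟨_, (Set.projIcc s t hst x).2, rfl⟩
  have := (hasLog_of_simplyConnected hcont fun x =>
    hf0 _ ⟨_, (Set.projIcc s t hst x).2, rfl⟩).comp hσ (Set.mapsTo_univ _ _)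
  refine this.congr ?_
  rintro _ ⟨x, hx, rfl⟩
  rw [hσγ x hx, Set.projIcc_of_mem hst hx]

theorem sameComp_image_Icc (hst : s ≤ t) (hc : ContinuousOn γ (Set.Icc s t))
    (hi : Set.InjOn γ (Set.Icc s t)) {a b : ℝ × ℝ} (ha : a ∉ γ '' Set.Icc s t)
    (hb : b ∉ γ '' Set.Icc s t) : SameComp (γ '' Set.Icc s t) a b :=
  sameComp_of_hasLog (isCompact_Icc.image_of_continuousOn hc) ha hb
    (hasLog_image_Icc hst hc hi (continuousOn_div_toC a hb) fun _ hz =>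
      div_ne_zero (toC_sub_ne_zero fun e => ha (e ▸ hz)) (toC_sub_ne_zero fun e => hb (e ▸ hz)))

end Curve

/-- `A` is a simple arc with endpoints `p` and `q`. -/
def IsArc (A : Set (ℝ × ℝ)) (p q : ℝ × ℝ) : Prop :=
  ∃ γ : ℝ → ℝ × ℝ, ContinuousOn γ (Set.Icc 0 1) ∧ Set.InjOn γ (Set.Icc 0 1) ∧
    γ 0 = p ∧ γ 1 = q ∧ γ '' Set.Icc 0 1 = A

namespace IsArc

variable {A B : Set (ℝ × ℝ)} {p q r : ℝ × ℝ}

theorem left_mem (h : IsArc A p q) : p ∈ A := by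
  obtain ⟨γ, -, -, rfl, -, rfl⟩ := h
  exact ⟨0, by simp, rfl⟩

theorem symm (h : IsArc A p q) : IsArc A q p := by
  obtain ⟨γ, hc, hi, h0, h1, hA⟩ := h
  have hm : Set.MapsTo (fun t : ℝ => 1 - t) (Set.Icc 0 1) (Set.Icc 0 1) := fun t ht =>
    ⟨by linarith [ht.2], by linarith [ht.1]⟩
  refine ⟨fun t => γ (1 - t), hc.comp (by fun_prop) hm, fun x hx y hy hxy => ?_, by simpa,
    by simpa, ?_⟩
  · have := hi (hm hx) (hm hy) hxy
    linarith
  · rw [← hA]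
    ext z
    constructor
    · rintro ⟨t, ht, rfl⟩
      exact ⟨1 - t, hm ht, rfl⟩
    · rintro ⟨t, ht, rfl⟩
      exact ⟨1 - t, hm ht, by simp⟩

theorem right_mem (h : IsArc A p q) : q ∈ A := h.symm.left_mem

theorem isCompact (h : IsArc A p q) : IsCompact A := by
  obtain ⟨γ, hc, -, -, -, rfl⟩ := h
  exact isCompact_Icc.image_of_continuousOn hc

theorem isClosed (h : IsArc A p q) : IsClosed A := h.isCompact.isClosed

theorem isPreconnected (h : IsArc A p q) : IsPreconnected A := by
  obtain ⟨γ, hc, -, -, -, rfl⟩ := h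
  exact isPreconnected_Icc.image _ hc

theorem sameComp (h : IsArc A p q) {a b : ℝ × ℝ} (ha : a ∉ A) (hb : b ∉ A) : SameComp A a b := by
  obtain ⟨γ, hc, hi, -, -, rfl⟩ := h
  exact sameComp_image_Icc zero_le_one hc hi ha hb

theorem diff_eq_image {γ : ℝ → ℝ × ℝ} (hi : Set.InjOn γ (Set.Icc 0 1)) :
    γ '' Set.Icc 0 1 \ {γ 0, γ 1} = γ '' Set.Ioo 0 1 := by
  ext z
  constructor
  · rintro ⟨⟨t, ht, rfl⟩, hz⟩
    simp only [Set.mem_insert_iff, Set.mem_singleton_iff, not_or] at hz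
    exact ⟨t, ⟨lt_of_le_of_ne ht.1 fun e => hz.1 (by rw [e]),
      lt_of_le_of_ne ht.2 fun e => hz.2 (by rw [e])⟩, rfl⟩
  · rintro ⟨t, ht, rfl⟩
    refine ⟨⟨t, ⟨ht.1.le, ht.2.le⟩, rfl⟩, ?_⟩
    rintro (h | h)
    · exact ht.1.ne' (hi ⟨ht.1.le, ht.2.le⟩ (by simp) h)
    · exact ht.2.ne (hi ⟨ht.1.le, ht.2.le⟩ (by simp) h)

theorem isPreconnected_diff (h : IsArc A p q) : IsPreconnected (A \ {p, q}) := by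
  obtain ⟨γ, hc, hi, rfl, rfl, rfl⟩ := h
  rw [diff_eq_image hi]
  exact isPreconnected_Ioo.image _ (hc.mono Set.Ioo_subset_Icc_self)

theorem diff_nonempty (h : IsArc A p q) : (A \ {p, q}).Nonempty := by
  obtain ⟨γ, hc, hi, rfl, rfl, rfl⟩ := h
  rw [diff_eq_image hi]
  exact ⟨γ (1 / 2), 1 / 2, by norm_num, rfl⟩

theorem subset_closure_diff (h : IsArc A p q) : A ⊆ closure (A \ {p, q}) := by
  obtain ⟨γ, hc, hi, rfl, rfl, rfl⟩ := h
  rw [diff_eq_image hi]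
  have h01 : Set.Icc (0 : ℝ) 1 = closure (Set.Ioo 0 1) := (closure_Ioo zero_ne_one).symm
  rw [h01]
  exact ContinuousOn.image_closure (h01 ▸ hc)

theorem union (hA : IsArc A p q) (hB : IsArc B q r) (hAB : A ∩ B ⊆ {q}) : IsArc (A ∪ B) p r := by
  obtain ⟨γ, hc, hi, rfl, hq, rfl⟩ := hA
  obtain ⟨δ, hc', hi', hq', rfl, rfl⟩ := hB
  have hm1 : Set.MapsTo (fun t : ℝ => 2 * t) (Set.Icc 0 (1 / 2)) (Set.Icc 0 1) := fun t ht =>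
    ⟨by linarith [ht.1], by linarith [ht.2]⟩
  have hm2 : Set.MapsTo (fun t : ℝ => 2 * t - 1) (Set.Icc (1 / 2) 1) (Set.Icc 0 1) := fun t ht =>
    ⟨by linarith [ht.1], by linarith [ht.2]⟩
  have hU : Set.Icc (0 : ℝ) (1 / 2) ∪ Set.Icc (1 / 2) 1 = Set.Icc 0 1 :=
    Set.Icc_union_Icc_eq_Icc (by norm_num) (by norm_num)
  set ε : ℝ → ℝ × ℝ := (Set.Icc (0 : ℝ) (1 / 2)).piecewise (fun t => γ (2 * t))
    (fun t => δ (2 * t - 1)) with hε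
  have e1 : ∀ t ∈ Set.Icc (0 : ℝ) (1 / 2), ε t = γ (2 * t) := fun t ht =>
    Set.piecewise_eq_of_mem _ _ _ ht
  have e2 : ∀ t ∈ Set.Icc (1 / 2 : ℝ) 1, ε t = δ (2 * t - 1) := fun t ht => by
    rcases eq_or_lt_of_le ht.1 with he | hlt
    · rw [e1 t ⟨by rw [← he]; norm_num, he.ge⟩, ← he]
      norm_num
      rw [hq, hq']
    · exact Set.piecewise_eq_of_notMem _ _ _ fun h => absurd h.2 (not_le.2 hlt)
  have hmix : ∀ x ∈ Set.Icc (0 : ℝ) (1 / 2), ∀ y ∈ Set.Icc (1 / 2 : ℝ) 1, ε x = ε y → x = y := by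
    intro x hx y hy hxy
    have h1 := e1 x hx
    have h2 := e2 y hy
    have hmem : γ (2 * x) ∈ γ '' Set.Icc 0 1 ∩ δ '' Set.Icc 0 1 :=
      ⟨⟨_, hm1 hx, rfl⟩, by rw [← h1, hxy, h2]; exact ⟨_, hm2 hy, rfl⟩⟩
    have hx1 : γ (2 * x) = γ 1 := (hAB hmem).trans hq.symm
    have hy1 : δ (2 * y - 1) = δ 0 := by rw [← h2, ← hxy, h1, hx1, hq, hq']
    have := hi (hm1 hx) (by simp) hx1
    have := hi' (hm2 hy) (by simp) hy1
    linarith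
  refine ⟨ε, ?_, ?_, ?_, ?_, ?_⟩
  · rw [← hU]
    exact ((hc.comp (by fun_prop) hm1).congr e1).union_of_isClosed
      ((hc'.comp (by fun_prop) hm2).congr e2) isClosed_Icc isClosed_Icc
  · rw [← hU]
    rintro x (hx | hx) y (hy | hy) hxy
    · rw [e1 x hx, e1 y hy] at hxy
      have := hi (hm1 hx) (hm1 hy) hxy
      linarith
    · exact hmix x hx y hy hxy
    · exact (hmix y hy x hx hxy.symm).symm
    · rw [e2 x hx, e2 y hy] at hxy
      have := hi' (hm2 hx) (hm2 hy) hxy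
      linarith
  · rw [e1 0 (by norm_num)]
    norm_num
  · rw [e2 1 (by norm_num)]
    norm_num
  · rw [show ε '' Set.Icc 0 1 = ε '' Set.Icc 0 (1 / 2) ∪ ε '' Set.Icc (1 / 2) 1 by
      rw [← Set.image_union, hU]]
    congr 1
    · rw [Set.image_congr e1]
      ext z
      constructor
      · rintro ⟨t, ht, rfl⟩
        exact ⟨_, hm1 ht, rfl⟩
      · rintro ⟨t, ht, rfl⟩
        exact ⟨t / 2, ⟨by linarith [ht.1], by linarith [ht.2]⟩, by ring_nf⟩
    · rw [Set.image_congr e2]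
      ext z
      constructor
      · rintro ⟨t, ht, rfl⟩
        exact ⟨_, hm2 ht, rfl⟩
      · rintro ⟨t, ht, rfl⟩
        exact ⟨(t + 1) / 2, ⟨by linarith [ht.1], by linarith [ht.2]⟩, by ring_nf⟩

end IsArc

open ComplexConjugate in
theorem ContinuousLinearMap.exists_conj_decomposition (L : ℂ →L[ℝ] ℂ) :
    ∃ α β : ℂ, (∀ w, L w = α * w + β * conj w) ∧ (‖α‖ = ‖β‖ → L.det = 0) := by
  set α : ℂ := (L 1 - Complex.I * L Complex.I) / 2 with hα
  set β : ℂ := (L 1 + Complex.I * L Complex.I) / 2 with hβ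
  have hL : ∀ w, L w = α * w + β * conj w := by
    intro w
    have h1 : L w = w.re * L 1 + w.im * L Complex.I := by
      conv_lhs => rw [show w = w.re • (1 : ℂ) + w.im • Complex.I by
        simp [Complex.re_add_im]]
      rw [map_add, map_smul, map_smul]
      simp
    have h2 : w = w.re + w.im * Complex.I := (Complex.re_add_im w).symm
    have h3 : conj w = w.re - w.im * Complex.I := by
      apply Complex.ext <;> simp
    rw [h1, h3]
    conv_rhs => rw [h2]
    simp only [hα, hβ]
    have hI := Complex.I_mul_I
    simp only [Complex.add_re, Complex.add_im, Complex.ofReal_re, Complex.ofReal_im,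
      Complex.mul_re, Complex.mul_im, Complex.I_re, Complex.I_im]
    push_cast
    linear_combination (w.im * L Complex.I : ℂ) * hI
  refine ⟨α, β, hL, fun hn => ?_⟩
  have hker : ∃ w : ℂ, w ≠ 0 ∧ L w = 0 := by
    have hnn : α * conj α = β * conj β := by
      rw [Complex.mul_conj, Complex.mul_conj, Complex.normSq_eq_norm_sq, Complex.normSq_eq_norm_sq,
        hn]
    by_cases h1 : β = conj α
    · by_cases h2 : β = - conj α
      · have hβ0 : β = 0 := by linear_combination (h1 + h2) / 2
        have hα0 : α = 0 := by rwa [hβ0, norm_zero, norm_eq_zero] at hn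
        exact ⟨1, one_ne_zero, by rw [hL, hα0, hβ0]; simp⟩
      · refine ⟨β * Complex.I + conj α * Complex.I, ?_, ?_⟩
        · rw [← add_mul]
          exact mul_ne_zero (fun h => h2 (by linear_combination h)) Complex.I_ne_zero
        · rw [hL]
          simp only [map_add, map_mul, Complex.conj_I, Complex.conj_conj]
          linear_combination Complex.I * hnn
    · refine ⟨β - conj α, sub_ne_zero.2 h1, ?_⟩
      rw [hL]
      simp only [map_sub, Complex.conj_conj]
      linear_combination - hnn
  obtain ⟨w, hw, hw0⟩ := hker
  refine LinearMap.det_eq_zero_iff_ker_ne_bot.2 fun hb => hw ?_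
  exact (Submodule.eq_bot_iff _).1 hb w (LinearMap.mem_ker.2 hw0)

open ComplexConjugate in
theorem exists_hasLog_div_zpow_of_det_ne_zero {P : ℂ → ℂ} (hP : Continuous P) {a : ℂ}
    {L : ℂ →L[ℝ] ℂ} (hL : HasFDerivAt P L a) (ha : P a = 0) (hdet : L.det ≠ 0) :
    ∃ n : ℤ, ∃ ε > 0, (∀ z ∈ Metric.closedBall a ε \ {a}, P z ≠ 0) ∧
      HasLog (Metric.closedBall a ε \ {a}) (fun z => P z / (z - a) ^ n) := by
  obtain ⟨α, β, hab, hne⟩ := L.exists_conj_decomposition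
  have hne' : ‖α‖ ≠ ‖β‖ := fun h => hdet (hne h)
  set c : ℝ := |‖α‖ - ‖β‖| / 2 with hc
  have hc0 : 0 < c := by
    have := abs_pos.2 (sub_ne_zero.2 hne')
    positivity
  obtain ⟨ε, hε, hball⟩ := Metric.eventually_nhds_iff_ball.1 (hL.isLittleO.def hc0)
  have hbound : ∀ z ∈ Metric.closedBall a (ε / 2) \ {a},
      0 < ‖z - a‖ ∧ ‖P z - (α * (z - a) + β * conj (z - a))‖ ≤ c * ‖z - a‖ := fun z hz => by
    have := hball z (Metric.closedBall_subset_ball (half_lt_self hε) hz.1)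
    rw [ha, sub_zero, hab] at this
    exact ⟨norm_pos_iff.2 (sub_ne_zero.2 hz.2), this⟩
  have hcont : ∀ n : ℤ, ContinuousOn (fun z => P z / (z - a) ^ n)
      (Metric.closedBall a (ε / 2) \ {a}) := fun n =>
    hP.continuousOn.div (ContinuousOn.zpow₀ (by fun_prop) n
      fun z hz => Or.inl (sub_ne_zero.2 hz.2)) fun z hz => zpow_ne_zero _ (sub_ne_zero.2 hz.2)
  have hconj : ∀ w : ℂ, ‖conj w‖ = ‖w‖ := Complex.norm_conj
  rcases lt_or_gt_of_ne hne' with hlt | hlt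
  · have hc' : c = (‖β‖ - ‖α‖) / 2 := by rw [hc, abs_of_neg (by linarith)]; ring
    have hkey : ∀ z ∈ Metric.closedBall a (ε / 2) \ {a},
        ‖P z * (z - a) - β * (conj (z - a) * (z - a))‖ < ‖β * (conj (z - a) * (z - a))‖ := by
      intro z hz
      obtain ⟨h1, h2⟩ := hbound z hz
      have h3 : ‖P z - β * conj (z - a)‖ ≤ c * ‖z - a‖ + ‖α‖ * ‖z - a‖ := by
        rw [← norm_mul]
        refine le_trans ?_ (add_le_add_left h2 _)
        refine le_trans (le_of_eq ?_) (norm_add_le _ _)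
        ring_nf
      rw [show P z * (z - a) - β * (conj (z - a) * (z - a)) =
        (P z - β * conj (z - a)) * (z - a) by ring, norm_mul, norm_mul, norm_mul, hconj,
        ← mul_assoc]
      refine mul_lt_mul_of_pos_right (h3.trans_lt ?_) h1
      rw [← add_mul]
      exact mul_lt_mul_of_pos_right (by linarith) h1
    have hβ : β ≠ 0 := fun h => by
      rw [h, norm_zero] at hlt
      exact absurd hlt (not_lt.2 (norm_nonneg _))
    refine ⟨-1, ε / 2, half_pos hε, fun z hz h0 => ?_, ?_⟩
    · have := hkey z hz
      rw [h0, zero_mul, zero_sub, norm_neg] at this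
      exact lt_irrefl _ this
    · refine HasLog.of_norm_sub_lt (h := fun z => β * (conj (z - a) * (z - a))) ?_
        (by fun_prop) (hcont _) fun z hz => ?_
      · refine (hasLog_const _ hβ).mul (HasLog.of_re_pos (by fun_prop) fun z hz => ?_)
        rw [mul_comm, Complex.mul_conj, Complex.ofReal_re]
        exact Complex.normSq_pos.2 (sub_ne_zero.2 hz.2)
      · rw [zpow_neg_one, div_inv_eq_mul]
        exact hkey z hz
  · have hc' : c = (‖α‖ - ‖β‖) / 2 := by rw [hc, abs_of_pos (by linarith)]
    have hkey : ∀ z ∈ Metric.closedBall a (ε / 2) \ {a}, ‖P z / (z - a) - α‖ < ‖α‖ := by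
      intro z hz
      obtain ⟨h1, h2⟩ := hbound z hz
      have h3 : ‖P z - α * (z - a)‖ ≤ c * ‖z - a‖ + ‖β‖ * ‖z - a‖ := by
        rw [← hconj (z - a), ← norm_mul, hconj]
        refine le_trans ?_ (add_le_add_left h2 _)
        refine le_trans (le_of_eq ?_) (norm_add_le _ _)
        ring_nf
      rw [div_sub' (sub_ne_zero.2 hz.2), norm_div, div_lt_iff₀ h1, mul_comm (z - a)]
      refine h3.trans_lt ?_
      rw [← add_mul]
      exact mul_lt_mul_of_pos_right (by linarith) h1
    have hα : α ≠ 0 := fun h => by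
      rw [h, norm_zero] at hlt
      exact absurd hlt (not_lt.2 (norm_nonneg _))
    refine ⟨1, ε / 2, half_pos hε, fun z hz h0 => ?_, ?_⟩
    · have := hkey z hz
      rw [h0, zero_div, zero_sub, norm_neg] at this
      exact lt_irrefl _ this
    · refine (hasLog_const _ hα).of_norm_sub_lt continuousOn_const (hcont _) fun z hz => ?_
      rw [zpow_one]
      exact hkey z hz

theorem HasLog.of_finite_zeros {U K : Set ℂ} (hU : IsOpen U) (hUs : IsSimplyConnected U)
    (hKU : K ⊆ U) (hK : IsClosed K) (hlog : ∀ a ∉ K, HasLog K (fun z => z - a)) (F : Finset ℂ) :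
    ∀ P : ℂ → ℂ, Continuous P → (∀ z ∈ U, P z = 0 → z ∈ F) → (∀ z ∈ K, P z ≠ 0) →
      (∀ a ∈ F, a ∈ U → P a = 0 → ∃ n : ℤ, ∃ ε > 0,
        HasLog (Metric.closedBall a ε \ {a}) (fun z => P z / (z - a) ^ n)) → HasLog K P := by
  induction F using Finset.induction_on with
  | empty =>
    intro P hP hz _ _
    obtain ⟨f, hf, hfe⟩ := Complex.exists_continuousOn_eqOn_exp_comp hUs hU hP.continuousOn
      (by rintro ⟨z, hzU, h0⟩; simpa using hz z hzU h0)
    exact ⟨f, hf.mono hKU, fun z hz => (hfe (hKU hz)).symm⟩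
  | insert a F haF ih =>
    intro P hP hz hPK hloc
    by_cases haU : a ∈ U ∧ P a = 0
    swap
    · refine ih P hP (fun z hzU h0 => ?_) hPK fun b hb => hloc b (Finset.mem_insert_of_mem hb)
      refine (Finset.mem_insert.1 (hz z hzU h0)).resolve_left ?_
      rintro rfl
      exact haU ⟨hzU, h0⟩
    obtain ⟨haU, ha0⟩ := haU
    have haK : a ∉ K := fun h => hPK a h ha0
    obtain ⟨n, ε₀, hε₀, g, hg, hgP⟩ := hloc a (Finset.mem_insert_self _ _) haU ha0
    obtain ⟨ε, hε, hball⟩ : ∃ ε > 0, Metric.closedBall a ε ⊆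
        Metric.closedBall a ε₀ ∩ (U ∩ (Kᶜ ∩ (↑F : Set ℂ)ᶜ)) := by
      refine Metric.nhds_basis_closedBall.mem_iff.1 ?_
      refine Filter.inter_mem (Metric.closedBall_mem_nhds a hε₀) ?_
      exact (hU.inter (hK.isOpen_compl.inter F.finite_toSet.isClosed.isOpen_compl)).mem_nhds
        ⟨haU, haK, haF⟩
    have hsph : Metric.sphere a ε ⊆ Metric.closedBall a ε₀ \ {a} := fun z hz =>
      ⟨(hball (Metric.sphere_subset_closedBall hz)).1, fun h => by
        rw [Set.mem_singleton_iff.1 h, mem_sphere_iff_norm, sub_self, norm_zero] at hz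
        exact hε.ne hz⟩
    obtain ⟨G, hG⟩ := ContinuousMap.exists_restrict_eq (Metric.isClosed_sphere (x := a) (ε := ε))
      (⟨(Metric.sphere a ε).domRestrict g,
        continuousOn_iff_continuous_domRestrict.1 (hg.mono hsph)⟩ : C(Metric.sphere a ε, ℂ))
    have hGg : ∀ z ∈ Metric.sphere a ε, G z = g z := fun z hz => by
      have := congrArg (fun F : C(Metric.sphere a ε, ℂ) => F ⟨z, hz⟩) hG
      simpa using this
    set P' : ℂ → ℂ := (Metric.closedBall a ε).piecewise (fun z => Complex.exp (G z))
      (fun z => P z / (z - a) ^ n) with hP'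
    have hin : ∀ z ∈ Metric.closedBall a ε, P' z = Complex.exp (G z) := fun z hz =>
      Set.piecewise_eq_of_mem _ _ _ hz
    have hout : ∀ z ∉ Metric.closedBall a ε, P' z = P z / (z - a) ^ n := fun z hz =>
      Set.piecewise_eq_of_notMem _ _ _ hz
    have hne : ∀ z ∉ Metric.ball a ε, z - a ≠ 0 := fun z hz => sub_ne_zero.2 fun h =>
      hz (h ▸ Metric.mem_ball_self hε)
    have hne' : ∀ z ∉ Metric.closedBall a ε, z - a ≠ 0 := fun z hz =>
      hne z fun h => hz (Metric.ball_subset_closedBall h)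
    have hP'c : Continuous P' := by
      have := ContinuousOn.piecewise_union (f := fun z => Complex.exp (G z))
        (g := fun z => P z / (z - a) ^ n) (Metric.isClosed_closedBall (x := a) (ε := ε))
        (Metric.isOpen_ball (x := a) (ε := ε)).isClosed_compl
        (by fun_prop)
        (hP.continuousOn.div (ContinuousOn.zpow₀ (by fun_prop) n
          fun z hz => Or.inl (hne z hz)) fun z hz => zpow_ne_zero _ (hne z hz))
        (fun z hz hz' => by
          have hzs : z ∈ Metric.sphere a ε :=
            le_antisymm hz (not_lt.1 fun h => hz' (Metric.mem_ball.2 h))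
          rw [hGg z hzs]
          exact (hgP z (hsph hzs)).symm)
      rw [← continuousOn_univ]
      refine this.mono fun z _ => ?_
      by_cases hz : z ∈ Metric.ball a ε
      · exact Or.inl (Metric.ball_subset_closedBall hz)
      · exact Or.inr hz
    have hKout : ∀ z ∈ K, z ∉ Metric.closedBall a ε := fun z hz h => (hball h).2.2.1 hz
    have hlogP' : HasLog K P' := by
      refine ih P' hP'c (fun z hzU h0 => ?_) (fun z hz => ?_) fun b hb hbU hb0 => ?_
      · have hzb : z ∉ Metric.closedBall a ε := fun h =>
          Complex.exp_ne_zero _ ((hin z h).symm.trans h0)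
        rw [hout z hzb, div_eq_zero_iff] at h0
        have hP0 := h0.resolve_right (zpow_ne_zero _ (hne' z hzb))
        exact (Finset.mem_insert.1 (hz z hzU hP0)).resolve_left (sub_ne_zero.1 (hne' z hzb))
      · rw [hout z (hKout z hz)]
        exact div_ne_zero (hPK z hz) (zpow_ne_zero _ (hne' z (hKout z hz)))
      · have hbb : b ∉ Metric.closedBall a ε := fun h => (hball h).2.2.2 hb
        rw [hout b hbb, div_eq_zero_iff] at hb0
        obtain ⟨m, δ₀, hδ₀, hlog₀⟩ := hloc b (Finset.mem_insert_of_mem hb) hbU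
          (hb0.resolve_right (zpow_ne_zero _ (hne' b hbb)))
        obtain ⟨δ, hδ, hδball⟩ : ∃ δ > 0, Metric.closedBall b δ ⊆
            Metric.closedBall b δ₀ ∩ ((Metric.closedBall a ε)ᶜ ∩ Metric.ball b ‖b - a‖) := by
          refine Metric.nhds_basis_closedBall.mem_iff.1 ?_
          refine Filter.inter_mem (Metric.closedBall_mem_nhds b hδ₀) ?_
          exact (Metric.isClosed_closedBall.isOpen_compl.inter Metric.isOpen_ball).mem_nhds
            ⟨hbb, Metric.mem_ball_self (norm_pos_iff.2 (hne' b hbb))⟩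
        refine ⟨m, δ, hδ, ?_⟩
        have h1 : HasLog (Metric.closedBall b δ \ {b}) (fun z => z - a) :=
          (hasLog_const _ (hne' b hbb)).of_norm_sub_lt continuousOn_const (by fun_prop)
            fun z hz => by
              have := (hδball hz.1).2.2
              rw [mem_ball_iff_norm] at this
              simpa using this
        refine ((hlog₀.mono fun z hz => ⟨(hδball hz.1).1, hz.2⟩).div (h1.zpow n)).congr
          fun z hz => ?_
        rw [hout z (hδball hz.1).2.1]
        ring
    refine (hlogP'.mul ((hlog a haK).zpow n)).congr fun z hz => ?_
    rw [hout z (hKout z hz), div_mul_cancel₀ _ (zpow_ne_zero _ (hne' z (hKout z hz)))]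

theorem hasLog_of_forall_hasLog_sub {K : Set ℂ} (hK : IsCompact K)
    (hlog : ∀ a ∉ K, HasLog K (fun z => z - a)) {h : ℂ → ℂ} (hc : ContinuousOn h K)
    (h0 : ∀ z ∈ K, h z ≠ 0) : HasLog K h := by
  rcases K.eq_empty_or_nonempty with rfl | hne
  · exact ⟨fun _ => 0, continuousOn_const, by simp⟩
  obtain ⟨z₀, hz₀, hmin⟩ := hK.exists_isMinOn hne hc.norm
  set ε : ℝ := ‖h z₀‖ with hε
  have hε0 : 0 < ε := norm_pos_iff.2 (h0 z₀ hz₀)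
  obtain ⟨H, hH⟩ := ContinuousMap.exists_restrict_eq hK.isClosed
    (⟨K.domRestrict h, continuousOn_iff_continuous_domRestrict.1 hc⟩ : C(K, ℂ))
  have hHh : ∀ z ∈ K, H z = h z := fun z hz => by
    have := congrArg (fun F : C(K, ℂ) => F ⟨z, hz⟩) hH
    simpa using this
  obtain ⟨P, hPs, hPH, -⟩ := H.continuous.exists_contDiff_approx 1 continuous_const
    (ε := fun _ => ε / 4) (fun _ => by positivity)
  have hPd : Differentiable ℝ P := hPs.differentiable (by simp)
  set S : Set ℂ := {z | (fderiv ℝ P z).det = 0} with hS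
  have hnull : MeasureTheory.volume (P '' S) = 0 :=
    MeasureTheory.addHaar_image_eq_zero_of_det_fderivWithin_eq_zero _
      (fun z _ => (hPd z).hasFDerivAt.hasFDerivWithinAt) fun z hz => hz
  have hdense := MeasureTheory.Measure.dense_of_ae
    (MeasureTheory.measure_eq_zero_iff_ae_notMem.1 hnull)
  obtain ⟨c, hcS, hcb⟩ := hdense.exists_dist_lt 0 (show 0 < ε / 4 by positivity)
  have hcε : ‖c‖ < ε / 4 := by simpa using hcb
  set Q : ℂ → ℂ := fun z => P z - c with hQ
  have hQc : Continuous Q := hPd.continuous.sub continuous_const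
  have hclose : ∀ z ∈ K, ‖h z - Q z‖ < ‖Q z‖ ∧ Q z ≠ 0 := by
    intro z hz
    have h1 : ‖Q z - h z‖ < ε / 4 + ε / 4 := by
      have h2 : ‖P z - h z‖ < ε / 4 := by
        have := hPH z
        rwa [hHh z hz, dist_eq_norm] at this
      calc ‖Q z - h z‖ = ‖(P z - h z) - c‖ := by rw [hQ]; ring_nf
        _ ≤ ‖P z - h z‖ + ‖c‖ := norm_sub_le _ _
        _ < ε / 4 + ε / 4 := add_lt_add h2 hcε
    have h3 : ε ≤ ‖h z‖ := isMinOn_iff.1 hmin z hz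
    have h4 : ‖h z‖ ≤ ‖Q z‖ + ‖Q z - h z‖ := by
      have := norm_sub_le (Q z) (Q z - h z)
      rwa [sub_sub_cancel] at this
    refine ⟨by rw [norm_sub_rev]; linarith, norm_pos_iff.1 (by linarith)⟩
  have hQd : ∀ z, HasFDerivAt Q (fderiv ℝ P z) z := fun z => (hPd z).hasFDerivAt.sub_const c
  have hreg : ∀ z, Q z = 0 → (fderiv ℝ P z).det ≠ 0 := fun z hz h =>
    hcS ⟨z, h, sub_eq_zero.1 hz⟩
  have hloc := fun z (hz : Q z = 0) =>
    exists_hasLog_div_zpow_of_det_ne_zero hQc (hQd z) hz (hreg z hz)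
  obtain ⟨R, hR⟩ := hK.isBounded.subset_ball 0
  have hfin : (Metric.closedBall 0 R ∩ Q ⁻¹' {0}).Finite := by
    refine IsCompact.finite ((isCompact_closedBall 0 R).inter_right
      (isClosed_singleton.preimage hQc)) ?_
    rw [isDiscrete_iff_forall_mem_exists_isOpen]
    rintro z ⟨hz, hz0⟩
    obtain ⟨n, δ, hδ, hnz, -⟩ := hloc z hz0
    refine ⟨Metric.ball z δ, Metric.isOpen_ball, ?_⟩
    ext w
    constructor
    · rintro ⟨hw, -, hw0⟩
      by_contra hwz
      exact hnz w ⟨Metric.ball_subset_closedBall hw, hwz⟩ hw0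
    · rintro rfl
      exact ⟨Metric.mem_ball_self hδ, hz, hz0⟩
  have hR0 : 0 < R := by
    have := hR hz₀
    rw [Metric.mem_ball] at this
    exact dist_nonneg.trans_lt this
  have hQlog : HasLog K Q := by
    refine HasLog.of_finite_zeros (U := Metric.ball 0 R) Metric.isOpen_ball ?_ hR hK.isClosed hlog
      hfin.toFinset Q hQc (fun z hz h0 => ?_) (fun z hz => (hclose z hz).2) fun a _ _ ha0 => ?_
    · have := Metric.contractibleSpace_ball (x := (0 : ℂ)) hR0
      exact (inferInstance : SimplyConnectedSpace (Metric.ball (0 : ℂ) R))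
    · rw [Set.Finite.mem_toFinset]
      exact ⟨Metric.ball_subset_closedBall hz, h0⟩
    · obtain ⟨n, δ, hδ, -, hl⟩ := hloc a ha0
      exact ⟨n, δ, hδ, hl⟩
  exact hQlog.of_norm_sub_lt hQc.continuousOn hc fun z hz => (hclose z hz).1

theorem hasLog_of_forall_sameComp {K : Set (ℝ × ℝ)} (hK : IsCompact K)
    (hs : ∀ a b, a ∉ K → b ∉ K → SameComp K a b) {h : ℝ × ℝ → ℂ} (hc : ContinuousOn h K)
    (h0 : ∀ z ∈ K, h z ≠ 0) : HasLog K h := by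
  have e : ∀ z : ℝ × ℝ, Complex.equivRealProdCLM (toC z) = z := fun z =>
    Complex.equivRealProdCLM.apply_symm_apply z
  have e' : ∀ w : ℂ, toC (Complex.equivRealProdCLM w) = w := fun w =>
    Complex.equivRealProdCLM.symm_apply_apply w
  have hmem : ∀ w ∈ toC '' K, Complex.equivRealProdCLM w ∈ K := by
    rintro _ ⟨z, hz, rfl⟩
    rwa [e]
  have hsub : ∀ a ∉ toC '' K, HasLog (toC '' K) (fun z => z - a) := by
    intro a ha
    have haK : Complex.equivRealProdCLM a ∉ K := fun h => ha ⟨_, h, e' a⟩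
    obtain ⟨R, hR⟩ := (hK.image continuous_toC).isBounded.subset_ball 0
    set b : ℂ := ((|R| + 1 : ℝ) : ℂ) with hb
    have hbn : ‖b‖ = |R| + 1 := by
      rw [hb, Complex.norm_real, Real.norm_of_nonneg (by positivity)]
    have hlt : ∀ w ∈ toC '' K, ‖w‖ < ‖b‖ := fun w hw => by
      have := hR hw
      rw [mem_ball_zero_iff] at this
      rw [hbn]
      linarith [le_abs_self R]
    have hbK : Complex.equivRealProdCLM b ∉ K := fun h =>
      lt_irrefl _ (hlt b ⟨_, h, e' b⟩)
    have h1 : HasLog (toC '' K) (fun z => (z - a) / (z - b)) := by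
      refine (((hs _ _ haK hbK).hasLog hK.isClosed).comp (φ := Complex.equivRealProdCLM)
        (by fun_prop) hmem).congr fun w _ => ?_
      simp only [e']
    have hb0 : b ≠ 0 := by
      rw [← norm_pos_iff, hbn]
      positivity
    have h2 : HasLog (toC '' K) (fun z => z - b) :=
      (hasLog_const _ (neg_ne_zero.2 hb0)).of_norm_sub_lt continuousOn_const (by fun_prop)
        fun w hw => by simpa using hlt w hw
    refine (h1.mul h2).congr fun w hw => ?_
    rw [div_mul_cancel₀]
    refine sub_ne_zero.2 fun h => lt_irrefl ‖b‖ ?_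
    conv_lhs => rw [← h]
    exact hlt w hw
  have := hasLog_of_forall_hasLog_sub (hK.image continuous_toC) hsub
    (h := fun w => h (Complex.equivRealProdCLM w)) (hc.comp (by fun_prop) hmem)
    fun w hw => h0 _ (hmem w hw)
  refine (this.comp (φ := toC) continuous_toC.continuousOn (Set.mapsTo_image _ _)).congr
    fun z _ => ?_
  simp only [e]

/-- A simple closed curve separates the plane. -/
theorem IsArc.exists_not_sameComp {A B : Set (ℝ × ℝ)} {p q : ℝ × ℝ} (hA : IsArc A p q)
    (hB : IsArc B p q) (hAB : A ∩ B ⊆ {p, q}) :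
    ∃ a b, a ∉ A ∪ B ∧ b ∉ A ∪ B ∧ ¬ SameComp (A ∪ B) a b := by
  by_contra! hs
  obtain ⟨γ, hc, hi, hp, hq, hγA⟩ := id hA
  obtain ⟨σ, hσ, hσγ⟩ := exists_leftInverse_of_injOn hc hi
  rw [hγA] at hσ
  have hσp : σ p = 0 := by rw [← hp, hσγ 0 (by simp)]
  have hσq : σ q = 1 := by rw [← hq, hσγ 1 (by simp)]
  set h : ℝ × ℝ → ℂ := A.piecewise (fun z => Complex.exp (σ z * (2 * Real.pi * Complex.I)))
    (fun _ => 1) with hh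
  have hAB1 : ∀ z ∈ A, z ∈ B → Complex.exp (σ z * (2 * Real.pi * Complex.I)) = 1 := by
    intro z hzA hzB
    rcases hAB ⟨hzA, hzB⟩ with rfl | h
    · simp [hσp]
    · rw [Set.mem_singleton_iff.1 h, hσq]
      simp
  have hhc : ContinuousOn h (A ∪ B) := by
    refine ContinuousOn.piecewise_union hA.isClosed hB.isClosed ?_ continuousOn_const hAB1
    exact Complex.continuous_exp.comp_continuousOn
      ((Complex.continuous_ofReal.comp_continuousOn hσ).mul continuousOn_const)
  have hhA : ∀ z ∈ A, h z = Complex.exp (σ z * (2 * Real.pi * Complex.I)) := fun z hz =>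
    Set.piecewise_eq_of_mem _ _ _ hz
  have hhB : ∀ z ∈ B, h z = 1 := fun z hz => by
    by_cases hzA : z ∈ A
    · rw [hhA z hzA, hAB1 z hzA hz]
    · exact Set.piecewise_eq_of_notMem _ _ _ hzA
  obtain ⟨g, hg, hgh⟩ := hasLog_of_forall_sameComp (hA.isCompact.union hB.isCompact) hs hhc
    fun z hz => by
      rcases hz with hz | hz
      · rw [hhA z hz]
        exact Complex.exp_ne_zero _
      · rw [hhB z hz]
        exact one_ne_zero
  have h1 := hB.isPreconnected.eq_of_exp_eq_one (hg.mono Set.subset_union_right)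
    (fun z hz => by rw [← hgh z (Or.inr hz), hhB z hz]) hB.left_mem hB.right_mem
  have h2 := hA.isPreconnected.eq_of_exp_eq_one
    (g := fun z => g z - σ z * (2 * Real.pi * Complex.I))
    ((hg.mono Set.subset_union_left).sub
      ((Complex.continuous_ofReal.comp_continuousOn hσ).mul continuousOn_const))
    (fun z hz => by
      rw [Complex.exp_sub, ← hgh z (Or.inl hz), hhA z hz, div_self (Complex.exp_ne_zero _)])
    hA.left_mem hA.right_mem
  simp only [hσp, hσq, h1] at h2
  have h3 : (2 * Real.pi * Complex.I : ℂ) = 0 := by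
    push_cast at h2
    linear_combination h2
  exact Complex.two_pi_I_ne_zero h3

theorem exponent_eq_zero_of_not_sameComp {K : Set (ℝ × ℝ)} (hK : IsClosed K) {a b c : ℝ × ℝ}
    (ha : a ∉ K) (hb : b ∉ K) (hc : c ∉ K) (hab : ¬ SameComp K a b) (hac : ¬ SameComp K a c)
    (hbd : Bornology.IsBounded (connectedComponentIn Kᶜ a)) {m n l : ℤ}
    (hlog : HasLog K fun z =>
      (toC z - toC a) ^ m * ((toC z - toC b) ^ n * (toC z - toC c) ^ l)) : m = 0 := by
  have hne : ∀ d, d ∉ K → ¬ SameComp K a d →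
      ∀ z ∈ closure (connectedComponentIn Kᶜ a), toC z - toC d ≠ 0 := fun d hd had z hz =>
    toC_sub_ne_zero fun e => by
      subst e
      exact (closure_comp_subset hK a hz).elim had hd
  have hcont : ∀ d (k : ℤ), d ∉ K → ¬ SameComp K a d →
      ContinuousOn (fun z => (toC z - toC d) ^ k) (closure (connectedComponentIn Kᶜ a)) :=
    fun d k hd had => (continuous_toC.sub continuous_const).continuousOn.zpow₀ k
      fun z hz => Or.inl (hne d hd had z hz)
  refine exponent_eq_zero_of_hasLog (isOpen_comp hK a) hbd (mem_connectedComponentIn ha) m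
    ((hcont b n hb hab).mul (hcont c l hc hac)) (fun z hz => ?_)
    (hlog.mono (frontier_comp_subset hK a))
  exact mul_ne_zero (zpow_ne_zero _ (hne b hb hab z hz)) (zpow_ne_zero _ (hne c hc hac z hz))

theorem hasLog_div_zpow_mul {K : Set (ℝ × ℝ)} {a b c : ℝ × ℝ} (hc : c ∉ K) {m n : ℤ}
    (h : HasLog K fun z => ((toC z - toC a) / (toC z - toC c)) ^ m *
      ((toC z - toC b) / (toC z - toC c)) ^ n) :
    HasLog K fun z => (toC z - toC a) ^ m * ((toC z - toC b) ^ n * (toC z - toC c) ^ (-m - n)) := by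
  refine h.congr fun z hz => ?_
  have h0 : toC z - toC c ≠ 0 := toC_sub_ne_zero fun e => hc (e ▸ hz)
  rw [div_zpow, div_zpow, zpow_sub₀ h0, zpow_neg]
  field_simp

theorem IsArc.sameComp_or {D e : Set (ℝ × ℝ)} {p q : ℝ × ℝ} (hD : IsCompact D) (he : IsArc e p q)
    (hDe : D ∩ e ⊆ {p, q}) {a b c : ℝ × ℝ} (ha : a ∉ D ∪ e) (hb : b ∉ D ∪ e) (hc : c ∉ D ∪ e)
    (hac : SameComp D a c) (hbc : SameComp D b c) :
    SameComp (D ∪ e) a b ∨ SameComp (D ∪ e) a c ∨ SameComp (D ∪ e) b c := by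
  by_cases hpq : p ∈ D ∧ q ∈ D
  swap
  · refine Or.inr (Or.inl (hac.union hD he.isCompact ?_
      (he.sameComp (fun h => ha (Or.inr h)) fun h => hc (Or.inr h))))
    refine Set.Subsingleton.isPreconnected fun x hx y hy => ?_
    rcases hDe hx with rfl | rfl <;> rcases hDe hy with h | h <;> try exact h.symm
    · exact absurd ⟨hx.1, (h : y = q) ▸ hy.1⟩ hpq
    · exact absurd ⟨h ▸ hy.1, hx.1⟩ hpq
  have hK : IsCompact (D ∪ e) := hD.union he.isCompact
  obtain ⟨g₁, hg₁, hg₁e⟩ := hac.hasLog hD.isClosed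
  obtain ⟨g₂, hg₂, hg₂e⟩ := hbc.hasLog hD.isClosed
  obtain ⟨k₁, hk₁, hk₁e⟩ := (he.sameComp (fun h => ha (Or.inr h))
    fun h => hc (Or.inr h)).hasLog he.isClosed
  obtain ⟨k₂, hk₂, hk₂e⟩ := (he.sameComp (fun h => hb (Or.inr h))
    fun h => hc (Or.inr h)).hasLog he.isClosed
  have hgap : ∀ (g k : ℝ × ℝ → ℂ) (d : ℝ × ℝ), d ∉ D ∪ e →
      (∀ z ∈ D, (toC z - toC d) / (toC z - toC c) = Complex.exp (g z)) →
      (∀ z ∈ e, (toC z - toC d) / (toC z - toC c) = Complex.exp (k z)) →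
      ∀ r ∈ D ∩ e, ∃ n : ℤ, g r - k r = n * (2 * Real.pi * Complex.I) := by
    intro g k d hd hg hk r hr
    rw [← Complex.exp_eq_one_iff, Complex.exp_sub, ← hg r hr.1, ← hk r hr.2]
    exact div_self (div_ne_zero (toC_sub_ne_zero fun e => hd (Or.inl (e ▸ hr.1)))
      (toC_sub_ne_zero fun e => hc (Or.inl (e ▸ hr.1))))
  obtain ⟨n₁, hn₁⟩ := hgap g₁ k₁ a ha hg₁e hk₁e p ⟨hpq.1, he.left_mem⟩
  obtain ⟨n₁', hn₁'⟩ := hgap g₁ k₁ a ha hg₁e hk₁e q ⟨hpq.2, he.right_mem⟩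
  obtain ⟨n₂, hn₂⟩ := hgap g₂ k₂ b hb hg₂e hk₂e p ⟨hpq.1, he.left_mem⟩
  obtain ⟨n₂', hn₂'⟩ := hgap g₂ k₂ b hb hg₂e hk₂e q ⟨hpq.2, he.right_mem⟩
  obtain ⟨m, n, hmn, hzero⟩ : ∃ m n : ℤ, m * (n₁ - n₁') + n * (n₂ - n₂') = 0 ∧
      ¬ (m = 0 ∧ n = 0) := by
    by_cases h : n₁ - n₁' = 0 ∧ n₂ - n₂' = 0
    · exact ⟨1, 0, by rw [h.1, h.2]; ring, by simp⟩
    · exact ⟨n₂ - n₂', -(n₁ - n₁'), by ring, fun h' => h ⟨by omega, h'.1⟩⟩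
  have hlog : HasLog (D ∪ e) fun z => ((toC z - toC a) / (toC z - toC c)) ^ m *
      ((toC z - toC b) / (toC z - toC c)) ^ n := by
    set N : ℂ := (m * n₁ + n * n₂) * (2 * Real.pi * Complex.I) with hN
    refine ⟨D.piecewise (fun z => m * g₁ z + n * g₂ z) (fun z => m * k₁ z + n * k₂ z + N),
      ContinuousOn.piecewise_union hD.isClosed he.isClosed
        ((continuousOn_const.mul hg₁).add (continuousOn_const.mul hg₂))
        (((continuousOn_const.mul hk₁).add (continuousOn_const.mul hk₂)).add continuousOn_const)
        fun z hz hze => ?_, fun z hz => ?_⟩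
    · rcases hDe ⟨hz, hze⟩ with rfl | rfl
      · linear_combination (m : ℂ) * hn₁ + (n : ℂ) * hn₂
      · have : (m : ℂ) * (n₁ - n₁') + n * (n₂ - n₂') = 0 := by exact_mod_cast hmn
        linear_combination (m : ℂ) * hn₁' + (n : ℂ) * hn₂' -
          (2 * Real.pi * Complex.I) * this
    · by_cases hzD : z ∈ D
      · rw [Set.piecewise_eq_of_mem _ _ _ hzD, Complex.exp_add, Complex.exp_int_mul,
          Complex.exp_int_mul, ← hg₁e z hzD, ← hg₂e z hzD]
      · have hze := hz.resolve_left hzD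
        have hN1 : Complex.exp N = 1 :=
          Complex.exp_eq_one_iff.2 ⟨m * n₁ + n * n₂, by rw [hN]; push_cast; ring⟩
        rw [Set.piecewise_eq_of_notMem _ _ _ hzD, Complex.exp_add, Complex.exp_add, hN1,
          Complex.exp_int_mul, Complex.exp_int_mul, ← hk₁e z hze, ← hk₂e z hze, mul_one]
  have hlog' := hasLog_div_zpow_mul hc hlog
  by_contra! hn
  obtain ⟨hab', hac', hbc'⟩ := hn
  have e1 : Bornology.IsBounded (connectedComponentIn (D ∪ e)ᶜ a) → m = 0 := fun hbd =>
    exponent_eq_zero_of_not_sameComp hK.isClosed ha hb hc hab' hac' hbd hlog'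
  have e2 : Bornology.IsBounded (connectedComponentIn (D ∪ e)ᶜ b) → n = 0 := fun hbd =>
    exponent_eq_zero_of_not_sameComp hK.isClosed hb ha hc (fun h => hab' h.symm) hbc' hbd
      (hlog'.congr fun z _ => by ring)
  have e3 : Bornology.IsBounded (connectedComponentIn (D ∪ e)ᶜ c) → -m - n = 0 := fun hbd =>
    exponent_eq_zero_of_not_sameComp hK.isClosed hc ha hb (fun h => hac' h.symm)
      (fun h => hbc' h.symm) hbd (hlog'.congr fun z _ => by ring)
  by_cases ua : Bornology.IsBounded (connectedComponentIn (D ∪ e)ᶜ a)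
  · by_cases ub : Bornology.IsBounded (connectedComponentIn (D ∪ e)ᶜ b)
    · exact hzero ⟨e1 ua, e2 ub⟩
    · by_cases uc : Bornology.IsBounded (connectedComponentIn (D ∪ e)ᶜ c)
      · have := e1 ua
        have := e3 uc
        exact hzero ⟨by omega, by omega⟩
      · exact hbc' (sameComp_of_not_isBounded hK ub uc)
  · by_cases ub : Bornology.IsBounded (connectedComponentIn (D ∪ e)ᶜ b)
    · by_cases uc : Bornology.IsBounded (connectedComponentIn (D ∪ e)ᶜ c)
      · have := e2 ub
        have := e3 uc
        exact hzero ⟨by omega, by omega⟩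
      · exact hac' (sameComp_of_not_isBounded hK ua uc)
    · exact hab' (sameComp_of_not_isBounded hK ua ub)

theorem IsArc.subset_closure_of_sameComp {D e : Set (ℝ × ℝ)} {p q : ℝ × ℝ} (hD : IsCompact D)
    (he : IsArc e p q) (hDe : D ∩ e ⊆ {p, q}) {a b : ℝ × ℝ} (ha : a ∉ D ∪ e)
    (hab : SameComp D a b) (hb : ¬ SameComp (D ∪ e) a b) :
    e ⊆ closure (connectedComponentIn (D ∪ e)ᶜ a) := by
  have hK : IsCompact (D ∪ e) := hD.union he.isCompact
  have hdisj : Disjoint (e \ {p, q}) D :=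
    Set.disjoint_left.2 fun z hz hzD => hz.2 (hDe ⟨hzD, hz.1⟩)
  have hW : e \ {p, q} ⊆ connectedComponentIn Dᶜ a := by
    have hmeet : (connectedComponentIn Dᶜ a ∩ e).Nonempty := by
      by_contra hne
      rw [Set.not_nonempty_iff_eq_empty, ← Set.disjoint_iff_inter_eq_empty] at hne
      refine hb (isPreconnected_connectedComponentIn.sameComp (Set.disjoint_union_right.2
        ⟨Set.disjoint_left.2 fun z hz => connectedComponentIn_subset _ _ hz, hne⟩)
        (mem_connectedComponentIn hab.left_notMem) hab)
    obtain ⟨w, hw, hwe⟩ := hmeet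
    obtain ⟨z, hz, hze⟩ := mem_closure_iff.1 (he.subset_closure_diff hwe) _
      (isOpen_comp hD.isClosed a) hw
    exact fun y hy => SameComp.trans hz (he.isPreconnected_diff.sameComp hdisj hze hy)
  refine he.subset_closure_diff.trans (closure_minimal ?_ isClosed_closure)
  obtain ⟨γ, hc, hi, rfl, rfl, rfl⟩ := he
  rw [diff_eq_image hi] at hW ⊢
  rintro _ ⟨t, ht, rfl⟩
  by_contra hcl
  obtain ⟨ε, hε, hεs⟩ : ∃ ε > 0, ∀ s ∈ Set.Icc (0 : ℝ) 1, |s - t| ≤ ε →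
      γ s ∉ closure (connectedComponentIn (D ∪ γ '' Set.Icc 0 1)ᶜ a) := by
    have := (hc t (Set.Ioo_subset_Icc_self ht)).preimage_mem_nhdsWithin
      (isClosed_closure.isOpen_compl.mem_nhds hcl)
    obtain ⟨ε, hε, h⟩ := Metric.mem_nhdsWithin_iff.1 this
    refine ⟨ε / 2, by positivity, fun s hs hst => h ⟨?_, hs⟩⟩
    rw [Metric.mem_ball, Real.dist_eq]
    linarith
  obtain ⟨t₁, ht₁, h1t⟩ : ∃ t₁, max 0 (t - ε) < t₁ ∧ t₁ < t := exists_between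
    (max_lt ht.1 (by linarith))
  obtain ⟨t₂, ht₂, h2t⟩ : ∃ t₂, t < t₂ ∧ t₂ < min 1 (t + ε) := exists_between
    (lt_min ht.2 (by linarith))
  rw [max_lt_iff] at ht₁
  rw [lt_min_iff] at h2t
  have s1 : Set.Icc 0 t₁ ⊆ Set.Icc (0 : ℝ) 1 := Set.Icc_subset_Icc_right (by linarith [ht.2])
  have s2 : Set.Icc t₂ 1 ⊆ Set.Icc (0 : ℝ) 1 := Set.Icc_subset_Icc_left (by linarith [ht.1])
  have n1 : γ t ∉ γ '' Set.Icc 0 t₁ := by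
    rintro ⟨s, hs, hst⟩
    have := hi (s1 hs) (Set.Ioo_subset_Icc_self ht) hst
    linarith [hs.2]
  have n2 : γ t ∉ γ '' Set.Icc t₂ 1 := by
    rintro ⟨s, hs, hst⟩
    have := hi (s2 hs) (Set.Ioo_subset_Icc_self ht) hst
    linarith [hs.1]
  have a1 : a ∉ γ '' Set.Icc 0 t₁ := fun h => ha (Or.inr (Set.image_mono s1 h))
  have a2 : a ∉ γ '' Set.Icc t₂ 1 := fun h => ha (Or.inr (Set.image_mono s2 h))
  have hc1 : IsCompact (γ '' Set.Icc 0 t₁) := isCompact_Icc.image_of_continuousOn (hc.mono s1)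
  have hc2 : IsCompact (γ '' Set.Icc t₂ 1) := isCompact_Icc.image_of_continuousOn (hc.mono s2)
  have hz1 : γ 1 ∉ γ '' Set.Icc 0 t₁ := by
    rintro ⟨s, hs, hst⟩
    have := hi (s1 hs) (by simp) hst
    linarith [hs.2, ht.2]
  have hz0 : γ 0 ∉ γ '' Set.Icc t₂ 1 := by
    rintro ⟨s, hs, hst⟩
    have := hi (s2 hs) (by simp) hst
    linarith [hs.1, ht.1]
  have h1 : SameComp (D ∪ γ '' Set.Icc 0 t₁) a (γ t) := by
    refine SameComp.union hD hc1 (Set.Subsingleton.isPreconnected ?_) (hW ⟨t, ht, rfl⟩)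
      (sameComp_image_Icc (by linarith) (hc.mono s1) (hi.mono s1) a1 n1)
    refine (Set.subsingleton_singleton (a := γ 0)).anti fun z hz => ?_
    rcases hDe ⟨hz.1, Set.image_mono s1 hz.2⟩ with h | h
    · exact h
    · exact absurd ((h : z = γ 1) ▸ hz.2) hz1
  have h2 : SameComp (D ∪ γ '' Set.Icc 0 t₁ ∪ γ '' Set.Icc t₂ 1) a (γ t) := by
    refine SameComp.union (hD.union hc1) hc2 (Set.Subsingleton.isPreconnected ?_) h1
      (sameComp_image_Icc (by linarith [h2t.1]) (hc.mono s2) (hi.mono s2) a2 n2)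
    refine (Set.subsingleton_singleton (a := γ 1)).anti fun z hz => ?_
    rcases hz.1 with h | ⟨s, hs, rfl⟩
    · rcases hDe ⟨h, Set.image_mono s2 hz.2⟩ with h | h
      · exact absurd (h ▸ hz.2) hz0
      · exact h
    · obtain ⟨s', hs', hss'⟩ := hz.2
      have := hi (s2 hs') (s1 hs) hss'
      linarith [hs'.1, hs.2]
  have heq : connectedComponentIn (D ∪ γ '' Set.Icc 0 t₁ ∪ γ '' Set.Icc t₂ 1)ᶜ a =
      connectedComponentIn (D ∪ γ '' Set.Icc 0 1)ᶜ a := by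
    refine comp_eq_of_frontier_subset hK.isClosed (Set.union_subset (Set.union_subset
      Set.subset_union_left ((Set.image_mono s1).trans Set.subset_union_right))
      ((Set.image_mono s2).trans Set.subset_union_right)) ha fun z hz => ?_
    rcases frontier_comp_subset hK.isClosed a hz with h | ⟨s, hs, rfl⟩
    · exact Or.inl (Or.inl h)
    · by_cases hs1 : s ≤ t₁
      · exact Or.inl (Or.inr ⟨s, ⟨hs.1, hs1⟩, rfl⟩)
      · by_cases hs2 : t₂ ≤ s
        · exact Or.inr ⟨s, ⟨hs2, hs.2⟩, rfl⟩
        · refine absurd (frontier_subset_closure hz) (hεs s hs (abs_le.2 ⟨?_, ?_⟩)) <;>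
            linarith [h2t.1, h2t.2, ht₁.1, ht₁.2]
  have : SameComp (D ∪ γ '' Set.Icc 0 1) a (γ t) := by
    rw [SameComp, ← heq]
    exact h2
  exact this.right_notMem (Or.inr ⟨t, Set.Ioo_subset_Icc_self ht, rfl⟩)

theorem sameComp_of_mem_closure {D K : Set (ℝ × ℝ)} (hD : IsClosed D) (hDK : D ⊆ K)
    {a w : ℝ × ℝ} (hw : w ∈ closure (connectedComponentIn Kᶜ a)) (hwD : w ∉ D) :
    SameComp D a w := by
  obtain ⟨z, hz, hza⟩ := mem_closure_iff.1 hw _ (isOpen_comp hD w) (mem_connectedComponentIn hwD)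
  exact (SameComp.mono hza hDK).trans (SameComp.symm hz)

theorem IsArc.subset_closure_of_mem_closure {D e : Set (ℝ × ℝ)} {p q : ℝ × ℝ} (hD : IsCompact D)
    (he : IsArc e p q) (hDe : D ∩ e ⊆ {p, q}) {a w : ℝ × ℝ}
    (hwa : w ∈ closure (connectedComponentIn (D ∪ e)ᶜ a)) (hw : w ∈ e \ {p, q}) :
    e ⊆ closure (connectedComponentIn (D ∪ e)ᶜ a) := by
  have ha : a ∉ D ∪ e := connectedComponentIn_nonempty_iff.1 (closure_nonempty_iff.1 ⟨w, hwa⟩)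
  exact he.subset_closure_of_sameComp hD hDe ha (sameComp_of_mem_closure hD.isClosed
    Set.subset_union_left hwa fun h => hw.2 (hDe ⟨h, hw.1⟩)) fun h => h.right_notMem (Or.inr hw.1)

section Jordan

variable {A B P D e X : Set (ℝ × ℝ)} {p q : ℝ × ℝ}

theorem IsArc.exists_ne_comp (hA : IsArc A p q) (hB : IsArc B p q) (hAB : A ∩ B ⊆ {p, q})
    (a : ℝ × ℝ) : ∃ b, b ∉ A ∪ B ∧ ¬ SameComp (A ∪ B) a b := by
  obtain ⟨b, c, hb, hc, hbc⟩ := hA.exists_not_sameComp hB hAB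
  by_cases h : SameComp (A ∪ B) a b
  · exact ⟨c, hc, fun h' => hbc (h.symm.trans h')⟩
  · exact ⟨b, hb, h⟩

theorem IsArc.jordan_subset_closure (hA : IsArc A p q) (hB : IsArc B p q) (hAB : A ∩ B ⊆ {p, q})
    {a : ℝ × ℝ} (ha : a ∉ A ∪ B) : A ∪ B ⊆ closure (connectedComponentIn (A ∪ B)ᶜ a) := by
  obtain ⟨b, hb, hab⟩ := hA.exists_ne_comp hB hAB a
  refine Set.union_subset ?_ ?_
  · rw [Set.union_comm] at hab ha hb ⊢
    exact hA.subset_closure_of_sameComp hB.isCompact (by rwa [Set.inter_comm]) ha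
      (hB.sameComp (fun h => ha (Or.inl h)) fun h => hb (Or.inl h)) hab
  · exact hB.subset_closure_of_sameComp hA.isCompact hAB ha
      (hA.sameComp (fun h => ha (Or.inl h)) fun h => hb (Or.inl h)) hab

theorem IsArc.jordan_sameComp_or (hA : IsArc A p q) (hB : IsArc B p q) (hAB : A ∩ B ⊆ {p, q})
    {a b c : ℝ × ℝ} (ha : a ∉ A ∪ B) (hb : b ∉ A ∪ B) (hc : c ∉ A ∪ B) :
    SameComp (A ∪ B) a b ∨ SameComp (A ∪ B) a c ∨ SameComp (A ∪ B) b c :=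
  hB.sameComp_or hA.isCompact hAB ha hb hc
    (hA.sameComp (fun h => ha (Or.inl h)) fun h => hc (Or.inl h))
    (hA.sameComp (fun h => hb (Or.inl h)) fun h => hc (Or.inl h))

theorem IsArc.exists_face_of_side (hA : IsArc A p q) (he : IsArc e p q) (hD : IsCompact D)
    (hAD : A ⊆ D) (hDe : D ∩ e ⊆ {p, q}) {x : ℝ × ℝ} (hx : x ∉ A ∪ e) :
    ∃ a, SameComp (A ∪ e) x a ∧ a ∉ D ∪ e ∧ e ⊆ closure (connectedComponentIn (D ∪ e)ᶜ a) := by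
  have hAe : A ∩ e ⊆ {p, q} := (Set.inter_subset_inter_left _ hAD).trans hDe
  obtain ⟨w, hw⟩ := he.diff_nonempty
  have hwD : w ∉ D := fun h => hw.2 (hDe ⟨h, hw.1⟩)
  obtain ⟨a, haw, hxa⟩ := mem_closure_iff.1 (hA.jordan_subset_closure he hAe hx (Or.inr hw.1)) _
    (isOpen_comp hD.isClosed w) (mem_connectedComponentIn hwD)
  have ha : a ∉ D ∪ e := fun h => h.elim (SameComp.right_notMem haw)
    fun h => SameComp.right_notMem hxa (Or.inr h)
  exact ⟨a, hxa, ha, he.subset_closure_of_sameComp hD hDe ha (SameComp.symm haw)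
    fun h => h.right_notMem (Or.inr hw.1)⟩

theorem IsArc.sameComp_of_side (hA : IsArc A p q) (he : IsArc e p q) (hD : IsCompact D)
    (hAD : A ⊆ D) (hDe : D ∩ e ⊆ {p, q}) {a b v w : ℝ × ℝ} (hab : SameComp (A ∪ e) a b)
    (hv : v ∈ e \ {p, q}) (hw : w ∈ e \ {p, q})
    (hva : v ∈ closure (connectedComponentIn (D ∪ e)ᶜ a))
    (hwb : w ∈ closure (connectedComponentIn (D ∪ e)ᶜ b)) : SameComp (D ∪ e) a b := by
  have hAe : A ∩ e ⊆ {p, q} := (Set.inter_subset_inter_left _ hAD).trans hDe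
  have hdisj : Disjoint (e \ {p, q}) D :=
    Set.disjoint_left.2 fun z hz hzD => hz.2 (hDe ⟨hzD, hz.1⟩)
  have ha : a ∉ D ∪ e := connectedComponentIn_nonempty_iff.1 (closure_nonempty_iff.1 ⟨v, hva⟩)
  have hb : b ∉ D ∪ e := connectedComponentIn_nonempty_iff.1 (closure_nonempty_iff.1 ⟨w, hwb⟩)
  obtain ⟨x, hx, hax⟩ := hA.exists_ne_comp he hAe a
  obtain ⟨c, hxc, hc, hcl⟩ := hA.exists_face_of_side he hD hAD hDe hx
  have key : ∀ y u, u ∈ e \ {p, q} → u ∈ closure (connectedComponentIn (D ∪ e)ᶜ y) →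
      SameComp D y v := fun y u hu huy =>
    (sameComp_of_mem_closure hD.isClosed Set.subset_union_left huy
      (Set.disjoint_left.1 hdisj hu)).trans (he.isPreconnected_diff.sameComp hdisj hu hv)
  have hac := (key a v hv hva).trans (key c v hv (hcl hv.1)).symm
  have hbc := (key b w hw hwb).trans (key c v hv (hcl hv.1)).symm
  have hsub : A ∪ e ⊆ D ∪ e := Set.union_subset_union_left _ hAD
  rcases he.sameComp_or hD hDe ha hb hc hac hbc with h | h | h
  · exact h
  · exact absurd ((h.mono hsub).trans hxc.symm) hax
  · exact absurd (hab.trans ((h.mono hsub).trans hxc.symm)) hax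

theorem IsArc.theta (hA : IsArc A p q) (hB : IsArc B p q) (hP : IsArc P p q)
    (hAB : A ∩ B ⊆ {p, q}) {x : ℝ × ℝ} (hPX : P \ {p, q} ⊆ connectedComponentIn (A ∪ B)ᶜ x)
    {S : Set (ℝ × ℝ)} (hS : IsPreconnected S) (hSX : S ⊆ connectedComponentIn (A ∪ B)ᶜ x)
    (hSP : Disjoint S P) {v w : ℝ × ℝ} (hv : v ∈ A \ {p, q}) (hvS : v ∈ closure S)
    (hw : w ∈ B \ {p, q}) (hwS : w ∈ closure S) : False := by
  have hPJ : ∀ z ∈ P, z ∈ A ∪ B → z ∈ ({p, q} : Set _) := fun z hz hzJ => by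
    by_contra h
    exact connectedComponentIn_subset _ _ (hPX ⟨hz, h⟩) hzJ
  have hAP : A ∩ P ⊆ {p, q} := fun z hz => hPJ z hz.2 (Or.inl hz.1)
  have hwAP : w ∉ A ∪ P := fun h => hw.2 (h.elim (fun h => hAB ⟨h, hw.1⟩)
    fun h => hPJ w h (Or.inr hw.1))
  have hBdisj : Disjoint (B \ {p, q}) (A ∪ P) := Set.disjoint_left.2 fun z hz h =>
    hz.2 (h.elim (fun h => hAB ⟨h, hz.1⟩) fun h => hPJ z h (Or.inr hz.1))
  obtain ⟨m, hm, hwm⟩ := hA.exists_ne_comp hP hAP w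
  have hcl := hA.jordan_subset_closure hP hAP hm
  have hMB : Disjoint (connectedComponentIn (A ∪ P)ᶜ m) B := by
    refine Set.disjoint_left.2 fun z hz hzB => ?_
    have hz' : z ∈ B \ {p, q} := ⟨hzB, fun h => SameComp.right_notMem hz (Or.inl <| by
      rcases h with rfl | rfl
      exacts [hA.left_mem, hA.right_mem])⟩
    exact hwm ((hB.isPreconnected_diff.sameComp hBdisj hw hz').trans (SameComp.symm hz))
  have hMAP : Disjoint (connectedComponentIn (A ∪ P)ᶜ m) (A ∪ P) :=
    Set.disjoint_left.2 fun z hz => connectedComponentIn_subset _ _ hz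
  rw [Set.disjoint_union_right] at hMAP
  have hMm : m ∈ connectedComponentIn (A ∪ P)ᶜ m := mem_connectedComponentIn hm
  have hmX : SameComp (A ∪ B) x m := by
    obtain ⟨u, hu⟩ := hP.diff_nonempty
    obtain ⟨z, hzx, hzm⟩ := mem_closure_iff.1 (hcl (Or.inr hu.1)) _
      (isOpen_comp (hA.isClosed.union hB.isClosed) x) (hPX hu)
    exact SameComp.trans hzx (isPreconnected_connectedComponentIn.sameComp
      (Set.disjoint_union_right.2 ⟨hMAP.1, hMB⟩) hzm hMm)
  obtain ⟨s, hs⟩ : S.Nonempty := closure_nonempty_iff.1 ⟨v, hvS⟩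
  have hSD : S ⊆ connectedComponentIn (B ∪ P ∪ A)ᶜ s := by
    refine hS.subset_connectedComponentIn hs fun z hz hzD => ?_
    rcases hzD with (h | h) | h
    · exact SameComp.right_notMem (hSX hz) (Or.inr h)
    · exact Set.disjoint_left.1 hSP hz h
    · exact SameComp.right_notMem (hSX hz) (Or.inl h)
  have hMD : connectedComponentIn (A ∪ P)ᶜ m ⊆ connectedComponentIn (B ∪ P ∪ A)ᶜ m := by
    refine isPreconnected_connectedComponentIn.subset_connectedComponentIn hMm fun z hz hzD => ?_
    rcases hzD with (h | h) | h
    · exact Set.disjoint_left.1 hMB hz h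
    · exact Set.disjoint_left.1 hMAP.2 hz h
    · exact Set.disjoint_left.1 hMAP.1 hz h
  have hsm : SameComp (B ∪ P ∪ A) s m := by
    refine hB.sameComp_of_side hA (hB.isCompact.union hP.isCompact) Set.subset_union_left ?_ ?_
      hv hv (closure_mono hSD hvS) (closure_mono hMD (hcl (Or.inl hv.1)))
    · rintro z ⟨h | h, hzA⟩
      · exact hAB ⟨hzA, h⟩
      · exact hAP ⟨hzA, h⟩
    · rw [Set.union_comm]
      exact (SameComp.symm (hSX hs)).trans hmX
  have hsub : A ∪ P ⊆ B ∪ P ∪ A := Set.union_subset Set.subset_union_right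
    (Set.subset_union_right.trans Set.subset_union_left)
  have hwc := sameComp_of_mem_closure (hA.isClosed.union hP.isClosed) hsub
    (closure_mono hSD hwS) hwAP
  exact hwm (hwc.symm.trans (hsm.mono hsub))

end Jordan

section CyclicParam

variable {V : Type*} {G : SimpleGraph V} {x : V} {C : G.Walk x x} {p : ℤ → V}

/-- `p` enumerates the vertices of the cycle `C` in cyclic order, periodically over `ℤ`. -/
structure IsCyclicParam (C : G.Walk x x) (p : ℤ → V) : Prop where
  three_le : 3 ≤ C.length
  eq_iff : ∀ i j, p i = p j ↔ (C.length : ℤ) ∣ i - j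
  mem_support : ∀ v, v ∈ C.support ↔ ∃ i, p i = v
  mem_edges : ∀ e, e ∈ C.edges ↔ ∃ i, e = s(p i, p (i + 1))

theorem SimpleGraph.Walk.IsCycle.exists_isCyclicParam (hC : C.IsCycle) :
    ∃ p, IsCyclicParam C p := by
  have h3 := hC.three_le_length
  have hc : (0 : ℤ) < C.length := by omega
  have hp : ∀ n : ℕ, n ≤ C.length →
      C.getVert ((n : ℤ) % C.length).toNat = C.getVert n := by
    intro n hn
    rcases hn.eq_or_lt with rfl | hn
    · simp
    · rw [Int.emod_eq_of_lt (by omega) (by omega)]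
      simp
  refine ⟨fun i => C.getVert (i % C.length).toNat, h3, fun i j => ⟨fun h => ?_, fun h => ?_⟩,
    fun v => ⟨fun h => ?_, ?_⟩, fun e => ⟨fun h => ?_, ?_⟩⟩
  · have hi := Int.emod_lt_of_pos i hc
    have hj := Int.emod_lt_of_pos j hc
    have hi' := Int.emod_nonneg i hc.ne'
    have hj' := Int.emod_nonneg j hc.ne'
    have := hC.getVert_injOn' (by simp only [Set.mem_ofPred_eq]; omega)
      (by simp only [Set.mem_ofPred_eq]; omega) h
    exact Int.ModEq.dvd (show i % C.length = j % C.length by omega).symm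
  · have : i % C.length = j % C.length := (Int.modEq_iff_dvd.2 h).symm
    simp only [this]
  · obtain ⟨n, rfl, hn⟩ := SimpleGraph.Walk.mem_support_iff_exists_getVert.1 h
    exact ⟨n, hp n hn⟩
  · rintro ⟨i, rfl⟩
    exact C.getVert_mem_support _
  · induction e with
    | _ u v =>
      obtain ⟨n, hn, h⟩ := (SimpleGraph.Walk.mk_mem_edges_iff_exists C).1 h
      refine ⟨n, ?_⟩
      have h1 := hp n hn.le
      have h2 := hp (n + 1) hn
      push_cast at h2
      rw [h1, h2]
      exact h.symm
  · rintro ⟨i, rfl⟩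
    have hi := Int.emod_lt_of_pos i hc
    have hi' := Int.emod_nonneg i hc.ne'
    refine (SimpleGraph.Walk.mk_mem_edges_iff_exists C).2 ⟨(i % C.length).toNat, by omega, ?_⟩
    have h2 := hp ((i % C.length).toNat + 1) (by omega)
    push_cast at h2
    rw [← h2, Int.toNat_of_nonneg hi', Int.emod_add_emod]

namespace IsCyclicParam

theorem shift (hp : IsCyclicParam C p) (k : ℤ) : IsCyclicParam C fun i => p (i + k) where
  three_le := hp.three_le
  eq_iff i j := by rw [hp.eq_iff]; ring_nf
  mem_support v := by
    rw [hp.mem_support]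
    exact ⟨fun ⟨i, h⟩ => ⟨i - k, by simpa using h⟩, fun ⟨i, h⟩ => ⟨_, h⟩⟩
  mem_edges e := by
    rw [hp.mem_edges]
    exact ⟨fun ⟨i, h⟩ => ⟨i - k, by rw [h]; ring_nf⟩, fun ⟨i, h⟩ => ⟨i + k, by rw [h]; ring_nf⟩⟩

theorem reflect (hp : IsCyclicParam C p) (k : ℤ) : IsCyclicParam C fun i => p (k - i) where
  three_le := hp.three_le
  eq_iff i j := by rw [hp.eq_iff, ← dvd_neg]; ring_nf
  mem_support v := by
    rw [hp.mem_support]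
    exact ⟨fun ⟨i, h⟩ => ⟨k - i, by simpa using h⟩, fun ⟨i, h⟩ => ⟨_, h⟩⟩
  mem_edges e := by
    rw [hp.mem_edges]
    constructor
    · rintro ⟨i, rfl⟩
      exact ⟨k - i - 1, by rw [Sym2.eq_swap]; ring_nf⟩
    · rintro ⟨i, rfl⟩
      exact ⟨k - i - 1, by rw [Sym2.eq_swap]; ring_nf⟩

variable (hp : IsCyclicParam C p)
include hp

theorem edge_mem (i : ℤ) : s(p i, p (i + 1)) ∈ C.edges := (hp.mem_edges _).2 ⟨i, rfl⟩

theorem adj (i : ℤ) : G.Adj (p i) (p (i + 1)) := C.adj_of_mem_edges (hp.edge_mem i)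

theorem mem (i : ℤ) : p i ∈ C.support := (hp.mem_support _).2 ⟨i, rfl⟩

theorem add_length (i : ℤ) : p (i + C.length) = p i := (hp.eq_iff _ _).2 (by simp)

theorem inj {i j a : ℤ} (h : p i = p j) (hi : a ≤ i) (hj : a ≤ j) (hi' : i < a + C.length)
    (hj' : j < a + C.length) : i = j := by
  obtain ⟨k, hk⟩ := (hp.eq_iff i j).1 h
  have h3 := hp.three_le
  have : k = 0 := by
    rcases lt_trichotomy k 0 with h | h | h
    · nlinarith
    · exact h
    · nlinarith
  subst this
  omega

theorem ne {i j : ℤ} (h : i < j) (h' : j < i + C.length) : p i ≠ p j := fun e => by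
  have := hp.inj e le_rfl h.le (by omega) h'
  omega

theorem exists_mem_Ico {v : V} (hv : v ∈ C.support) (a : ℤ) :
    ∃ i, a ≤ i ∧ i < a + C.length ∧ p i = v := by
  obtain ⟨i, rfl⟩ := (hp.mem_support v).1 hv
  have hc : (0 : ℤ) < C.length := by have := hp.three_le; omega
  refine ⟨a + (i - a) % C.length, by have := Int.emod_nonneg (i - a) hc.ne'; omega,
    by have := Int.emod_lt_of_pos (i - a) hc; omega, (hp.eq_iff _ _).2 ?_⟩
  have := Int.emod_add_mul_ediv (i - a) C.length
  exact ⟨-((i - a) / C.length), by linarith⟩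

theorem exists_edge_mem_Ico {e : Sym2 V} (he : e ∈ C.edges) (a : ℤ) :
    ∃ i, a ≤ i ∧ i < a + C.length ∧ e = s(p i, p (i + 1)) := by
  obtain ⟨j, rfl⟩ := (hp.mem_edges e).1 he
  obtain ⟨i, h1, h2, h3⟩ := hp.exists_mem_Ico (hp.mem j) a
  refine ⟨i, h1, h2, ?_⟩
  rw [h3, (hp.eq_iff (i + 1) (j + 1)).2]
  have := (hp.eq_iff _ _).1 h3
  rwa [add_sub_add_right_eq_sub]

theorem edge_eq_iff {i j : ℤ} :
    s(p i, p (i + 1)) = s(p j, p (j + 1)) ↔ (C.length : ℤ) ∣ i - j := by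
  refine ⟨fun h => ?_, fun h => ?_⟩
  · rcases Sym2.eq_iff.1 h with ⟨h, -⟩ | ⟨h1, h2⟩
    · exact (hp.eq_iff _ _).1 h
    · have d := dvd_sub ((hp.eq_iff _ _).1 h2) ((hp.eq_iff _ _).1 h1)
      have h3 := hp.three_le
      have := Int.le_of_dvd (by omega) d
      omega
  · rw [(hp.eq_iff i j).2 h, (hp.eq_iff (i + 1) (j + 1)).2]
    rwa [add_sub_add_right_eq_sub]

theorem edge_inj {i j a : ℤ} (h : s(p i, p (i + 1)) = s(p j, p (j + 1))) (hi : a ≤ i) (hj : a ≤ j)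
    (hi' : i < a + C.length) (hj' : j < a + C.length) : i = j :=
  hp.inj ((hp.eq_iff _ _).2 (hp.edge_eq_iff.1 h)) hi hj hi' hj'

theorem card_filter_edges (Q : Sym2 V → Prop) (a : ℤ) :
    (C.edges.toFinset.filter Q).card =
      ((Finset.Ico a (a + C.length)).filter fun i => Q s(p i, p (i + 1))).card := by
  symm
  refine Finset.card_bij (fun i _ => s(p i, p (i + 1))) ?_ ?_ ?_
  · intro i hi
    rw [Finset.mem_filter] at hi ⊢
    exact ⟨List.mem_toFinset.2 (hp.edge_mem i), hi.2⟩
  · intro i hi j hj h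
    rw [Finset.mem_filter, Finset.mem_Ico] at hi hj
    exact hp.edge_inj h hi.1.1 hj.1.1 hi.1.2 hj.1.2
  · intro e he
    rw [Finset.mem_filter, List.mem_toFinset] at he
    obtain ⟨i, h1, h2, rfl⟩ := hp.exists_edge_mem_Ico he.1 a
    exact ⟨i, Finset.mem_filter.2 ⟨Finset.mem_Ico.2 ⟨h1, h2⟩, he.2⟩, rfl⟩

end IsCyclicParam

theorem SimpleGraph.exists_isCycle_of_isChain {l : List V} (hl : 3 ≤ l.length) (hnd : l.Nodup)
    (hchain : l.IsChain G.Adj) (hne : l ≠ []) (hadj : G.Adj (l.getLast hne) (l.head hne)) :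
    ∃ (y : V) (C' : G.Walk y y), C'.IsCycle ∧ C'.length = l.length ∧ ∀ v ∈ l, v ∈ C'.support := by
  set P := SimpleGraph.Walk.ofSupport l hne hchain with hP
  have hsup : P.support = l := SimpleGraph.Walk.support_ofSupport hne hchain
  have hpath : P.IsPath := by
    rw [SimpleGraph.Walk.isPath_def, hsup]
    exact hnd
  have hlen : P.length + 1 = l.length := by
    rw [← SimpleGraph.Walk.length_support, hsup]
  refine ⟨_, SimpleGraph.Walk.cons hadj P, ?_, by rw [SimpleGraph.Walk.length_cons, hlen],
    fun v hv => by rw [SimpleGraph.Walk.support_cons, hsup]; exact List.mem_cons_of_mem _ hv⟩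
  refine (SimpleGraph.Walk.cons_isCycle_iff _ _).2 ⟨hpath, fun h => ?_⟩
  rw [Sym2.eq_swap] at h
  have h1 := hpath.eq_snd_of_mem_edges h
  rw [SimpleGraph.Walk.snd, eq_comm, hpath.getVert_eq_end_iff (by omega)] at h1
  omega

variable [Fintype V]

theorem IsLongestIsolatingCycle.false_of_isChain (hC : IsLongestIsolatingCycle G C)
    (hp : IsCyclicParam C p) {a b : ℤ} (hab : a ≤ b) (hb : b < a + C.length) {L : List V}
    (hchain : L.IsChain G.Adj) (hnd : L.Nodup) (hhead : L.head? = some (p a))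
    (hlast : L.getLast? = some (p b)) (hmem : ∀ k, a ≤ k → k ≤ b → p k ∈ L)
    (hout : ∀ k, b < k → k < a + C.length → p k ∉ L) (hlen : b - a + 1 < L.length) : False := by
  have hL : L ≠ [] := by rintro rfl; simp at hhead
  set n := (a + C.length - 1 - b).toNat with hn
  have hn' : (n : ℤ) = a + C.length - 1 - b := by omega
  set M := (List.range n).map fun k : ℕ => p (b + 1 + k) with hM
  have hMmem : ∀ v, v ∈ M ↔ ∃ k : ℕ, k < n ∧ p (b + 1 + k) = v := by simp [hM]
  have hMget : ∀ k (hk : k < M.length), M[k] = p (b + 1 + k) := by simp [hM]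
  have hMlen : M.length = n := by simp [hM]
  have hMchain : M.IsChain G.Adj := by
    rw [List.isChain_iff_getElem]
    intro k hk
    rw [hMget, hMget]
    have := hp.adj (b + 1 + k)
    push_cast
    rwa [← add_assoc]
  have hLM : (L ++ M).IsChain G.Adj := by
    rw [List.isChain_append]
    refine ⟨hchain, hMchain, fun u hu v hv => ?_⟩
    rw [hlast, Option.mem_some_iff] at hu
    rw [← hu]
    have : M.head? = M[0]? := List.head?_eq_getElem?
    rw [this, Option.mem_def, List.getElem?_eq_some_iff] at hv
    obtain ⟨h0, hv⟩ := hv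
    rw [← hv, hMget]
    simpa using hp.adj b
  have hndLM : (L ++ M).Nodup := by
    refine List.Nodup.append hnd ?_ ?_
    · rw [hM]
      refine (List.nodup_map_iff_inj_on List.nodup_range).2 fun i hi j hj hij => ?_
      rw [List.mem_range] at hi hj
      have := hp.inj (a := b + 1) hij (by omega) (by omega) (by omega) (by omega)
      omega
    · intro v hv hvM
      obtain ⟨k, hk, rfl⟩ := (hMmem v).1 hvM
      exact hout _ (by omega) (by omega) hv
  have hne : L ++ M ≠ [] := by simp [hL]
  have hhd : (L ++ M).head hne = p a := by
    rw [List.head_append_of_ne_nil hL]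
    exact (List.head_eq_iff_head?_eq_some hL).2 hhead
  have hlst : (L ++ M).getLast hne = p (a + C.length - 1) := by
    by_cases hM0 : M = []
    · have : n = 0 := by rw [← hMlen, hM0]; rfl
      have hb' : b = a + C.length - 1 := by omega
      simp only [hM0, List.append_nil]
      rw [← hb']
      exact (List.getLast_eq_iff_getLast?_eq_some hL).2 hlast
    · rw [List.getLast_append_of_ne_nil _ hM0, List.getLast_eq_getElem, hMget]
      have : 0 < M.length := List.length_pos_iff.2 hM0
      congr 1
      omega
  have hadj : G.Adj ((L ++ M).getLast hne) ((L ++ M).head hne) := by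
    rw [hhd, hlst, ← hp.add_length a]
    simpa using hp.adj (a + C.length - 1)
  have hlen' : (L ++ M).length = L.length + n := by rw [List.length_append, hMlen]
  have h3 := hp.three_le
  obtain ⟨y, C', hcyc, hl, hsup⟩ := SimpleGraph.exists_isCycle_of_isChain (by omega) hndLM hLM hne
    hadj
  have hsub : ∀ v ∈ C.support, v ∈ C'.support := fun v hv => by
    obtain ⟨i, hi1, hi2, rfl⟩ := hp.exists_mem_Ico hv a
    refine hsup _ (List.mem_append.2 ?_)
    by_cases hib : i ≤ b
    · exact Or.inl (hmem i hi1 hib)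
    · refine Or.inr ((hMmem _).2 ⟨(i - b - 1).toNat, by omega, ?_⟩)
      congr 1
      omega
  have := hC.2.2 y C' hcyc fun v hv => ⟨(hC.2.1 v fun h => hv (hsub v h)).1, fun w hw =>
    hsub w ((hC.2.1 v fun h => hv (hsub v h)).2 w hw)⟩
  omega

theorem ThreeConnected.exists_adj_ne (h : ThreeConnected G) (hp : IsCyclicParam C p)
    (hc : 4 ≤ C.length) (i : ℤ) : ∃ w, G.Adj (p i) w ∧ w ≠ p (i - 1) ∧ w ≠ p (i + 1) := by
  have hcon := h.2 {p (i - 1), p (i + 1)} Finset.card_le_two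
  have h1 : p i ∈ ((↑({p (i - 1), p (i + 1)} : Finset V) : Set V)ᶜ) := by
    simp [(hp.ne (i := i - 1) (j := i) (by omega) (by omega)).symm,
      hp.ne (i := i) (j := i + 1) (by omega) (by omega)]
  have h2 : p (i + 2) ∈ ((↑({p (i - 1), p (i + 1)} : Finset V) : Set V)ᶜ) := by
    simp [(hp.ne (i := i - 1) (j := i + 2) (by omega) (by omega)).symm,
      (hp.ne (i := i + 1) (j := i + 2) (by omega) (by omega)).symm]
  obtain ⟨W⟩ := hcon.preconnected ⟨p i, h1⟩ ⟨p (i + 2), h2⟩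
  have hW : ¬ W.Nil := fun h =>
    hp.ne (i := i) (j := i + 2) (by omega) (by omega) (congrArg Subtype.val h.eq)
  have hsnd := W.snd.2
  simp only [Finset.coe_insert, Finset.coe_singleton, Set.mem_compl_iff, Set.mem_insert_iff,
    Set.mem_singleton_iff, not_or] at hsnd
  exact ⟨W.snd, W.adj_snd hW, hsnd⟩

end CyclicParam

section Drawing

variable {V : Type*} {G : SimpleGraph V} {x : V} {C : G.Walk x x} {p : ℤ → V}

theorem PlaneEmbedding.isArc (emb : PlaneEmbedding G) {u v : V} (h : G.Adj u v) :
    IsArc (emb.arc u v) (emb.pos u) (emb.pos v) := emb.arc_curve u v h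

theorem PlaneEmbedding.exists_of_mem_inter (emb : PlaneEmbedding G) {u v u' v' : V}
    (h : G.Adj u v) (h' : G.Adj u' v') (hne : s(u, v) ≠ s(u', v')) {z : ℝ × ℝ}
    (hz : z ∈ emb.arc u v) (hz' : z ∈ emb.arc u' v') :
    ∃ w, emb.pos w = z ∧ (w = u ∨ w = v) ∧ (w = u' ∨ w = v') := by
  obtain ⟨w, rfl⟩ := emb.arc_inter u v u' v' h h' hne ⟨hz, hz'⟩
  exact ⟨w, rfl, emb.arc_vertex u v h w hz, emb.arc_vertex u' v' h' w hz'⟩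

/-- The union of the arcs of the edges in `s`. -/
def drawEdges (emb : PlaneEmbedding G) (s : Set (Sym2 V)) : Set (ℝ × ℝ) :=
  ⋃ e ∈ s, arcSet emb e

theorem arc_subset_drawEdges {emb : PlaneEmbedding G} {s : Set (Sym2 V)} {u v : V}
    (h : s(u, v) ∈ s) : emb.arc u v ⊆ drawEdges emb s :=
  Set.subset_biUnion_of_mem (u := fun e => arcSet emb e) h

theorem isCompact_drawEdges [Finite V] (emb : PlaneEmbedding G) {s : Set (Sym2 V)}
    (hs : s ⊆ G.edgeSet) : IsCompact (drawEdges emb s) := by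
  refine (Set.toFinite s).isCompact_biUnion fun e he => ?_
  induction e with
  | _ u v => exact (emb.isArc (hs he)).isCompact

theorem drawEdges_union (emb : PlaneEmbedding G) (s t : Set (Sym2 V)) :
    drawEdges emb (s ∪ t) = drawEdges emb s ∪ drawEdges emb t := Set.biUnion_union _ _ _

theorem drawEdges_sdiff_union (emb : PlaneEmbedding G) {s : Set (Sym2 V)} {u v : V}
    (h : s(u, v) ∈ s) : drawEdges emb (s \ {s(u, v)}) ∪ emb.arc u v = drawEdges emb s := by
  have : emb.arc u v = drawEdges emb {s(u, v)} := by simp [drawEdges, arcSet]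
  rw [this, ← drawEdges_union, Set.sdiff_union_of_subset (Set.singleton_subset_iff.2 h)]

theorem drawEdges_sdiff_inter (emb : PlaneEmbedding G) {s : Set (Sym2 V)} (hs : s ⊆ G.edgeSet)
    {u v : V} (h : G.Adj u v) :
    drawEdges emb (s \ {s(u, v)}) ∩ emb.arc u v ⊆ {emb.pos u, emb.pos v} := by
  rintro z ⟨hz, hzuv⟩
  obtain ⟨e, he, hze⟩ := Set.mem_iUnion₂.1 hz
  induction e with
  | _ u' v' =>
    obtain ⟨w, rfl, -, hw⟩ := emb.exists_of_mem_inter (hs he.1) h he.2 hze hzuv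
    rcases hw with rfl | rfl <;> simp

theorem mem_drawEdges_arc {emb : PlaneEmbedding G} {s : Set (Sym2 V)} (hs : s ⊆ G.edgeSet)
    {u v : V} (h : G.Adj u v) (hn : s(u, v) ∉ s) {z : ℝ × ℝ} (hz : z ∈ drawEdges emb s)
    (hzuv : z ∈ emb.arc u v) : ∃ w, emb.pos w = z ∧ (w = u ∨ w = v) ∧ ∃ e ∈ s, w ∈ e := by
  obtain ⟨e, he, hze⟩ := Set.mem_iUnion₂.1 hz
  induction e with
  | _ u' v' =>
    obtain ⟨w, rfl, hw', hw⟩ := emb.exists_of_mem_inter (hs he) h (fun e => hn (e ▸ he)) hze hzuv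
    exact ⟨w, rfl, hw, _, he, by simpa using hw'⟩

theorem exists_of_pos_mem_drawEdges {emb : PlaneEmbedding G} {s : Set (Sym2 V)}
    (hs : s ⊆ G.edgeSet) {w : V} (hw : emb.pos w ∈ drawEdges emb s) : ∃ e ∈ s, w ∈ e := by
  obtain ⟨e, he, hze⟩ := Set.mem_iUnion₂.1 hw
  induction e with
  | _ u' v' => exact ⟨_, he, by simpa using emb.arc_vertex _ _ (hs he) w hze⟩

theorem subset_closure_of_face [Finite V] {emb : PlaneEmbedding G} {s : Set (Sym2 V)}
    (hs : s ⊆ G.edgeSet) {f : Set (ℝ × ℝ)} (hf : IsFaceOf (drawEdges emb s) f) {u v : V}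
    (h : s(u, v) ∈ s) {z : ℝ × ℝ} (hz : z ∈ closure f)
    (hzuv : z ∈ emb.arc u v \ {emb.pos u, emb.pos v}) : emb.arc u v ⊆ closure f := by
  obtain ⟨y, hy, rfl⟩ := hf
  rw [← drawEdges_sdiff_union emb h] at hz ⊢
  exact (emb.isArc (hs h)).subset_closure_of_mem_closure
    (isCompact_drawEdges emb (Set.sdiff_subset.trans hs)) (drawEdges_sdiff_inter emb hs (hs h)) hz
    hzuv

theorem IsFaceOf.eq_of_mem {D f g : Set (ℝ × ℝ)} (hf : IsFaceOf D f) (hg : IsFaceOf D g)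
    {z : ℝ × ℝ} (hzf : z ∈ f) (hzg : z ∈ g) : f = g := by
  obtain ⟨a, -, rfl⟩ := hf
  obtain ⟨b, -, rfl⟩ := hg
  rw [connectedComponentIn_eq hzf, connectedComponentIn_eq hzg]

theorem IsFaceOf.subset_of_mem {D f S : Set (ℝ × ℝ)} (hf : IsFaceOf D f) (hS : IsPreconnected S)
    (hSD : Disjoint S D) {z : ℝ × ℝ} (hzf : z ∈ f) (hzS : z ∈ S) : S ⊆ f := by
  obtain ⟨a, -, rfl⟩ := hf
  rw [connectedComponentIn_eq hzf]
  exact hS.subset_connectedComponentIn hzS hSD.subset_compl_right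

theorem IsFaceOf.disjoint {D f : Set (ℝ × ℝ)} (hf : IsFaceOf D f) : Disjoint f D := by
  obtain ⟨a, -, rfl⟩ := hf
  exact Set.disjoint_left.2 fun z hz => connectedComponentIn_subset _ _ hz

theorem IsFaceOf.isPreconnected {D f : Set (ℝ × ℝ)} (hf : IsFaceOf D f) : IsPreconnected f := by
  obtain ⟨a, -, rfl⟩ := hf
  exact isPreconnected_connectedComponentIn

theorem IsFaceOf.nonempty {D f : Set (ℝ × ℝ)} (hf : IsFaceOf D f) : f.Nonempty := by
  obtain ⟨a, ha, rfl⟩ := hf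
  exact ⟨a, mem_connectedComponentIn ha⟩

theorem drawC_eq_drawEdges (emb : PlaneEmbedding G) :
    drawC emb C = drawEdges emb {e | e ∈ C.edges} := rfl

theorem edges_subset_edgeSet : {e | e ∈ C.edges} ⊆ G.edgeSet :=
  fun _ he => C.edges_subset_edgeSet he

theorem mem_support_of_pos_mem {emb : PlaneEmbedding G} {v : V} (h : emb.pos v ∈ drawC emb C) :
    v ∈ C.support := by
  obtain ⟨e, he, hv⟩ := exists_of_pos_mem_drawEdges edges_subset_edgeSet h
  exact SimpleGraph.Walk.mem_support_of_mem_edges he hv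

theorem disjoint_arc_drawC {emb : PlaneEmbedding G} {u v : V} (h : G.Adj u v)
    (hn : s(u, v) ∉ C.edges) :
    Disjoint (emb.arc u v \ {emb.pos u, emb.pos v}) (drawC emb C) := by
  refine Set.disjoint_left.2 fun z hz hzC => hz.2 ?_
  obtain ⟨w, rfl, hw, -⟩ := mem_drawEdges_arc edges_subset_edgeSet h hn hzC hz.1
  rcases hw with rfl | rfl <;> simp

section Seg

/-- The part of the drawing of the cycle from `p i` to `p j`. -/
def cycleSeg (emb : PlaneEmbedding G) (p : ℤ → V) (i j : ℤ) : Set (ℝ × ℝ) :=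
  ⋃ k ∈ Set.Ico i j, emb.arc (p k) (p (k + 1))

variable {emb : PlaneEmbedding G} {i j k l : ℤ}

theorem arc_subset_cycleSeg (h : i ≤ k) (h' : k < j) :
    emb.arc (p k) (p (k + 1)) ⊆ cycleSeg emb p i j :=
  Set.subset_biUnion_of_mem (u := fun k => emb.arc (p k) (p (k + 1))) (⟨h, h'⟩ : k ∈ Set.Ico i j)

theorem cycleSeg_succ_self (i : ℤ) : cycleSeg emb p i (i + 1) = emb.arc (p i) (p (i + 1)) := by
  have : Set.Ico i (i + 1) = {i} := by ext; simp; omega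
  simp [cycleSeg, this]

theorem cycleSeg_union (h : i ≤ j) (h' : j ≤ k) :
    cycleSeg emb p i k = cycleSeg emb p i j ∪ cycleSeg emb p j k := by
  rw [cycleSeg, ← Set.Ico_union_Ico_eq_Ico h h', Set.biUnion_union]
  rfl

variable (hp : IsCyclicParam C p)
include hp

theorem cycleSeg_length (i : ℤ) : cycleSeg emb p i (i + C.length) = drawC emb C := by
  refine Set.Subset.antisymm (Set.iUnion₂_subset fun k _ =>
    arc_subset_drawEdges (s := {e | e ∈ C.edges}) (hp.edge_mem k))
    (Set.iUnion₂_subset fun e he => ?_)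
  obtain ⟨k, h1, h2, rfl⟩ := hp.exists_edge_mem_Ico he i
  exact arc_subset_cycleSeg h1 h2

theorem drawC_eq_union (h : i ≤ j) (h' : j ≤ i + C.length) :
    drawC emb C = cycleSeg emb p i j ∪ cycleSeg emb p j (i + C.length) := by
  rw [← cycleSeg_length hp i, cycleSeg_union h h']

theorem cycleSeg_inter (hjk : j ≤ k) (hl : l ≤ i + C.length) :
    cycleSeg emb p i j ∩ cycleSeg emb p k l ⊆ {emb.pos (p i), emb.pos (p j)} := by
  rintro z ⟨hz, hz'⟩
  obtain ⟨m, hm, hzm⟩ := Set.mem_iUnion₂.1 hz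
  obtain ⟨n, hn, hzn⟩ := Set.mem_iUnion₂.1 hz'
  rw [Set.mem_Ico] at hm hn
  obtain ⟨w, rfl, hw, hw'⟩ := emb.exists_of_mem_inter (hp.adj m) (hp.adj n) (fun e => by
    have := hp.edge_inj (a := i) e (by omega) (by omega) (by omega) (by omega)
    omega) hzm hzn
  obtain ⟨m', hm1, hm2, rfl⟩ : ∃ m', i ≤ m' ∧ m' ≤ j ∧ w = p m' := by
    rcases hw with h | h
    · exact ⟨m, hm.1, by omega, h⟩
    · exact ⟨m + 1, by omega, by omega, h⟩
  obtain ⟨n', hn1, hn2, hn'⟩ : ∃ n', j ≤ n' ∧ n' ≤ i + C.length ∧ p m' = p n' := by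
    rcases hw' with h | h
    · exact ⟨n, by omega, by omega, h⟩
    · exact ⟨n + 1, by omega, by omega, h⟩
  rcases hn2.lt_or_eq with h | rfl
  · have := hp.inj (a := i) hn' hm1 (by omega) (by omega) h
    have : m' = j := by omega
    simp [this]
  · rw [hp.add_length] at hn'
    simp [hn']

theorem isArc_cycleSeg (hij : i < j) (hj : j < i + C.length) :
    IsArc (cycleSeg emb p i j) (emb.pos (p i)) (emb.pos (p j)) := by
  obtain ⟨n, rfl⟩ : ∃ n : ℕ, j = i + 1 + n := ⟨(j - i - 1).toNat, by omega⟩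
  clear hij
  induction n with
  | zero =>
    simp only [Nat.cast_zero, add_zero, cycleSeg_succ_self]
    exact emb.isArc (hp.adj i)
  | succ n ih =>
    push_cast at hj ⊢
    rw [← add_assoc, cycleSeg_union (j := i + 1 + n) (by omega) (by omega), cycleSeg_succ_self]
    refine (ih (by omega)).union (emb.isArc (hp.adj _)) fun z hz => ?_
    have h1 := cycleSeg_inter (emb := emb) hp (i := i) (j := i + 1 + n) le_rfl
      (l := i + 1 + n + 1) (by omega) ⟨hz.1, by rw [cycleSeg_succ_self]; exact hz.2⟩
    rcases h1 with rfl | h1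
    · exfalso
      rcases emb.arc_vertex _ _ (hp.adj _) _ hz.2 with h | h
      · exact hp.ne (by omega) (by omega) h
      · exact hp.ne (by omega) (by omega) h
    · exact h1

theorem pos_mem_cycleSeg (h : i ≤ k) (h' : k ≤ j) (hij : i < j) :
    emb.pos (p k) ∈ cycleSeg emb p i j := by
  rcases h'.lt_or_eq with h' | rfl
  · exact arc_subset_cycleSeg h h' (emb.isArc (hp.adj k)).left_mem
  · refine arc_subset_cycleSeg (k := k - 1) (by omega) (by omega) ?_
    have := (emb.isArc (hp.adj (k - 1))).right_mem
    rwa [sub_add_cancel] at this ⊢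

/-- The closure of `S` meets the relative interior of the part of the cycle from `p i` to
`p j`. -/
def TouchesSeg (emb : PlaneEmbedding G) (p : ℤ → V) (S : Set (ℝ × ℝ)) (i j : ℤ) : Prop :=
  ∃ v ∈ cycleSeg emb p i j \ {emb.pos (p i), emb.pos (p j)}, v ∈ closure S

theorem touchesSeg_of_pos {S : Set (ℝ × ℝ)} (h : i < k) (h' : k < j) (hj : j ≤ i + C.length)
    (hk : emb.pos (p k) ∈ closure S) : TouchesSeg emb p S i j := by
  refine ⟨_, ⟨pos_mem_cycleSeg hp h.le h'.le (h.trans h'), ?_⟩, hk⟩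
  rintro (e | e)
  · exact hp.ne h (by omega) (emb.pos_injective e).symm
  · exact hp.ne h' (by omega) (emb.pos_injective e)

theorem touchesSeg_of_arc {S : Set (ℝ × ℝ)} (h : i ≤ k) (h' : k < j)
    (hk : emb.arc (p k) (p (k + 1)) ⊆ closure S) : TouchesSeg emb p S i j := by
  obtain ⟨v, hv⟩ := (emb.isArc (hp.adj k)).diff_nonempty
  have key : ∀ w, v ≠ emb.pos w := by
    rintro w rfl
    rcases emb.arc_vertex _ _ (hp.adj k) _ hv.1 with rfl | rfl <;> simp at hv
  refine ⟨v, ⟨arc_subset_cycleSeg h h' hv.1, ?_⟩, hk hv.1⟩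
  rintro (e | e)
  exacts [key _ e, key _ e]

theorem cycleSeg_theta {X : Set (ℝ × ℝ)} (hX : IsFaceOf (drawC emb C) X) (hij : i < j)
    (hj : j < i + C.length) {P : Set (ℝ × ℝ)} (hP : IsArc P (emb.pos (p i)) (emb.pos (p j)))
    (hPX : P \ {emb.pos (p i), emb.pos (p j)} ⊆ X) {S : Set (ℝ × ℝ)} (hS : IsPreconnected S)
    (hSX : S ⊆ X) (hSP : Disjoint S P) (h1 : TouchesSeg emb p S i j)
    (h2 : TouchesSeg emb p S j (i + C.length)) : False := by
  obtain ⟨y, -, rfl⟩ := hX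
  obtain ⟨v, hv, hvS⟩ := h1
  obtain ⟨w, hw, hwS⟩ := h2
  rw [drawC_eq_union hp hij.le hj.le] at hPX hSX
  have hB : IsArc (cycleSeg emb p j (i + C.length)) (emb.pos (p i)) (emb.pos (p j)) := by
    have := isArc_cycleSeg (emb := emb) hp (i := j) (j := i + C.length) hj (by omega)
    rw [hp.add_length] at this
    exact this.symm
  rw [hp.add_length, Set.pair_comm] at hw
  exact (isArc_cycleSeg hp hij hj).theta hB hP (cycleSeg_inter hp le_rfl le_rfl) hPX hS hSX hSP
    hv hvS hw hwS

end Seg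

section Sides

variable {emb : PlaneEmbedding G} (hp : IsCyclicParam C p)
include hp

theorem exists_two_sides : ∃ X X', IsFaceOf (drawC emb C) X ∧ IsFaceOf (drawC emb C) X' ∧ X ≠ X' ∧
    ∀ Y, IsFaceOf (drawC emb C) Y → Y = X ∨ Y = X' := by
  have h3 := hp.three_le
  have hA := isArc_cycleSeg (emb := emb) hp (i := 0) (j := 1) (by omega) (by omega)
  have hB := isArc_cycleSeg (emb := emb) hp (i := 1) (j := 0 + C.length) (by omega) (by omega)
  rw [hp.add_length] at hB
  have hAB := cycleSeg_inter (emb := emb) hp (i := 0) (j := 1) le_rfl le_rfl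
  have hD := drawC_eq_union (emb := emb) hp (i := 0) (j := 1) (by omega) (by omega)
  rw [hD]
  obtain ⟨a, b, ha, hb, hab⟩ := hA.exists_not_sameComp hB.symm hAB
  refine ⟨_, _, ⟨a, ha, rfl⟩, ⟨b, hb, rfl⟩, fun h => hab ?_, ?_⟩
  · rw [SameComp, h]
    exact mem_connectedComponentIn hb
  · rintro _ ⟨y, hy, rfl⟩
    rcases hA.jordan_sameComp_or hB.symm hAB ha hb hy with h | h | h
    · exact absurd h hab
    · exact Or.inl h.comp_eq.symm
    · exact Or.inr h.comp_eq.symm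

end Sides

end Drawing

section HDrawing

set_option linter.unusedSectionVars false

variable {V : Type*} [Fintype V] {G : SimpleGraph V} {x : V} {C : G.Walk x x} {p : ℤ → V}
  {emb : PlaneEmbedding G}

theorem Hgraph_adj {u v : V} :
    (Hgraph C).Adj u v ↔ G.Adj u v ∧ (s(u, v) ∈ C.edges ∨ u ∉ C.support ∨ v ∉ C.support) := by
  simp only [Hgraph, SimpleGraph.deleteEdges_adj, chordSet, Set.mem_ofPred_eq,
    SimpleGraph.mem_edgeSet, Sym2.mem_iff, forall_eq_or_imp, forall_eq]
  tauto

theorem edgeSet_Hgraph_subset : (Hgraph C).edgeSet ⊆ G.edgeSet :=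
  SimpleGraph.edgeSet_mono (SimpleGraph.deleteEdges_le _)

theorem edges_subset_Hgraph : {e | e ∈ C.edges} ⊆ (Hgraph C).edgeSet := fun e he => by
  induction e with
  | _ u v => exact Hgraph_adj.2 ⟨C.adj_of_mem_edges he, Or.inl he⟩

theorem drawEdges_mono {s t : Set (Sym2 V)} (h : s ⊆ t) : drawEdges emb s ⊆ drawEdges emb t :=
  Set.biUnion_subset_biUnion_left h

theorem IsIsolating.exists_adj_ne (hiso : IsIsolating G C) {v : V} (hv : v ∉ C.support) (w : V) :
    ∃ u, G.Adj v u ∧ u ∈ C.support ∧ u ≠ w := by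
  obtain ⟨h3, hs⟩ := hiso v hv
  have : 1 < (Finset.univ.filter fun w => G.Adj v w).card := by omega
  obtain ⟨u, hu, hne⟩ := Finset.exists_mem_ne this w
  have hu := (Finset.mem_filter.1 hu).2
  exact ⟨u, hu, hs u hu, hne⟩

theorem drawingH_eq (hp : IsCyclicParam C p) (hiso : IsIsolating G C) :
    drawingH emb C = drawEdges emb (Hgraph C).edgeSet := by
  refine Set.Subset.antisymm (Set.union_subset ?_ ?_) ?_
  · rintro _ ⟨v, -, rfl⟩
    obtain ⟨u, hu⟩ : ∃ u, (Hgraph C).Adj v u := by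
      by_cases hv : v ∈ C.support
      · obtain ⟨i, rfl⟩ := (hp.mem_support v).1 hv
        exact ⟨_, edges_subset_Hgraph (hp.edge_mem i)⟩
      · obtain ⟨u, hu, -⟩ := hiso.exists_adj_ne hv v
        exact ⟨u, Hgraph_adj.2 ⟨hu, Or.inr (Or.inl hv)⟩⟩
    exact arc_subset_drawEdges ((SimpleGraph.mem_edgeSet _).2 hu)
      (emb.isArc (Hgraph_adj.1 hu).1).left_mem
  · simp only [Set.iUnion_subset_iff]
    exact fun u v h _ _ => arc_subset_drawEdges ((SimpleGraph.mem_edgeSet _).2 h)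
  · refine Set.iUnion₂_subset fun e he => ?_
    induction e with
    | _ u v =>
      refine Set.Subset.trans ?_ Set.subset_union_right
      intro z hz
      simp only [Set.mem_iUnion]
      exact ⟨u, v, he, trivial, trivial, hz⟩

theorem drawC_subset_drawEdges : drawC emb C ⊆ drawEdges emb (Hgraph C).edgeSet :=
  drawEdges_mono edges_subset_Hgraph

theorem isClosed_drawC : IsClosed (drawC emb C) :=
  (isCompact_drawEdges emb edges_subset_edgeSet).isClosed

theorem IsFaceOf.exists_superset {D D' f : Set (ℝ × ℝ)} (h : D ⊆ D') (hf : IsFaceOf D' f) :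
    ∃ X, IsFaceOf D X ∧ f ⊆ X := by
  obtain ⟨a, ha, rfl⟩ := hf
  exact ⟨_, ⟨a, fun h' => ha (h h'), rfl⟩, fun z hz => SameComp.mono hz h⟩

theorem IsFaceOf.mem_of_mem_closure {D X : Set (ℝ × ℝ)} (hD : IsClosed D) (hX : IsFaceOf D X)
    {z : ℝ × ℝ} (hz : z ∈ closure X) (hzD : z ∉ D) : z ∈ X := by
  obtain ⟨a, -, rfl⟩ := hX
  exact (closure_comp_subset hD a hz).resolve_right hzD

theorem mem_Vminus_union_Vplus {v : V} : v ∈ Vminus emb C ∪ Vplus emb C ↔ v ∉ C.support := by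
  simp only [Vminus, Vplus, Finset.mem_union, Finset.mem_filter, Finset.mem_univ, true_and]
  tauto

variable {X Y f g : Set (ℝ × ℝ)}

theorem IsFaceOf.pos_mem (hX : IsFaceOf (drawC emb C) X) (hfX : f ⊆ X) {v : V}
    (hv : v ∉ C.support) (hvf : emb.pos v ∈ closure f) : emb.pos v ∈ X :=
  hX.mem_of_mem_closure isClosed_drawC (closure_mono hfX hvf)
    fun h => hv (mem_support_of_pos_mem h)

theorem IsFaceOf.spoke_subset (hX : IsFaceOf (drawC emb C) X) {v w : V} (hv : v ∉ C.support)
    (hvX : emb.pos v ∈ X) (h : G.Adj v w) : emb.arc v w \ {emb.pos w} ⊆ X := by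
  have hn : s(v, w) ∉ C.edges := fun he => hv (C.fst_mem_support_of_mem_edges he)
  have harc := emb.isArc h
  refine hX.subset_of_mem ?_ ?_ hvX ⟨harc.left_mem, fun e => h.ne (emb.pos_injective e)⟩
  · refine harc.isPreconnected_diff.subset_closure (fun z hz => ⟨hz.1, fun h => hz.2 (Or.inr h)⟩)
      fun z hz => harc.subset_closure_diff hz.1
  · refine Set.disjoint_left.2 fun z hz hzC => ?_
    by_cases hzv : z = emb.pos v
    · subst hzv
      exact hv (mem_support_of_pos_mem hzC)
    · exact Set.disjoint_left.1 (disjoint_arc_drawC h hn) ⟨hz.1, fun h => h.elim hzv hz.2⟩ hzC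

theorem IsFaceOf.chord_subset (hX : IsFaceOf (drawC emb C) X) {u v : V} (h : G.Adj u v)
    (hn : s(u, v) ∉ C.edges) {z : ℝ × ℝ} (hz : z ∈ emb.arc u v \ {emb.pos u, emb.pos v})
    (hzX : z ∈ X) : emb.arc u v \ {emb.pos u, emb.pos v} ⊆ X :=
  hX.subset_of_mem (emb.isArc h).isPreconnected_diff (disjoint_arc_drawC h hn) hzX hz

section Param

variable (hp : IsCyclicParam C p)
include hp

theorem drawH_split (i : ℤ) :
    drawEdges emb ((Hgraph C).edgeSet \ {s(p i, p (i + 1))}) ∪ emb.arc (p i) (p (i + 1)) =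
      drawEdges emb (Hgraph C).edgeSet :=
  drawEdges_sdiff_union emb (edges_subset_Hgraph (hp.edge_mem i))

theorem drawC_split (i : ℤ) :
    cycleSeg emb p (i + 1) (i + C.length) ∪ emb.arc (p i) (p (i + 1)) = drawC emb C := by
  rw [drawC_eq_union hp (i := i) (j := i + 1) (by omega) (by have := hp.three_le; omega),
    cycleSeg_succ_self, Set.union_comm]

theorem isArc_cycleSeg_compl (i : ℤ) : IsArc (cycleSeg emb p (i + 1) (i + C.length))
    (emb.pos (p i)) (emb.pos (p (i + 1))) := by
  have h3 := hp.three_le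
  have := isArc_cycleSeg (emb := emb) hp (i := i + 1) (j := i + C.length) (by omega) (by omega)
  rw [hp.add_length] at this
  exact this.symm

theorem cycleSeg_compl_subset (i : ℤ) : cycleSeg emb p (i + 1) (i + C.length) ⊆
    drawEdges emb ((Hgraph C).edgeSet \ {s(p i, p (i + 1))}) := by
  refine Set.iUnion₂_subset fun k hk => arc_subset_drawEdges
    ⟨edges_subset_Hgraph (hp.edge_mem k), fun e => ?_⟩
  have := hp.edge_inj (a := i) e (by have := hk.1; omega) le_rfl hk.2
    (by have := hp.three_le; omega)
  have := hk.1
  omega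

theorem exists_face_of_edge (hX : IsFaceOf (drawC emb C) X) (i : ℤ) :
    ∃ f, IsFaceOf (drawEdges emb (Hgraph C).edgeSet) f ∧ f ⊆ X ∧
      emb.arc (p i) (p (i + 1)) ⊆ closure f := by
  obtain ⟨y, hy, rfl⟩ := hX
  rw [← drawC_split hp i] at hy ⊢
  obtain ⟨a, hya, ha, hcl⟩ := (isArc_cycleSeg_compl hp i).exists_face_of_side (emb.isArc (hp.adj i))
    (isCompact_drawEdges emb (Set.sdiff_subset.trans edgeSet_Hgraph_subset))
    (cycleSeg_compl_subset hp i)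
    (drawEdges_sdiff_inter emb edgeSet_Hgraph_subset (hp.adj i)) hy
  refine ⟨_, ⟨a, by rwa [← drawH_split hp i], rfl⟩, ?_, ?_⟩
  · rw [SameComp.comp_eq hya, drawC_split hp i]
    exact fun z hz => SameComp.mono hz drawC_subset_drawEdges
  · rwa [← drawH_split hp i]

theorem eq_of_edge (hX : IsFaceOf (drawC emb C) X)
    (hf : IsFaceOf (drawEdges emb (Hgraph C).edgeSet) f) (hfX : f ⊆ X)
    (hg : IsFaceOf (drawEdges emb (Hgraph C).edgeSet) g) (hgX : g ⊆ X) {i : ℤ}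
    (hfi : emb.arc (p i) (p (i + 1)) ⊆ closure f) (hgi : emb.arc (p i) (p (i + 1)) ⊆ closure g) :
    f = g := by
  obtain ⟨y, hy, rfl⟩ := hX
  obtain ⟨a, ha, rfl⟩ := hf
  obtain ⟨b, hb, rfl⟩ := hg
  rw [← drawC_split hp i] at hfX hgX
  rw [← drawH_split hp i] at *
  obtain ⟨w, hw⟩ := (emb.isArc (hp.adj i)).diff_nonempty
  have hya := hfX (mem_connectedComponentIn ha)
  have hyb := hgX (mem_connectedComponentIn hb)
  exact SameComp.comp_eq ((isArc_cycleSeg_compl hp i).sameComp_of_side (emb.isArc (hp.adj i))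
    (isCompact_drawEdges emb (Set.sdiff_subset.trans edgeSet_Hgraph_subset))
    (cycleSeg_compl_subset hp i)
    (drawEdges_sdiff_inter emb edgeSet_Hgraph_subset (hp.adj i))
    ((SameComp.symm hya).trans hyb) hw hw (hfi hw.1) (hgi hw.1))

/-- No two chords of the cycle on the same side cross. -/
theorem false_of_chords_cross (hX : IsFaceOf (drawC emb C) X) {i l k m : ℤ} (hil : i < l)
    (hlk : l < k) (hkm : k < m) (hm : m < i + C.length) (h : G.Adj (p i) (p k))
    (hX1 : emb.arc (p i) (p k) \ {emb.pos (p i), emb.pos (p k)} ⊆ X) (h' : G.Adj (p l) (p m))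
    (hX2 : emb.arc (p l) (p m) \ {emb.pos (p l), emb.pos (p m)} ⊆ X) : False := by
  have harc := emb.isArc h'
  refine cycleSeg_theta hp hX (hil.trans hlk) (by omega) (emb.isArc h) hX1
    harc.isPreconnected_diff hX2 ?_ (touchesSeg_of_pos hp hil hlk (by omega)
      (harc.subset_closure_diff harc.left_mem)) (touchesSeg_of_pos hp hkm hm (by omega)
      (harc.subset_closure_diff harc.right_mem))
  refine Set.disjoint_left.2 fun z hz hz' => hz.2 ?_
  obtain ⟨w, rfl, hw, -⟩ := emb.exists_of_mem_inter h' h (fun e => by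
    rcases Sym2.eq_iff.1 e with ⟨e, -⟩ | ⟨e, -⟩
    · exact hp.ne hil (by omega) e.symm
    · exact hp.ne hlk (by omega) e) hz.1 hz'
  rcases hw with rfl | rfl <;> simp

theorem isArc_spokes {v : V} (hv : v ∉ C.support) {i j : ℤ} (hij : i < j) (hj : j < i + C.length)
    (hi : G.Adj v (p i)) (hj' : G.Adj v (p j)) :
    IsArc (emb.arc v (p i) ∪ emb.arc v (p j)) (emb.pos (p i)) (emb.pos (p j)) := by
  refine (emb.isArc hi).symm.union (emb.isArc hj') fun z hz => ?_
  obtain ⟨w, rfl, hw, hw'⟩ := emb.exists_of_mem_inter hi hj'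
    (fun e => hp.ne hij hj (Sym2.congr_right.1 e)) hz.1 hz.2
  rcases hw with rfl | rfl
  · rfl
  · rcases hw' with h | h
    · exact absurd (h ▸ hp.mem i) hv
    · exact absurd h (hp.ne hij hj)

theorem spokes_subset (hX : IsFaceOf (drawC emb C) X) {v : V} (hv : v ∉ C.support)
    (hvX : emb.pos v ∈ X) {i j : ℤ} (hi : G.Adj v (p i)) (hj' : G.Adj v (p j)) :
    (emb.arc v (p i) ∪ emb.arc v (p j)) \ {emb.pos (p i), emb.pos (p j)} ⊆ X := by
  rintro z ⟨hz | hz, hz'⟩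
  · exact hX.spoke_subset hv hvX hi ⟨hz, fun h => hz' (Or.inl h)⟩
  · exact hX.spoke_subset hv hvX hj' ⟨hz, fun h => hz' (Or.inr h)⟩

theorem spokes_subset_drawH {v : V} (hv : v ∉ C.support) {i j : ℤ} (hi : G.Adj v (p i))
    (hj' : G.Adj v (p j)) : emb.arc v (p i) ∪ emb.arc v (p j) ⊆
      drawEdges emb (Hgraph C).edgeSet :=
  Set.union_subset (arc_subset_drawEdges (Hgraph_adj.2 ⟨hi, Or.inr (Or.inl hv)⟩))
    (arc_subset_drawEdges (Hgraph_adj.2 ⟨hj', Or.inr (Or.inl hv)⟩))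

/-- A face cannot touch the cycle on both sides of a path of two spokes. -/
theorem false_of_face_spokes (hX : IsFaceOf (drawC emb C) X)
    (hf : IsFaceOf (drawEdges emb (Hgraph C).edgeSet) f) (hfX : f ⊆ X) {v : V}
    (hv : v ∉ C.support) (hvX : emb.pos v ∈ X) {i j : ℤ} (hij : i < j) (hj : j < i + C.length)
    (hi : G.Adj v (p i)) (hj' : G.Adj v (p j)) (h1 : TouchesSeg emb p f i j)
    (h2 : TouchesSeg emb p f j (i + C.length)) : False :=
  cycleSeg_theta hp hX hij hj (isArc_spokes hp hv hij hj hi hj') (spokes_subset hp hX hv hvX hi hj')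
    hf.isPreconnected hfX (hf.disjoint.mono_right (spokes_subset_drawH hp hv hi hj')) h1 h2

theorem not_adj_of_face_corner (hiso : IsIsolating G C) (hX : IsFaceOf (drawC emb C) X)
    (hf : IsFaceOf (drawEdges emb (Hgraph C).edgeSet) f) (hfX : f ⊆ X) {i : ℤ}
    (h1 : emb.arc (p (i - 1)) (p i) ⊆ closure f) (h2 : emb.arc (p i) (p (i + 1)) ⊆ closure f)
    {v : V} (hv : v ∉ C.support) (hvX : emb.pos v ∈ X) : ¬ G.Adj v (p i) := fun h => by
  obtain ⟨u, hu, huC, hne⟩ := hiso.exists_adj_ne hv (p i)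
  obtain ⟨n, hn1, hn2, rfl⟩ := hp.exists_mem_Ico huC i
  have hin : i < n := lt_of_le_of_ne hn1 fun e => hne (by rw [e])
  refine false_of_face_spokes hp hX hf hfX hv hvX hin hn2 h hu
    (touchesSeg_of_arc hp le_rfl hin h2)
    (touchesSeg_of_arc hp (k := i + C.length - 1) (by omega) (by omega) ?_)
  have e1 : p (i + C.length - 1) = p (i - 1) := by rw [← hp.add_length (i - 1)]; ring_nf
  rw [e1, sub_add_cancel, hp.add_length]
  exact h1

theorem false_of_chord_spokes (hX : IsFaceOf (drawC emb C) X) {v : V} (hv : v ∉ C.support)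
    (hvX : emb.pos v ∈ X) {a i b k : ℤ} (hai : a < i) (hib : i < b) (hbk : b < k)
    (hk : k < a + C.length) (ha : G.Adj v (p a)) (hb : G.Adj v (p b)) (h : G.Adj (p i) (p k))
    (hX1 : emb.arc (p i) (p k) \ {emb.pos (p i), emb.pos (p k)} ⊆ X) : False := by
  have harc := isArc_spokes (emb := emb) hp hv (hai.trans hib) (by omega) ha hb
  refine cycleSeg_theta hp hX (hib.trans hbk) (by omega) (emb.isArc h) hX1
    harc.isPreconnected_diff (spokes_subset hp hX hv hvX ha hb) ?_ (touchesSeg_of_pos hp hib hbk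
      (by omega) (harc.subset_closure_diff harc.right_mem)) (touchesSeg_of_pos hp
      (k := a + C.length) hk (by omega) (by omega) ?_)
  · have key : ∀ n, n = a ∨ n = b → G.Adj v (p n) → ∀ z ∈ emb.arc v (p n),
        z ∈ emb.arc (p i) (p k) → False := by
      intro n hn hvn z hz hz'
      obtain ⟨w, rfl, hw, hw'⟩ := emb.exists_of_mem_inter hvn h
        (fun e => hv (by
          have : v ∈ s(p i, p k) := e ▸ Sym2.mem_mk_left _ _
          rcases Sym2.mem_iff.1 this with h | h
          exacts [h ▸ hp.mem i, h ▸ hp.mem k])) hz hz'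
      rcases hw with rfl | rfl
      · rcases hw' with h | h
        exacts [hv (h ▸ hp.mem i), hv (h ▸ hp.mem k)]
      · have : n = i ∨ n = k := by
          refine hw'.imp (fun e => ?_) fun e => ?_ <;>
            exact hp.inj (a := a) e (by omega) (by omega) (by omega) (by omega)
        omega
    refine Set.disjoint_left.2 fun z hz hz' => ?_
    rcases hz.1 with hz | hz
    exacts [key a (Or.inl rfl) ha z hz hz', key b (Or.inr rfl) hb z hz hz']
  · rw [hp.add_length]
    exact harc.subset_closure_diff harc.left_mem

end Param

end HDrawing

section MinorFaces

set_option linter.unusedSectionVars false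

variable {V : Type*} [Fintype V] {G : SimpleGraph V} {x : V} {C : G.Walk x x} {p : ℤ → V}
  {emb : PlaneEmbedding G} {X Y f g : Set (ℝ × ℝ)} {v : V} {a b i j k : ℤ}

/-- `f` is a minor face of `H` on the side `X` of the cycle, its vertex off the cycle is `v`, and
its edges on the cycle form the path from `p a` to `p b`. -/
structure FaceIv (emb : PlaneEmbedding G) (C : G.Walk x x) (p : ℤ → V) (X f : Set (ℝ × ℝ)) (v : V)
    (a b : ℤ) : Prop where
  subset : f ⊆ X
  minor : MinorFaceH emb C f
  off : v ∉ C.support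
  pos_mem : emb.pos v ∈ X
  lt : a < b
  lt_add : b < a + C.length
  adj_left : G.Adj v (p a)
  adj_right : G.Adj v (p b)
  not_adj : ∀ k, a < k → k < b → ¬ G.Adj v (p k)
  inc_iff : ∀ j, a ≤ j → j < a + C.length → (incEdge emb f s(p j, p (j + 1)) ↔ j < b)

theorem exists_nearest_adj (hp : IsCyclicParam C p) (hiso : IsIsolating G C) (hv : v ∉ C.support)
    (i : ℤ) : ∃ a b, a ≤ i ∧ i < b ∧ b < a + C.length ∧ G.Adj v (p a) ∧ G.Adj v (p b) ∧
      ∀ k, a < k → k < b → ¬ G.Adj v (p k) := by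
  have h3 := hp.three_le
  obtain ⟨w, hw, hwC, -⟩ := hiso.exists_adj_ne hv v
  obtain ⟨k₁, h11, h12, rfl⟩ := hp.exists_mem_Ico hwC (i - C.length + 1)
  obtain ⟨a, ⟨hai, haa⟩, hamax⟩ := Int.exists_greatest_of_bdd
    (P := fun k => k ≤ i ∧ G.Adj v (p k)) ⟨i, fun _ h => h.1⟩ ⟨k₁, by omega, hw⟩
  obtain ⟨b, ⟨hib, hbb⟩, hbmin⟩ := Int.exists_least_of_bdd
    (P := fun k => i < k ∧ G.Adj v (p k)) ⟨i, fun _ h => h.1.le⟩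
    ⟨k₁ + C.length, by omega, by rwa [hp.add_length]⟩
  refine ⟨a, b, hai, hib, ?_, haa, hbb, fun k hak hkb hk => ?_⟩
  · obtain ⟨u, hu, huC, hne⟩ := hiso.exists_adj_ne hv (p a)
    obtain ⟨k, h1, h2, rfl⟩ := hp.exists_mem_Ico huC a
    have hak : a ≠ k := fun e => hne (by rw [e])
    rcases le_or_gt k i with hki | hki
    · have := hamax k ⟨hki, hu⟩
      omega
    · have := hbmin k ⟨hki, hu⟩
      omega
  · rcases le_or_gt k i with hki | hki
    · have := hamax k ⟨hki, hk⟩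
      omega
    · have := hbmin k ⟨hki, hk⟩
      omega

/-- The edges on the boundary of a minor face at the vertex `v`. -/
def wheelEdges (C : G.Walk x x) (v : V) : Set (Sym2 V) := {e | e ∈ C.edges} ∪ G.incidenceSet v

theorem wheelEdges_subset_Hgraph (hv : v ∉ C.support) :
    wheelEdges C v ⊆ (Hgraph C).edgeSet := by
  refine Set.union_subset edges_subset_Hgraph fun e he => ?_
  induction e with
  | _ u w =>
    refine Hgraph_adj.2 ⟨he.1, Or.inr ?_⟩
    rcases Sym2.mem_iff.1 he.2 with rfl | rfl
    exacts [Or.inl hv, Or.inr hv]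

theorem pos_mem_closure_of_mem (hiso : IsIsolating G C)
    (hf : IsFaceOf (drawEdges emb (Hgraph C).edgeSet) f) {z : ℝ × ℝ} (hz : z ∈ closure f)
    (hzC : z ∉ drawC emb C) {u w : V} (h : (Hgraph C).Adj u w) (hu : u ∉ C.support)
    (hp : IsCyclicParam C p) (hzuw : z ∈ emb.arc u w) : emb.pos u ∈ closure f := by
  have hG := (Hgraph_adj.1 h).1
  by_cases h1 : z = emb.pos u
  · exact h1 ▸ hz
  have hw : w ∈ C.support := (hiso u hu).2 w hG
  have h2 : z ≠ emb.pos w := by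
    rintro rfl
    obtain ⟨k, rfl⟩ := (hp.mem_support w).1 hw
    exact hzC (arc_subset_drawEdges (s := {e | e ∈ C.edges}) (hp.edge_mem k)
      (emb.isArc (hp.adj k)).left_mem)
  exact subset_closure_of_face edgeSet_Hgraph_subset hf h hz
    ⟨hzuw, fun h => h.elim h1 h2⟩ (emb.isArc hG).left_mem

theorem isFaceOf_wheel (hp : IsCyclicParam C p) (hiso : IsIsolating G C)
    (hf : IsFaceOf (drawEdges emb (Hgraph C).edgeSet) f) (hv : v ∉ C.support)
    (huniq : ∀ u, u ∉ C.support → emb.pos u ∈ closure f → u = v) :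
    IsFaceOf (drawEdges emb (wheelEdges C v)) f := by
  have hcl : IsClosed (drawEdges emb (Hgraph C).edgeSet) :=
    (isCompact_drawEdges emb edgeSet_Hgraph_subset).isClosed
  have hsub := drawEdges_mono (emb := emb) (wheelEdges_subset_Hgraph (C := C) hv)
  obtain ⟨y, hy, rfl⟩ := id hf
  refine ⟨y, fun h => hy (hsub h), (comp_eq_of_frontier_subset hcl hsub hy fun z hz => ?_).symm⟩
  by_cases hzC : z ∈ drawC emb C
  · exact drawEdges_mono Set.subset_union_left hzC
  obtain ⟨e, he, hze⟩ := Set.mem_iUnion₂.1 (frontier_comp_subset hcl y hz)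
  have key : ∀ u w, (Hgraph C).Adj u w → z ∈ emb.arc u w → u ∉ C.support →
      z ∈ drawEdges emb (wheelEdges C v) := fun u w h hzuw hu => by
    obtain rfl := huniq u hu (pos_mem_closure_of_mem hiso hf (frontier_subset_closure hz) hzC h hu
      hp hzuw)
    exact arc_subset_drawEdges (Or.inr ⟨(Hgraph_adj.1 h).1, Sym2.mem_mk_left _ _⟩) hzuw
  induction e with
  | _ u w =>
    rcases (Hgraph_adj.1 he).2 with h | h | h
    · exact absurd (arc_subset_drawEdges (s := {e | e ∈ C.edges}) h hze) hzC
    · exact key u w he hze h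
    · exact key w u ((SimpleGraph.mem_edgeSet _).1 he).symm (emb.arc_symm u w ▸ hze) h

theorem cycleSeg_subset_closure (hp : IsCyclicParam C p)
    (hf : IsFaceOf (drawEdges emb (wheelEdges C v)) f) (hv : v ∉ C.support) (hab : a < b)
    (hb : b < a + C.length) (hn : ∀ k, a < k → k < b → ¬ G.Adj v (p k)) (hai : a ≤ i) (hib : i < b)
    (hi : emb.arc (p i) (p (i + 1)) ⊆ closure f) : cycleSeg emb p a b ⊆ closure f := by
  have hD : drawEdges emb (wheelEdges C v) =
      (cycleSeg emb p b (a + C.length) ∪ drawEdges emb (G.incidenceSet v)) ∪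
        cycleSeg emb p a b := by
    rw [wheelEdges, drawEdges_union, ← drawC_eq_drawEdges, drawC_eq_union hp hab.le hb.le,
      Set.union_comm (cycleSeg emb p a b), Set.union_right_comm]
  have hseg : IsCompact (cycleSeg emb p b (a + C.length)) :=
    (isArc_cycleSeg hp hb (by omega)).isCompact
  obtain ⟨w, hw, hwf⟩ := touchesSeg_of_arc hp hai hib hi
  obtain ⟨y, hy, rfl⟩ := hf
  rw [hD] at hwf ⊢
  refine (isArc_cycleSeg hp hab hb).subset_closure_of_mem_closure
    (hseg.union (isCompact_drawEdges emb (G.incidenceSet_subset v))) ?_ hwf hw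
  rw [Set.union_inter_distrib_right]
  refine Set.union_subset ?_ ?_
  · rw [Set.inter_comm]
    exact cycleSeg_inter hp le_rfl le_rfl
  · rintro z ⟨hz, hz'⟩
    obtain ⟨m, hm, hzm⟩ := Set.mem_iUnion₂.1 hz'
    obtain ⟨w, rfl, hw, e, he, hwe⟩ := mem_drawEdges_arc (G.incidenceSet_subset v) (hp.adj m)
      (fun h => hv (by
        rcases Sym2.mem_iff.1 h.2 with h | h
        exacts [h ▸ hp.mem m, h ▸ hp.mem _])) hz hzm
    obtain ⟨n, hn1, hn2, rfl⟩ : ∃ n, a ≤ n ∧ n ≤ b ∧ p n = w := by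
      have := hm.1
      have := hm.2
      rcases hw with rfl | rfl
      exacts [⟨m, by omega, by omega, rfl⟩, ⟨m + 1, by omega, by omega, rfl⟩]
    have hvn : G.Adj v (p n) := by
      have hne : v ≠ p n := fun h => hv (h ▸ hp.mem n)
      have : e = s(v, p n) := (Sym2.mem_and_mem_iff hne).1 ⟨he.2, hwe⟩
      exact (this ▸ he).1
    by_contra h
    have h1 : a ≠ n := by rintro rfl; simp at h
    have h2 : n ≠ b := by rintro rfl; simp at h
    exact hn n (by omega) (by omega) hvn

theorem exists_faceIv (hp : IsCyclicParam C p) (hiso : IsIsolating G C)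
    (hX : IsFaceOf (drawC emb C) X) (hfX : f ⊆ X) (hf : MinorFaceH emb C f)
    (hi : incEdge emb f s(p i, p (i + 1))) :
    ∃ v a b, a ≤ i ∧ i < b ∧ FaceIv emb C p X f v a b := by
  obtain ⟨hface, v, ⟨hv, hvf⟩, huniq⟩ := id hf
  rw [drawingH_eq hp hiso] at hface
  rw [mem_Vminus_union_Vplus] at hv
  have hvX := hX.pos_mem hfX hv hvf
  obtain ⟨a, b, hai, hib, hb, hva, hvb, hn⟩ := exists_nearest_adj hp hiso hv i
  have hwheel := isFaceOf_wheel hp hiso hface hv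
    fun u hu huf => huniq u ⟨mem_Vminus_union_Vplus.2 hu, huf⟩
  have hseg := cycleSeg_subset_closure hp hwheel hv (hai.trans_lt hib) hb hn hai hib hi
  refine ⟨v, a, b, hai, hib, hfX, hf, hv, hvX, hai.trans_lt hib, hb, hva, hvb, hn,
    fun j haj hj => ⟨fun h => ?_, fun hjb => (arc_subset_cycleSeg haj hjb).trans hseg⟩⟩
  by_contra hbj
  exact false_of_face_spokes hp hX hface hfX hv hvX (hai.trans_lt hib) hb hva hvb
    (touchesSeg_of_arc hp hai hib hi) (touchesSeg_of_arc hp (by omega) hj h)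

namespace FaceIv

theorem numCEdges (hp : IsCyclicParam C p) (h : FaceIv emb C p X f v a b) :
    (numCEdges emb C f : ℤ) = b - a := by
  have hlt := h.lt_add
  have h1 := h.lt
  rw [_root_.numCEdges, hp.card_filter_edges _ a]
  have : (Finset.Ico a (a + C.length)).filter (fun i => incEdge emb f s(p i, p (i + 1))) =
      Finset.Ico a b := by
    ext j
    simp only [Finset.mem_filter, Finset.mem_Ico]
    constructor
    · rintro ⟨⟨h1, h2⟩, h3⟩
      exact ⟨h1, (h.inc_iff j h1 h2).1 h3⟩
    · rintro ⟨h1, h2⟩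
      exact ⟨⟨h1, by omega⟩, (h.inc_iff j h1 (by omega)).2 h2⟩
  rw [this, Int.card_Ico]
  omega

theorem inc (h : FaceIv emb C p X f v a b) (h1 : a ≤ j) (h2 : j < b) :
    incEdge emb f s(p j, p (j + 1)) := (h.inc_iff j h1 (by have := h.lt_add; omega)).2 h2

theorem isFaceOf (hp : IsCyclicParam C p) (hiso : IsIsolating G C)
    (h : FaceIv emb C p X f v a b) : IsFaceOf (drawEdges emb (Hgraph C).edgeSet) f :=
  drawingH_eq (emb := emb) hp hiso ▸ h.minor.1

theorem reflect (hp : IsCyclicParam C p) (h : FaceIv emb C p X f v a b) (n : ℤ) :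
    FaceIv emb C (fun i => p (n - i)) X f v (n - b) (n - a) where
  subset := h.subset
  minor := h.minor
  off := h.off
  pos_mem := h.pos_mem
  lt := by have := h.lt; omega
  lt_add := by have := h.lt_add; omega
  adj_left := by simpa using h.adj_right
  adj_right := by simpa using h.adj_left
  not_adj k h1 h2 := h.not_adj _ (by omega) (by omega)
  inc_iff j h1 h2 := by
    have e : s(p (n - j), p (n - (j + 1))) = s(p (n - j - 1), p (n - j - 1 + 1)) := by
      rw [Sym2.eq_swap]
      ring_nf
    rw [e]
    rcases lt_or_ge (n - j - 1) a with hj | hj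
    · have e' : s(p (n - j - 1), p (n - j - 1 + 1)) =
          s(p (n - j - 1 + C.length), p (n - j - 1 + C.length + 1)) :=
        hp.edge_eq_iff.2 (by simp)
      have := h.lt
      rw [e', h.inc_iff _ (by have := h.lt_add; omega) (by omega)]
      omega
    · rw [h.inc_iff _ hj (by have := h.lt_add; omega)]
      omega

theorem shift (h : FaceIv emb C p X f v a b) (n : ℤ) :
    FaceIv emb C (fun i => p (i + n)) X f v (a - n) (b - n) where
  subset := h.subset
  minor := h.minor
  off := h.off
  pos_mem := h.pos_mem
  lt := by have := h.lt; omega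
  lt_add := by have := h.lt_add; omega
  adj_left := by simpa using h.adj_left
  adj_right := by simpa using h.adj_right
  not_adj k h1 h2 := h.not_adj _ (by omega) (by omega)
  inc_iff j h1 h2 := by
    rw [add_right_comm, h.inc_iff _ (by omega) (by omega)]
    omega

end FaceIv

/-- A third edge at a vertex interior to minor faces on both sides of the cycle is a chord ending
in the interval of one of the two faces. -/
theorem exists_chord {X' f' : Set (ℝ × ℝ)} {v' : V} {a' b' : ℤ} (hp : IsCyclicParam C p)
    (h3 : ThreeConnected G) (hc : 4 ≤ C.length)
    (hiso : IsIsolating G C) (hX : IsFaceOf (drawC emb C) X) (hX' : IsFaceOf (drawC emb C) X')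
    (hall : ∀ Y, IsFaceOf (drawC emb C) Y → Y = X ∨ Y = X')
    (h : FaceIv emb C p X f v a b) (h' : FaceIv emb C p X' f' v' a' b') (hai : a < i) (hib : i < b)
    (hai' : a' < i) (hib' : i < b') :
    ∃ k, G.Adj (p i) (p k) ∧ p k ≠ p (i - 1) ∧ p k ≠ p (i + 1) ∧
      ((a ≤ k ∧ k ≤ b ∧ emb.arc (p i) (p k) \ {emb.pos (p i), emb.pos (p k)} ⊆ X) ∨
       (a' ≤ k ∧ k ≤ b' ∧ emb.arc (p i) (p k) \ {emb.pos (p i), emb.pos (p k)} ⊆ X')) := by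
  obtain ⟨w, hw, hw1, hw2⟩ := h3.exists_adj_ne hp hc i
  have inc1 := h.inc (j := i - 1) (by omega) (by omega)
  have inc1' := h'.inc (j := i - 1) (by omega) (by omega)
  rw [sub_add_cancel] at inc1 inc1'
  have hwC : w ∈ C.support := by
    by_contra hwC
    have hpos : emb.pos w ∉ drawC emb C := fun h => hwC (mem_support_of_pos_mem h)
    rcases hall _ ⟨_, hpos, rfl⟩ with e | e
    · exact not_adj_of_face_corner hp hiso hX (h.isFaceOf hp hiso) h.subset inc1
        (h.inc hai.le hib) hwC (e ▸ mem_connectedComponentIn hpos) hw.symm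
    · exact not_adj_of_face_corner hp hiso hX' (h'.isFaceOf hp hiso) h'.subset inc1'
        (h'.inc hai'.le hib') hwC (e ▸ mem_connectedComponentIn hpos) hw.symm
  have hn : s(p i, w) ∉ C.edges := fun he => by
    obtain ⟨m, h1, h2, hm⟩ := hp.exists_edge_mem_Ico he i
    rcases Sym2.eq_iff.1 hm with ⟨e1, e2⟩ | ⟨e1, e2⟩
    · have := hp.inj (a := i) e1 le_rfl h1 (by omega) h2
      exact hw2 (by rw [e2, ← this])
    · refine hw1 (e2.trans ((hp.eq_iff _ _).2 ?_))
      obtain ⟨q, hq⟩ := (hp.eq_iff _ _).1 e1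
      exact ⟨-q, by linarith⟩
  obtain ⟨z, hz⟩ := (emb.isArc hw).diff_nonempty
  have hzC := Set.disjoint_left.1 (disjoint_arc_drawC hw hn) hz
  have key : ∀ {Y g : Set (ℝ × ℝ)} {u : V} {c d : ℤ}, IsFaceOf (drawC emb C) Y →
      FaceIv emb C p Y g u c d → c < i → i < d → z ∈ Y → ∃ k, w = p k ∧ c ≤ k ∧ k ≤ d ∧
        emb.arc (p i) (p k) \ {emb.pos (p i), emb.pos (p k)} ⊆ Y := by
    intro Y g u c d hY hg hci hid hzY
    obtain ⟨k, hk1, hk2, rfl⟩ := hp.exists_mem_Ico hwC c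
    have hsub := hY.chord_subset hw hn hz hzY
    refine ⟨k, rfl, hk1, ?_, hsub⟩
    by_contra hdk
    exact false_of_chord_spokes hp hY hg.off hg.pos_mem hci hid (by omega) hk2 hg.adj_left
      hg.adj_right hw hsub
  rcases hall _ ⟨z, hzC, rfl⟩ with e | e
  · obtain ⟨k, rfl, hk⟩ := key hX h hai hib (e ▸ mem_connectedComponentIn hzC)
    exact ⟨k, hw, hw1, hw2, Or.inl hk⟩
  · obtain ⟨k, rfl, hk⟩ := key hX' h' hai' hib' (e ▸ mem_connectedComponentIn hzC)
    exact ⟨k, hw, hw1, hw2, Or.inr hk⟩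

end MinorFaces

section Core

set_option linter.unusedSectionVars false

variable {V : Type*} [Fintype V] {G : SimpleGraph V} {x : V} {C : G.Walk x x} {p : ℤ → V}
  {emb : PlaneEmbedding G} {X X' Y f g h : Set (ℝ × ℝ)} {u v w : V} {a b i j k : ℤ}

/-- `X` and `X'` are the two sides of the longest isolating cycle `C`, which is parametrized by
`p`. -/
structure CycleSetup (emb : PlaneEmbedding G) (C : G.Walk x x) (p : ℤ → V)
    (X X' : Set (ℝ × ℝ)) : Prop where
  param : IsCyclicParam C p
  longest : IsLongestIsolatingCycle G C
  conn : ThreeConnected G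
  eight_le : 8 ≤ C.length
  left : IsFaceOf (drawC emb C) X
  right : IsFaceOf (drawC emb C) X'
  ne : X ≠ X'
  eq_or_eq : ∀ Y, IsFaceOf (drawC emb C) Y → Y = X ∨ Y = X'

/-- `p i` and `p j` are joined by an edge drawn on the side `X` of the cycle. -/
def ChordIn (emb : PlaneEmbedding G) (p : ℤ → V) (X : Set (ℝ × ℝ)) (i j : ℤ) : Prop :=
  G.Adj (p i) (p j) ∧ emb.arc (p i) (p j) \ {emb.pos (p i), emb.pos (p j)} ⊆ X

theorem ChordIn.symm (hij : ChordIn emb p X i j) : ChordIn emb p X j i :=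
  ⟨hij.1.symm, by rw [emb.arc_symm, Set.pair_comm]; exact hij.2⟩

namespace CycleSetup

variable (S : CycleSetup emb C p X X')
include S

theorem iso : IsIsolating G C := S.longest.2.1

theorem symm : CycleSetup emb C p X' X :=
  { S with left := S.right, right := S.left, ne := S.ne.symm
           eq_or_eq := fun Y hY => (S.eq_or_eq Y hY).symm }

theorem reflect (n : ℤ) : CycleSetup emb C (fun i => p (n - i)) X X' :=
  { S with param := S.param.reflect n }

theorem shift (n : ℤ) : CycleSetup emb C (fun i => p (i + n)) X X' :=
  { S with param := S.param.shift n }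

theorem adj (h : j = i + 1 ∨ i = j + 1) : G.Adj (p i) (p j) := by
  rcases h with rfl | rfl
  exacts [S.param.adj i, (S.param.adj j).symm]

theorem false_of_cross {l m : ℤ} (h : ChordIn emb p X i k) (h' : ChordIn emb p X l m)
    (hil : i < l) (hlk : l < k) (hkm : k < m) (hm : m < i + C.length) : False :=
  false_of_chords_cross S.param S.left hil hlk hkm hm h.1 h.2 h'.1 h'.2

theorem exists_chordIn {a' b' : ℤ} (hf : FaceIv emb C p X f v a b)
    (hg : FaceIv emb C p X' g u a' b') (hai : a < i) (hib : i < b) (hai' : a' < i) (hib' : i < b') :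
    ∃ k, k ≠ i ∧ k ≠ i - 1 ∧ k ≠ i + 1 ∧ (a ≤ k ∧ k ≤ b ∧ ChordIn emb p X i k ∨
      a' ≤ k ∧ k ≤ b' ∧ ChordIn emb p X' i k) := by
  obtain ⟨k, h, h1, h2, hk⟩ := exists_chord S.param S.conn (by have := S.eight_le; omega) S.iso
    S.left S.right S.eq_or_eq hf hg hai hib hai' hib'
  refine ⟨k, ?_, ?_, ?_, hk.imp (fun hk => ⟨hk.1, hk.2.1, h, hk.2.2⟩)
    fun hk => ⟨hk.1, hk.2.1, h, hk.2.2⟩⟩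
  · rintro rfl
    exact h.ne rfl
  · rintro rfl
    exact h1 rfl
  · rintro rfl
    exact h2 rfl

/-- The path from `p a` to `p b` of the cycle cannot be rerouted through a vertex off the cycle. -/
theorem false_of_detour (hu : u ∉ C.support) (hb : b < a + C.length) (I J : List ℤ)
    (hchain : (I.map p ++ u :: J.map p).IsChain G.Adj) (hnd : (I ++ J).Nodup)
    (hhead : I.head? = some a) (hlast : J.getLast? = some b)
    (hmem : ∀ k, k ∈ I ++ J ↔ a ≤ k ∧ k ≤ b) (hlen : b - a < (I ++ J).length) : False := by
  have hI : ∀ {k}, k ∈ I → a ≤ k ∧ k ≤ b := fun h => (hmem _).1 (List.mem_append_left _ h)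
  have hJ : ∀ {k}, k ∈ J → a ≤ k ∧ k ≤ b := fun h => (hmem _).1 (List.mem_append_right _ h)
  have hne : ∀ k, p k ≠ u := fun k e => hu (e ▸ S.param.mem k)
  have hmemL : ∀ k, a ≤ k → k < a + C.length → p k ∈ I.map p ++ u :: J.map p → k ≤ b := by
    intro k h1 h2 hk
    simp only [List.mem_append, List.mem_cons, List.mem_map, hne, false_or] at hk
    rcases hk with ⟨m, hm, e⟩ | ⟨m, hm, e⟩
    · have := hI hm
      have := S.param.inj (a := a) e (by omega) (by omega) (by omega) (by omega)
      omega
    · have := hJ hm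
      have := S.param.inj (a := a) e (by omega) (by omega) (by omega) (by omega)
      omega
  have hab : a ≤ b := (hI (List.mem_of_mem_head? hhead)).2
  refine S.longest.false_of_isChain S.param hab hb hchain ?_ ?_ ?_ ?_ ?_ ?_
  · have h1 : ((I ++ J).map p).Nodup := by
      refine (List.nodup_map_iff_inj_on hnd).2 fun m hm n hn e => ?_
      have := (hmem m).1 hm
      have := (hmem n).1 hn
      exact S.param.inj (a := a) e (by omega) (by omega) (by omega) (by omega)
    rw [List.map_append] at h1
    refine List.nodup_middle.2 (List.nodup_cons.2 ⟨?_, h1⟩)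
    simp only [List.mem_append, List.mem_map, hne, and_false, exists_false, or_self,
      not_false_eq_true]
  · cases I with
    | nil => simp at hhead
    | cons m I => simpa using congrArg (Option.map p) hhead
  · rw [List.getLast?_append_of_ne_nil _ (by simp), List.getLast?_cons]
    simp [hlast]
  · intro k h1 h2
    have := (hmem k).2 ⟨h1, h2⟩
    rw [List.mem_append] at this
    simp only [List.mem_append, List.mem_cons]
    exact this.imp (List.mem_map_of_mem) fun h => Or.inr (List.mem_map_of_mem h)
  · intro k h1 h2 hk
    have := hmemL k (by omega) h2 hk
    omega
  · simp only [List.length_append, List.length_map, List.length_cons, Nat.cast_add,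
      Nat.cast_one] at hlen ⊢
    omega

theorem not_faceIv_one : ¬ FaceIv emb C p Y f u i (i + 1) := fun hf => by
  have := S.eight_le
  refine S.false_of_detour hf.off (a := i) (b := i + 1) (by omega) [i] [i + 1] ?_ ?_ rfl rfl ?_ ?_
  · simpa using ⟨hf.adj_left.symm, hf.adj_right⟩
  · simp
  · simp; omega
  · simp

theorem not_adj_add_two (hf : FaceIv emb C p Y f u (i - 1) (i + 1)) :
    ¬ G.Adj (p i) (p (i + 2)) := fun hadj => by
  have := S.eight_le
  refine S.false_of_detour hf.off (a := i - 1) (b := i + 2) (by omega) [i - 1]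
    [i + 1, i, i + 2] ?_ ?_ rfl rfl ?_ ?_
  · simpa using ⟨hf.adj_left.symm, hf.adj_right, S.adj (by omega), hadj⟩
  · simp; omega
  · simp; omega
  · simp

theorem not_adj_sub_two (hf : FaceIv emb C p Y f u (i - 1) (i + 1)) :
    ¬ G.Adj (p i) (p (i - 2)) := fun hadj => by
  have := S.eight_le
  refine S.false_of_detour hf.off (a := i - 2) (b := i + 1) (by omega) [i - 2, i, i - 1]
    [i + 1] ?_ ?_ rfl rfl ?_ ?_
  · simpa using ⟨hadj.symm, S.adj (by omega), hf.adj_left.symm, hf.adj_right⟩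
  · simp; omega
  · simp; omega
  · simp

variable (hf : FaceIv emb C p X f v 0 7) (hg : FaceIv emb C p X' g u 2 4)
include hf hg

theorem chordIn_three_zero (hh : FaceIv emb C p X' h w 4 6) : ChordIn emb p X 0 3 := by
  have hlen := S.eight_le
  have h1 := S.not_adj_add_two (i := 3) hg
  have h2 := S.not_adj_sub_two (i := 3) hg
  have h3 := S.not_adj_sub_two (i := 5) hh
  norm_num at h1 h2 h3
  obtain ⟨k, k1, k2, k3, hk⟩ := S.exists_chordIn hf hg (i := 3) (by omega) (by omega) (by omega)
    (by omega)
  obtain ⟨l, l1, l2, l3, hl⟩ := S.exists_chordIn hf hh (i := 5) (by omega) (by omega) (by omega)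
    (by omega)
  obtain ⟨k4, k5, hk⟩ := hk.resolve_right (by omega)
  obtain ⟨l4, l5, hl⟩ := hl.resolve_right (by omega)
  have k6 : k ≠ 1 := by rintro rfl; exact h2 hk.1
  have k7 : k ≠ 5 := by rintro rfl; exact h1 hk.1
  have l6 : l ≠ 3 := by rintro rfl; exact h3 hl.1
  rcases eq_or_ne l 7 with rfl | l7
  · have h4 := S.not_adj_add_two (i := 5) hh
    norm_num at h4
    exact absurd hl.1 h4
  rcases eq_or_ne k 0 with rfl | k8
  · exact hk.symm
  · exact (S.false_of_cross hl.symm hk (by omega) (by omega) (by omega) (by omega)).elim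

variable (h03 : ChordIn emb p X 0 3)
include h03

omit hg in
theorem not_faceIv_two : ¬ FaceIv emb C p X' h w 0 2 := fun hh => by
  have hlen := S.eight_le
  have h1 := S.not_adj_add_two (i := 1) hh
  norm_num at h1
  obtain ⟨k, k1, k2, k3, hk⟩ := S.exists_chordIn hf hh (i := 1) (by omega) (by omega) (by omega)
    (by omega)
  obtain ⟨k4, k5, hk⟩ := hk.resolve_right (by omega)
  have k6 : k ≠ 3 := by rintro rfl; exact h1 hk.1
  exact S.false_of_cross h03 hk (by omega) (by omega) (by omega) (by omega)

omit hf hg in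
theorem not_faceIv_three : ¬ FaceIv emb C p X' h w (-1) 2 := fun hh => by
  have := S.eight_le
  refine S.false_of_detour hh.off (a := -1) (b := 3) (by omega) [-1] [2, 1, 0, 3] ?_ (by decide)
    rfl rfl ?_ (by simp)
  · simpa using ⟨hh.adj_left.symm, hh.adj_right, S.adj (by omega), S.adj (by omega), h03.1⟩
  · simp; omega

theorem not_faceIv_four {f₂ : Set (ℝ × ℝ)} {v₂ : V} {a₂ : ℤ} (ha : a₂ = -2 ∨ a₂ = -3)
    (hf₂ : FaceIv emb C p X f₂ v₂ a₂ 0) : ¬ FaceIv emb C p X' h w (-2) 2 := fun hh => by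
  have hlen := S.eight_le
  have h1 := S.not_adj_sub_two (i := 3) hg
  norm_num at h1
  have h11 : ¬ G.Adj (p 1) (p (-1)) := fun hadj => by
    refine S.false_of_detour hh.off (a := -2) (b := 3) (by omega) [-2] [2, 1, -1, 0, 3] ?_
      (by decide) rfl rfl ?_ (by simp)
    · simpa using ⟨hh.adj_left.symm, hh.adj_right, S.adj (by omega), hadj, S.adj (by omega), h03.1⟩
    · simp; omega
  obtain ⟨k, k1, k2, k3, hk⟩ := S.exists_chordIn hf hh (i := 1) (by omega) (by omega) (by omega)
    (by omega)
  rcases hk with ⟨k4, k5, hk⟩ | ⟨k4, k5, hk⟩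
  · have k6 : k ≠ 3 := by rintro rfl; exact h1 hk.1.symm
    exact S.false_of_cross h03 hk (by omega) (by omega) (by omega) (by omega)
  have k6 : k ≠ -1 := by rintro rfl; exact h11 hk.1
  obtain rfl : k = -2 := by omega
  obtain ⟨l, l1, l2, l3, hl⟩ := S.exists_chordIn hf₂ hh (i := -1) (by omega) (by omega) (by omega)
    (by omega)
  rcases hl with ⟨l4, l5, hl⟩ | ⟨l4, l5, hl⟩
  · obtain rfl : l = -3 := by omega
    refine S.false_of_detour hh.off (a := -3) (b := 3) (by omega) [-3, -1, -2] [2, 1, 0, 3] ?_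
      (by decide) rfl rfl ?_ (by simp)
    · simpa using ⟨hl.1.symm, S.adj (by omega), hh.adj_left.symm, hh.adj_right, S.adj (by omega),
        S.adj (by omega), h03.1⟩
    · simp; omega
  · have l6 : l ≠ 1 := by rintro rfl; exact h11 hl.1.symm
    exact S.symm.false_of_cross hk.symm hl (by omega) (by omega) (by omega) (by omega)

end CycleSetup

end Core

section Discharging

set_option linter.unusedSectionVars false

variable {V : Type*} [Fintype V] {G : SimpleGraph V} {x : V} {C : G.Walk x x} {p : ℤ → V}
  {emb : PlaneEmbedding G} {X X' Y f g h : Set (ℝ × ℝ)} {u v w : V} {a b i j k : ℤ}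

theorem mEdges_comm : mEdges emb C f g = mEdges emb C g f := by
  simp only [mEdges, and_comm]

theorem OppositeFaces.symm (h : OppositeFaces emb C f g) : OppositeFaces emb C g f :=
  ⟨h.1.symm, h.2.imp fun _ he => ⟨he.1, he.2.2, he.2.1⟩⟩

theorem IsCyclicParam.mEdges_eq (hp : IsCyclicParam C p) (a : ℤ) : mEdges emb C f g =
    ((Finset.Ico a (a + C.length)).filter fun k => incEdge emb f s(p k, p (k + 1)) ∧
      incEdge emb g s(p k, p (k + 1))).card := by
  unfold mEdges
  convert hp.card_filter_edges (fun e => incEdge emb f e ∧ incEdge emb g e) a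

theorem IsCyclicParam.card_le_mEdges (hp : IsCyclicParam C p) (s : Finset ℤ) (a : ℤ)
    (hs : ∀ k ∈ s, a ≤ k ∧ k < a + C.length ∧ incEdge emb f s(p k, p (k + 1)) ∧
      incEdge emb g s(p k, p (k + 1))) : s.card ≤ mEdges emb C f g := by
  rw [hp.mEdges_eq a]
  refine Finset.card_le_card fun k hk => ?_
  obtain ⟨h1, h2, h3⟩ := hs k hk
  exact Finset.mem_filter.2 ⟨Finset.mem_Ico.2 ⟨h1, h2⟩, h3⟩

theorem sendWeight_nonneg : 0 ≤ sendWeight emb C f g := by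
  unfold sendWeight
  refine add_nonneg (add_nonneg (add_nonneg (add_nonneg ?_ ?_) ?_) ?_) ?_ <;>
    · split_ifs <;> positivity

theorem isFaceOf_of_sendWeight_ne_zero (h : sendWeight emb C f g ≠ 0) :
    IsFaceOf (drawingH emb C) f ∧ IsFaceOf (drawingH emb C) g ∧ OppositeFaces emb C f g := by
  contrapose! h
  unfold sendWeight
  rw [if_neg, if_neg, if_neg, if_neg, if_neg]
  · norm_num
  · exact fun H => h H.1.1 H.2.2.1.1 H.2.2.2.2.1.symm
  · exact fun H => h H.1.1 H.2.2.1.1 H.2.2.2.2.1.symm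
  · rintro ⟨H1, H2, -, hne, e, he, hfe⟩
    exact h H1.1 H2.1 ⟨hne, e, he.1, hfe, he.2.1⟩
  · exact fun H => h H.1.1 H.2.1.1 H.2.2.2
  · exact fun H => h H.1.1 H.2.1.1 H.2.2

theorem sendWeight_of_major (hf : MajorFaceH emb C f) (hg : MinorFaceH emb C g)
    (ho : OppositeFaces emb C f g) : sendWeight emb C f g = mEdges emb C f g := by
  simp [sendWeight, hf, hf.2, hg, ho]

theorem sendWeight_to_major (hg : MajorFaceH emb C g) :
    sendWeight emb C f g = 0 := by
  simp [sendWeight, hg.2]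

/-- The condition on `f` and `g` under which rule R4 sends weight from `f` to `g`. -/
def RuleFour (emb : PlaneEmbedding G) (C : G.Walk x x) (f g : Set (ℝ × ℝ)) : Prop :=
  mEdges emb C g f = 2 ∧ ∃ f₂, MinorFaceH emb C f₂ ∧ (numCEdges emb C f₂ = 2 ∨
    numCEdges emb C f₂ = 3) ∧ OppositeFaces emb C g f₂ ∧ mEdges emb C g f₂ = 2

theorem sendWeight_le_of_minor (hf : MinorFaceH emb C f) : sendWeight emb C f g ≤
    (if numCEdges emb C g = 2 then 2 / 3 * (mEdges emb C f g : ℚ) else 0) +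
    (if numCEdges emb C g = 3 ∧ ∃ e, IsMiddleCEdge emb C g e ∧ incEdge emb f e then 1 else 0) +
    (if numCEdges emb C g = 4 ∧ RuleFour emb C f g then 2 / 3 else 0) +
    (if numCEdges emb C g = 5 ∧ mEdges emb C f g = 2 then 1 / 3 else 0) := by
  have key : ∀ {P Q : Prop} [Decidable P] [Decidable Q] {r : ℚ}, (P → Q) → 0 ≤ r →
      (if P then r else 0) ≤ if Q then r else 0 := by
    intro P Q _ _ r hPQ hr
    split_ifs with h1 h2 h2
    exacts [le_rfl, absurd (hPQ h1) h2, hr, le_rfl]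
  unfold sendWeight
  rw [if_neg fun H => H.1.2 hf, zero_add]
  refine add_le_add (add_le_add (add_le_add ?_ ?_) ?_) ?_
  · apply key
    · exact fun H => H.2.2.1
    · positivity
  · apply key
    · exact fun H => ⟨H.2.2.1, H.2.2.2.2⟩
    · norm_num
  · apply key
    · exact fun H => ⟨H.2.2.2.1, H.2.2.2.2.2.1, H.2.2.2.2.2.2⟩
    · norm_num
  · apply key
    · exact fun H => ⟨H.2.2.2.1, mEdges_comm.trans H.2.2.2.2.2.1⟩
    · norm_num

/-- The net weight that `f` sends to `g`, per common edge. -/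
def share (emb : PlaneEmbedding G) (C : G.Walk x x) (f g : Set (ℝ × ℝ)) : ℚ :=
  (sendWeight emb C f g - sendWeight emb C g f) / mEdges emb C f g

theorem share_of_major (hf : MinorFaceH emb C f) (hg : MajorFaceH emb C g)
    (ho : OppositeFaces emb C f g) (hm : 0 < mEdges emb C f g) : share emb C f g = -1 := by
  have : (mEdges emb C f g : ℚ) ≠ 0 := by positivity
  rw [share, sendWeight_to_major hg, sendWeight_of_major hg hf ho.symm, zero_sub, neg_div,
    mEdges_comm (f := g), div_self this]

theorem share_le {r : ℚ} (hm : 0 < mEdges emb C f g)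
    (h : sendWeight emb C f g ≤ r * mEdges emb C f g) : share emb C f g ≤ r := by
  have : (0 : ℚ) < mEdges emb C f g := by positivity
  rw [share, div_le_iff₀ this]
  linarith [sendWeight_nonneg (emb := emb) (C := C) (f := g) (g := f)]

theorem share_two (hf : MinorFaceH emb C f) (hm : 0 < mEdges emb C f g)
    (hn : numCEdges emb C g = 2) : share emb C f g ≤ 2 / 3 := by
  refine share_le hm ((sendWeight_le_of_minor hf).trans (le_of_eq ?_))
  simp [hn]

theorem share_three (hf : MinorFaceH emb C f) (hm : 3 ≤ mEdges emb C f g)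
    (hn : numCEdges emb C g = 3) : share emb C f g ≤ 1 / 3 := by
  refine share_le (by omega) ((sendWeight_le_of_minor hf).trans ?_)
  have : (3 : ℚ) ≤ mEdges emb C f g := by exact_mod_cast hm
  simp only [hn]
  norm_num
  split_ifs <;> linarith

theorem share_four (hf : MinorFaceH emb C f) (hm : 0 < mEdges emb C f g)
    (hn : numCEdges emb C g = 4) : share emb C f g ≤ 1 / 3 := by
  refine share_le hm ((sendWeight_le_of_minor hf).trans ?_)
  simp only [hn]
  norm_num
  split_ifs with h
  · rw [mEdges_comm, h.1]
    norm_num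
  · positivity

theorem share_four_of_not (hf : MinorFaceH emb C f) (hm : 0 < mEdges emb C f g)
    (hn : numCEdges emb C g = 4) (hr : ¬ RuleFour emb C f g) : share emb C f g ≤ 0 := by
  refine share_le hm ((sendWeight_le_of_minor hf).trans (le_of_eq ?_))
  simp [hn, hr]

theorem share_five (hf : MinorFaceH emb C f) (hm : 0 < mEdges emb C f g)
    (hn : numCEdges emb C g = 5) : share emb C f g ≤ 1 / 6 := by
  refine share_le hm ((sendWeight_le_of_minor hf).trans ?_)
  simp only [hn]
  norm_num
  split_ifs with h
  · rw [h]
    norm_num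
  · positivity

theorem share_other (hf : MinorFaceH emb C f) (hm : 0 < mEdges emb C f g)
    (hn : numCEdges emb C g ≤ 1 ∨ 6 ≤ numCEdges emb C g) : share emb C f g ≤ 0 := by
  refine share_le hm ((sendWeight_le_of_minor hf).trans (le_of_eq ?_))
  rw [if_neg (by omega), if_neg (by omega), if_neg (by omega), if_neg (by omega)]
  norm_num

theorem share_five_le (hf : MinorFaceH emb C f) (hm : 0 < mEdges emb C f g)
    (hn : 5 ≤ numCEdges emb C g) : share emb C f g ≤ 1 / 6 := by
  rcases hn.eq_or_lt with h | h
  · exact share_five hf hm h.symm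
  · exact (share_other hf hm (Or.inr h)).trans (by norm_num)

namespace CycleSetup

variable (S : CycleSetup emb C p X X')
include S

theorem mEdges_two_of_middle (hf : FaceIv emb C p X f v 0 7) (hg : FaceIv emb C p X' g u a (a + 3))
    {e : Sym2 V} (he : IsMiddleCEdge emb C g e) (hfe : incEdge emb f e) :
    2 ≤ mEdges emb C f g := by
  have hlen := S.eight_le
  have hp := S.param
  obtain ⟨heC, hge, hmid⟩ := he
  obtain ⟨j, h1, h2, rfl⟩ := hp.exists_edge_mem_Ico heC a
  have hj := (hg.inc_iff j h1 h2).1 hge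
  have hsep : ∀ w, w ∈ s(p a, p (a + 1)) → w ∈ s(p (a + 2), p (a + 2 + 1)) → False := by
    intro w h1 h2
    rw [Sym2.mem_iff] at h1 h2
    rcases h1 with rfl | rfl <;> rcases h2 with h2 | h2 <;>
      exact hp.ne (by omega) (by omega) h2
  have hne : s(p a, p (a + 1)) ≠ s(p (a + 2), p (a + 2 + 1)) := fun e =>
    hsep _ (Sym2.mem_mk_left _ _) (e ▸ Sym2.mem_mk_left _ _)
  have hja : j ≠ a := by
    rintro rfl
    obtain ⟨w, hw, hw'⟩ := hmid _ (hp.edge_mem (j + 2)) (hg.inc (by omega) (by omega)) hne.symm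
    exact hsep w hw hw'
  have hja' : j ≠ a + 2 := by
    rintro rfl
    obtain ⟨w, hw, hw'⟩ := hmid _ (hp.edge_mem a) (hg.inc (by omega) (by omega)) hne
    exact hsep w hw' hw
  obtain rfl : j = a + 1 := by omega
  obtain ⟨v', a', b', h3, h4, hf'⟩ := exists_faceIv hp S.iso S.left hf.subset hf.minor hfe
  have e1 := hf.numCEdges hp
  have e2 := hf'.numCEdges hp
  rcases le_or_gt a' a with h5 | h5
  · have := hp.card_le_mEdges (emb := emb) (f := f) (g := g) {a, a + 1} a (by
      simp only [Finset.mem_insert, Finset.mem_singleton]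
      rintro k (rfl | rfl)
      · exact ⟨by omega, by omega, hf'.inc (by omega) (by omega), hg.inc (by omega) (by omega)⟩
      · exact ⟨by omega, by omega, hf'.inc (by omega) (by omega), hg.inc (by omega) (by omega)⟩)
    rwa [Finset.card_pair (by omega)] at this
  · have := hp.card_le_mEdges (emb := emb) (f := f) (g := g) {a + 1, a + 2} a (by
      simp only [Finset.mem_insert, Finset.mem_singleton]
      rintro k (rfl | rfl)
      · exact ⟨by omega, by omega, hf'.inc (by omega) (by omega), hg.inc (by omega) (by omega)⟩
      · exact ⟨by omega, by omega, hf'.inc (by omega) (by omega), hg.inc (by omega) (by omega)⟩)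
    rwa [Finset.card_pair (by omega)] at this

theorem share_le_two_thirds (hf : FaceIv emb C p X f v 0 7) (hg : FaceIv emb C p X' g u a b)
    (hm : 0 < mEdges emb C f g) : share emb C f g ≤ 2 / 3 := by
  have hn := hg.numCEdges S.param
  have hb := hg.lt
  rcases (by omega : b - a = 2 ∨ b - a = 3 ∨ b - a = 4 ∨ b - a = 5 ∨ (b - a ≤ 1 ∨ 6 ≤ b - a)) with
    h | h | h | h | h
  · exact share_two hf.minor hm (by omega)
  · obtain rfl : b = a + 3 := by omega
    refine share_le hm ((sendWeight_le_of_minor hf.minor).trans ?_)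
    have hn : numCEdges emb C g = 3 := by omega
    simp only [hn]
    norm_num
    split_ifs with he
    · obtain ⟨e, he, hfe⟩ := he
      have : (2 : ℚ) ≤ mEdges emb C f g := by
        exact_mod_cast S.mEdges_two_of_middle hf hg he hfe
      linarith
    · positivity
  · exact (share_four hf.minor hm (by omega)).trans (by norm_num)
  · exact (share_five hf.minor hm (by omega)).trans (by norm_num)
  · exact (share_other hf.minor hm (by omega)).trans (by norm_num)

/-- The faces opposite to the edges of a minor 7-face, and the resulting final weight. -/
theorem exists_faces (hf : FaceIv emb C p X f v 0 7) : ∃ F : ℤ → Set (ℝ × ℝ),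
    (∀ k, IsFaceOf (drawingH emb C) (F k) ∧ F k ⊆ X' ∧ incEdge emb (F k) s(p k, p (k + 1))) ∧
    wFace emb C f = 7 - ∑ k ∈ Finset.Ico (0 : ℤ) 7, share emb C f (F k) := by
  have hp := S.param
  have hlen := S.eight_le
  have hH := drawingH_eq (emb := emb) hp S.iso
  choose F hF hFX hFi using exists_face_of_edge hp S.right
  have huniq : ∀ g k, IsFaceOf (drawEdges emb (Hgraph C).edgeSet) g → g ⊆ X' →
      incEdge emb g s(p k, p (k + 1)) → F k = g := fun g k hg hgX hgi =>
    eq_of_edge hp S.right (hF k) (hFX k) hg hgX (hFi k) hgi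
  refine ⟨F, fun k => ⟨hH ▸ hF k, hFX k, hFi k⟩, ?_⟩
  have hopp : ∀ g, IsFaceOf (drawingH emb C) g → OppositeFaces emb C f g →
      g ∈ (Finset.Ico (0 : ℤ) 7).image F := by
    rintro g hg ⟨hne, e, he, hfe, hge⟩
    rw [hH] at hg
    obtain ⟨k, h1, h2, rfl⟩ := hp.exists_edge_mem_Ico he 0
    have hk := (hf.inc_iff k h1 h2).1 hfe
    obtain ⟨Y, hY, hgY⟩ := hg.exists_superset (drawC_subset_drawEdges (C := C))
    rcases S.eq_or_eq Y hY with rfl | rfl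
    · exact absurd (eq_of_edge hp hY (hf.isFaceOf hp S.iso) hf.subset hg hgY hfe hge) hne
    · exact Finset.mem_image.2 ⟨k, Finset.mem_Ico.2 ⟨h1, hk⟩, huniq g k hg hgY hge⟩
  have hcard : ∀ g ∈ (Finset.Ico (0 : ℤ) 7).image F,
      mEdges emb C f g = ((Finset.Ico (0 : ℤ) 7).filter fun k => F k = g).card := by
    intro g hg
    obtain ⟨j, -, rfl⟩ := Finset.mem_image.1 hg
    rw [hp.mEdges_eq 0]
    congr 1
    ext k
    simp only [Finset.mem_filter, Finset.mem_Ico]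
    constructor
    · rintro ⟨⟨h1, h2⟩, h3, h4⟩
      exact ⟨⟨h1, (hf.inc_iff k h1 h2).1 h3⟩, huniq _ _ (hF j) (hFX j) h4⟩
    · rintro ⟨⟨h1, h2⟩, h3⟩
      exact ⟨⟨h1, by omega⟩, hf.inc h1 h2, h3 ▸ hFi k⟩
  have hs1 : ∑ᶠ g, sendWeight emb C f g =
      ∑ g ∈ (Finset.Ico (0 : ℤ) 7).image F, sendWeight emb C f g :=
    finsum_eq_sum_of_support_subset _ fun g hg =>
      have := isFaceOf_of_sendWeight_ne_zero hg
      hopp g this.2.1 this.2.2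
  have hs2 : ∑ᶠ g, sendWeight emb C g f =
      ∑ g ∈ (Finset.Ico (0 : ℤ) 7).image F, sendWeight emb C g f :=
    finsum_eq_sum_of_support_subset _ fun g hg =>
      have := isFaceOf_of_sendWeight_ne_zero hg
      hopp g this.1 this.2.2.symm
  have hn := hf.numCEdges hp
  have hn : numCEdges emb C f = 7 := by omega
  rw [wFace, hs1, hs2, hn, Finset.sum_comp (share emb C f) F, sub_add, ← Finset.sum_sub_distrib]
  push_cast
  congr 1
  refine Finset.sum_congr rfl fun g hg => ?_
  have hpos : 0 < mEdges emb C f g := by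
    rw [hcard g hg]
    obtain ⟨j, hj, rfl⟩ := Finset.mem_image.1 hg
    exact Finset.card_pos.2 ⟨j, Finset.mem_filter.2 ⟨hj, rfl⟩⟩
  have : (mEdges emb C f g : ℚ) ≠ 0 := by positivity
  rw [← hcard g hg, share, nsmul_eq_mul, mul_div_cancel₀ _ this]

end CycleSetup

end Discharging

section MinorSevenFace

set_option linter.unusedSectionVars false

variable {V : Type*} [Fintype V] {G : SimpleGraph V} {x : V} {C : G.Walk x x} {p : ℤ → V}
  {emb : PlaneEmbedding G} {X X' f g g' : Set (ℝ × ℝ)} {u v w : V} {a b k : ℤ}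

namespace CycleSetup

variable (S : CycleSetup emb C p X X')
include S

theorem three_le_mEdges (hf : FaceIv emb C p X f v 0 7) (hg : FaceIv emb C p X' g u a b)
    (ha : 0 ≤ a) (ha7 : a + 3 ≤ 7) (hab : a + 3 ≤ b) : 3 ≤ mEdges emb C f g := by
  have hlen := S.eight_le
  have := S.param.card_le_mEdges (emb := emb) (f := f) (g := g) (Finset.Ico a (a + 3)) a
    fun k hk => by
      obtain ⟨h1, h2⟩ := Finset.mem_Ico.1 hk
      exact ⟨h1, by omega, hf.inc (by omega) (by omega), hg.inc h1 (by omega)⟩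
  rwa [Int.card_Ico, show a + 3 - a = 3 by ring] at this

theorem mEdges_pos (hf : FaceIv emb C p X f v 0 7) (hk : 0 ≤ k) (hk7 : k < 7)
    (hi : incEdge emb g s(p k, p (k + 1))) : 0 < mEdges emb C f g := by
  have hlen := S.eight_le
  have := S.param.card_le_mEdges (emb := emb) (f := f) (g := g) {k} 0 fun j hj => by
    obtain rfl := Finset.mem_singleton.1 hj
    exact ⟨hk, by omega, hf.inc hk hk7, hi⟩
  rwa [Finset.card_singleton] at this

/-- If the final weight of a minor 7-face is small, all its opposite faces are minor. -/
theorem exists_minor_faces (hf : FaceIv emb C p X f v 0 7) (hw : wFace emb C f < 10 / 3) :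
    ∃ (F : ℤ → Set (ℝ × ℝ)) (u : ℤ → V) (a b : ℤ → ℤ),
      (∀ k, 0 ≤ k → k < 7 → a k ≤ k ∧ k < b k ∧ FaceIv emb C p X' (F k) (u k) (a k) (b k) ∧
        0 < mEdges emb C f (F k) ∧ share emb C f (F k) ≤ 2 / 3) ∧
      (∀ k g, IsFaceOf (drawingH emb C) g → g ⊆ X' → incEdge emb g s(p k, p (k + 1)) →
        F k = g) ∧
      11 / 3 < share emb C f (F 0) + share emb C f (F 1) + share emb C f (F 2) +
        share emb C f (F 3) + share emb C f (F 4) + share emb C f (F 5) + share emb C f (F 6) := by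
  have hp := S.param
  have hlen := S.eight_le
  have hH := drawingH_eq (emb := emb) hp S.iso
  obtain ⟨F, hF, hsum⟩ := S.exists_faces hf
  rw [show Finset.Ico (0 : ℤ) 7 = {0, 1, 2, 3, 4, 5, 6} from by decide] at hsum
  simp only [Finset.mem_insert, Finset.mem_singleton, Finset.sum_insert, Finset.sum_singleton,
    not_false_eq_true, or_self, Int.reduceEq, OfNat.one_ne_ofNat, OfNat.zero_ne_ofNat,
    zero_ne_one] at hsum
  have hne : ∀ k, f ≠ F k := by
    rintro k rfl
    obtain ⟨z, hz⟩ := (hF k).1.nonempty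
    exact S.ne (S.left.eq_of_mem S.right (hf.subset hz) ((hF k).2.1 hz))
  have hmajor : ∀ k, 0 ≤ k → k < 7 → ¬ MinorFaceH emb C (F k) → share emb C f (F k) = -1 :=
    fun k h0 h7 hk => share_of_major hf.minor ⟨(hF k).1, hk⟩
      ⟨hne k, _, hp.edge_mem k, hf.inc h0 h7, (hF k).2.2⟩ (S.mEdges_pos hf h0 h7 (hF k).2.2)
  have hle : ∀ k, 0 ≤ k → k < 7 → share emb C f (F k) ≤ 2 / 3 := fun k h0 h7 => by
    by_cases hk : MinorFaceH emb C (F k)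
    · obtain ⟨u, a, b, -, -, h⟩ := exists_faceIv hp S.iso S.right (hF k).2.1 hk (hF k).2.2
      exact S.share_le_two_thirds hf h (S.mEdges_pos hf h0 h7 (hF k).2.2)
    · rw [hmajor k h0 h7 hk]
      norm_num
  have hminor : ∀ k, 0 ≤ k → k < 7 → MinorFaceH emb C (F k) := fun k h0 h7 => by
    by_contra hk
    have hk := hmajor k h0 h7 hk
    have l0 := hle 0 (by omega) (by omega)
    have l1 := hle 1 (by omega) (by omega)
    have l2 := hle 2 (by omega) (by omega)
    have l3 := hle 3 (by omega) (by omega)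
    have l4 := hle 4 (by omega) (by omega)
    have l5 := hle 5 (by omega) (by omega)
    have l6 := hle 6 (by omega) (by omega)
    interval_cases k <;> linarith
  have hiv : ∀ k, ∃ (u : V) (a b : ℤ), 0 ≤ k → k < 7 →
      a ≤ k ∧ k < b ∧ FaceIv emb C p X' (F k) u a b := fun k => by
    by_cases h : 0 ≤ k ∧ k < 7
    · obtain ⟨u, a, b, h1⟩ :=
        exists_faceIv hp S.iso S.right (hF k).2.1 (hminor k h.1 h.2) (hF k).2.2
      exact ⟨u, a, b, fun _ _ => h1⟩
    · exact ⟨x, 0, 0, fun h0 h7 => absurd ⟨h0, h7⟩ h⟩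
  choose u a b hiv using hiv
  refine ⟨F, u, a, b, fun k h0 h7 => ?_, fun k g hg hgX hgi => ?_, by linarith⟩
  · obtain ⟨h1, h2, h3⟩ := hiv k h0 h7
    exact ⟨h1, h2, h3, S.mEdges_pos hf h0 h7 (hF k).2.2, hle k h0 h7⟩
  · exact eq_of_edge hp S.right (hH ▸ (hF k).1) (hF k).2.1 (hH ▸ hg) hgX (hF k).2.2 hgi

/-- The faces causing rule R4 to apply to `g'`, when `g'` ends two edges after the left end of the
7-face `f`. -/
theorem exists_faceIv_of_ruleFour (hf : FaceIv emb C p X f v 0 7)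
    (hg' : FaceIv emb C p X' g' w (-2) 2) (hr : RuleFour emb C f g') :
    ∃ (f₂ : Set (ℝ × ℝ)) (v₂ : V) (a₂ : ℤ), (a₂ = -2 ∨ a₂ = -3) ∧ FaceIv emb C p X f₂ v₂ a₂ 0 := by
  have hlen := S.eight_le
  have hp := S.param
  have hH := drawingH_eq (emb := emb) hp S.iso
  obtain ⟨-, f₂, hm, hn, ⟨hne, e, he, hge, hfe⟩, hcard⟩ := hr
  have hnf := hf.numCEdges hp
  have hff : f ≠ f₂ := by
    rintro rfl
    omega
  have hface : IsFaceOf (drawEdges emb (Hgraph C).edgeSet) f₂ := hH ▸ hm.1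
  obtain ⟨Y, hY, hY'⟩ := hface.exists_superset (drawC_subset_drawEdges (C := C))
  obtain ⟨j, -, -, rfl⟩ := hp.exists_edge_mem_Ico he 0
  obtain rfl : Y = X := (S.eq_or_eq Y hY).resolve_right fun h => hne
    (eq_of_edge hp S.right (hg'.isFaceOf hp S.iso) hg'.subset hface (h ▸ hY') hge hfe)
  have hnot : ∀ k, 0 ≤ k → k < 7 → ¬ incEdge emb f₂ s(p k, p (k + 1)) := fun k h0 h7 h =>
    hff (eq_of_edge hp hY (hf.isFaceOf hp S.iso) hf.subset hface hY' (hf.inc h0 h7) h)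
  have hinc : incEdge emb f₂ s(p (-1), p (-1 + 1)) := by
    by_contra hinc
    have : mEdges emb C g' f₂ ≤ ({-2} : Finset ℤ).card := by
      rw [hp.mEdges_eq (-2)]
      refine Finset.card_le_card fun k hk => ?_
      obtain ⟨hk, h1, h2⟩ := Finset.mem_filter.1 hk
      obtain ⟨h3, h4⟩ := Finset.mem_Ico.1 hk
      have h5 := (hg'.inc_iff k h3 h4).1 h1
      have h6 : ¬ 0 ≤ k := fun h0 => hnot k h0 (by omega) h2
      have h7 : k ≠ -1 := by
        rintro rfl
        exact hinc h2
      rw [Finset.mem_singleton]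
      omega
    simp [hcard] at this
  obtain ⟨v₂, a₂, b₂, h1, h2, h⟩ := exists_faceIv hp S.iso hY hY' hm hinc
  have hb : ¬ 0 < b₂ := fun h0 => hnot 0 le_rfl (by omega) (h.inc (by omega) h0)
  obtain rfl : b₂ = 0 := by omega
  have := h.numCEdges hp
  exact ⟨f₂, v₂, a₂, by omega, h⟩

theorem share_le_one_third (hf : FaceIv emb C p X f v 0 7) (hg : FaceIv emb C p X' g u a b)
    (ha : 0 ≤ a) (hb7 : b ≤ 7) (hb : b - a = 3) : share emb C f g ≤ 1 / 3 := by
  have hn := hg.numCEdges S.param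
  exact share_three hf.minor (S.three_le_mEdges hf hg ha (by omega) (by omega)) (by omega)

theorem share_nonpos (hf : FaceIv emb C p X f v 0 7) (hg : FaceIv emb C p X' g u a b)
    (ha : 0 ≤ a) (ha7 : a + 3 ≤ 7) (hb : b - a = 4) : share emb C f g ≤ 0 := by
  have hn := hg.numCEdges S.param
  have h3 := S.three_le_mEdges hf hg ha ha7 (by omega)
  refine share_four_of_not hf.minor (by omega) (by omega) fun h => ?_
  have := mEdges_comm.trans h.1
  omega

theorem share_le_one_sixth (hf : FaceIv emb C p X f v 0 7) (hg : FaceIv emb C p X' g u a b)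
    (hm : 0 < mEdges emb C f g) (hb : 5 ≤ b - a) : share emb C f g ≤ 1 / 6 := by
  have hn := hg.numCEdges S.param
  exact share_five_le hf.minor hm (by omega)

theorem le_wFace_of_faceIv_two_four (hf : FaceIv emb C p X f v 0 7)
    (hg : FaceIv emb C p X' g u 2 4) : 10 / 3 ≤ wFace emb C f := by
  by_contra! hw
  have hlen := S.eight_le
  have hp := S.param
  obtain ⟨F, u', a, b, hF, huniq, hsum⟩ := S.exists_minor_faces hf hw
  obtain ⟨-, -, -, -, l0⟩ := hF 0 (by omega) (by omega)
  obtain ⟨ha1, hb1, h1, m1, l1⟩ := hF 1 (by omega) (by omega)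
  obtain ⟨-, -, -, -, l2⟩ := hF 2 (by omega) (by omega)
  obtain ⟨-, -, -, -, l3⟩ := hF 3 (by omega) (by omega)
  obtain ⟨ha4, hb4, h4, m4, l4⟩ := hF 4 (by omega) (by omega)
  obtain ⟨-, -, -, -, l5⟩ := hF 5 (by omega) (by omega)
  obtain ⟨-, -, -, -, l6⟩ := hF 6 (by omega) (by omega)
  have hEg : ∀ k, 2 ≤ k → k < 4 → F k = g := fun k h1 h2 =>
    huniq k _ hg.minor.1 hg.subset (hg.inc h1 h2)
  have huniq : ∀ j k, FaceIv emb C p X' (F j) (u' j) (a j) (b j) → a j ≤ k → k < b j →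
      F k = F j := fun j k h h1 h2 => huniq k _ h.minor.1 h.subset (h.inc h1 h2)
  have hb1' : b 1 = 2 := by
    by_contra hb
    have := (hEg 2 le_rfl (by omega)).symm.trans (huniq 1 2 h1 (by omega) (by omega))
    subst this
    have := h1.inc ha1 hb1
    rw [show s(p 1, p (1 + 1)) = s(p (1 + C.length), p (1 + C.length + 1)) from
      hp.edge_eq_iff.2 (by simp)] at this
    have := (hg.inc_iff (1 + C.length) (by omega) (by omega)).1 this
    omega
  have ha4' : a 4 = 4 := by
    by_contra ha
    have := (hEg 3 (by omega) (by omega)).symm.trans (huniq 4 3 h4 (by omega) (by omega))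
    subst this
    have := (hg.inc_iff 4 (by omega) (by omega)).1 (h4.inc ha4 hb4)
    omega
  have hb4' : b 4 = 6 := by
    by_contra hb
    have e5 : b 4 ≠ 5 := fun e => by
      rw [ha4', e] at h4
      exact S.not_faceIv_one h4
    have f5 := huniq 4 5 h4 (by omega) (by omega)
    have f6 := huniq 4 6 h4 (by omega) (by omega)
    rw [f5, f6] at hsum
    rcases (by omega : b 4 = 7 ∨ b 4 = 8 ∨ 9 ≤ b 4) with h | h | h
    · have := S.share_le_one_third hf h4 (by omega) (by omega) (by omega)
      linarith
    · have := S.share_nonpos hf h4 (by omega) (by omega) (by omega)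
      linarith
    · have := S.share_le_one_sixth hf h4 m4 (by omega)
      linarith
  rw [ha4', hb4'] at h4
  have h03 := S.chordIn_three_zero hf hg h4
  rcases (by omega : a 1 = 1 ∨ a 1 = 0 ∨ a 1 = -1 ∨ a 1 = -2 ∨ a 1 ≤ -3) with h | h | h | h | h
  · rw [h, hb1'] at h1
    exact S.not_faceIv_one h1
  · rw [h, hb1'] at h1
    exact S.not_faceIv_two hf h03 h1
  · rw [h, hb1'] at h1
    exact S.not_faceIv_three h03 h1
  · rw [huniq 1 0 h1 (by omega) (by omega)] at hsum
    rw [h, hb1'] at h1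
    have hn := h1.numCEdges hp
    by_cases hr : RuleFour emb C f (F 1)
    · obtain ⟨f₂, v₂, a₂, ha₂, h₂⟩ := S.exists_faceIv_of_ruleFour hf h1 hr
      exact S.not_faceIv_four hf hg h03 ha₂ h₂ h1
    · have := share_four_of_not hf.minor m1 (by omega) hr
      linarith
  · rw [huniq 1 0 h1 (by omega) (by omega)] at hsum
    have := S.share_le_one_sixth hf h1 m1 (by omega)
    linarith

theorem le_wFace (hf : FaceIv emb C p X f v 0 7) : 10 / 3 ≤ wFace emb C f := by
  by_contra! hw
  have hlen := S.eight_le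
  obtain ⟨F, u, a, b, hF, huniq, hsum⟩ := S.exists_minor_faces hf hw
  obtain ⟨-, -, -, -, l0⟩ := hF 0 (by omega) (by omega)
  obtain ⟨-, -, -, -, l1⟩ := hF 1 (by omega) (by omega)
  obtain ⟨-, -, -, -, l2⟩ := hF 2 (by omega) (by omega)
  obtain ⟨ha, hb, h, hm, l3⟩ := hF 3 (by omega) (by omega)
  obtain ⟨-, -, -, -, l4⟩ := hF 4 (by omega) (by omega)
  obtain ⟨-, -, -, -, l5⟩ := hF 5 (by omega) (by omega)
  obtain ⟨-, -, -, -, l6⟩ := hF 6 (by omega) (by omega)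
  have huniq : ∀ k, a 3 ≤ k → k < b 3 → share emb C f (F k) = share emb C f (F 3) :=
    fun k h1 h2 => by rw [huniq k _ h.minor.1 h.subset (h.inc h1 h2)]
  have hf' := hf.reflect S.param 7
  rw [sub_self, sub_zero] at hf'
  rcases (by omega : b 3 - a 3 = 1 ∨ b 3 - a 3 = 2 ∨ b 3 - a 3 = 3 ∨ b 3 - a 3 = 4 ∨
    5 ≤ b 3 - a 3) with hd | hd | hd | hd | hd
  · rw [show b 3 = a 3 + 1 by omega] at h
    exact S.not_faceIv_one h
  · rcases (by omega : a 3 = 2 ∨ a 3 = 3) with h2 | h2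
    · rw [show b 3 = 4 by omega, h2] at h
      exact hw.not_ge (S.le_wFace_of_faceIv_two_four hf h)
    · rw [show b 3 = 5 by omega, h2] at h
      have h' := h.reflect S.param 7
      norm_num at h'
      exact hw.not_ge ((S.reflect 7).le_wFace_of_faceIv_two_four hf' h')
  · have h3 := S.share_le_one_third hf h (by omega) (by omega) hd
    have := huniq (a 3) (by omega) (by omega)
    have := huniq (a 3 + 1) (by omega) (by omega)
    have := huniq (a 3 + 2) (by omega) (by omega)
    rcases (by omega : a 3 = 1 ∨ a 3 = 2 ∨ a 3 = 3) with e | e | e <;> simp only [e] at * <;>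
      norm_num at * <;> linarith
  · have h3 := S.share_nonpos hf h (by omega) (by omega) hd
    have := huniq (a 3) (by omega) (by omega)
    have := huniq (a 3 + 1) (by omega) (by omega)
    have := huniq (a 3 + 2) (by omega) (by omega)
    rcases (by omega : a 3 = 0 ∨ a 3 = 1 ∨ a 3 = 2 ∨ a 3 = 3) with e | e | e | e <;>
      simp only [e] at * <;> norm_num at * <;> linarith
  · have h3 := S.share_le_one_sixth hf h hm hd
    rcases (by omega : a 3 ≤ 2 ∨ 4 < b 3) with e | e
    · have := huniq 2 (by omega) (by omega)
      linarith
    · have := huniq 4 (by omega) (by omega)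
      linarith

end CycleSetup

end MinorSevenFace

/-- After discharging by rules R1–R5, every minor 7-face of `H` has weight `≥ 10/3`. -/
theorem stmt13_minor_7face
    {V : Type*} [Fintype V] {G : SimpleGraph V}
    (hn : 11 ≤ Fintype.card V) (h4 : EssentiallyFourConnected G)
    (emb : PlaneEmbedding G) {x : V} (C : G.Walk x x)
    (hC : IsLongestIsolatingCycle G C) (hc : 8 ≤ C.length)
    (hVm : (Vminus emb C).Nonempty) (hVp : (Vplus emb C).Nonempty) :
    ∀ f : Set (ℝ × ℝ), MinorFaceH emb C f → numCEdges emb C f = 7 →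
      (10 : ℚ) / 3 ≤ wFace emb C f := by
  intro f hf hn
  obtain ⟨p, hp⟩ := hC.1.exists_isCyclicParam
  obtain ⟨X, X', hX, hX', hne, heq⟩ := exists_two_sides (emb := emb) hp
  have S : CycleSetup emb C p X X' := ⟨hp, hC, h4.1, hc, hX, hX', hne, heq⟩
  have key : ∀ {Y Y' : Set (ℝ × ℝ)}, CycleSetup emb C p Y Y' → f ⊆ Y →
      (10 : ℚ) / 3 ≤ wFace emb C f := by
    intro Y Y' S hfY
    obtain ⟨e, he⟩ := Finset.card_pos.1 (show 0 < numCEdges emb C f by omega)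
    obtain ⟨heC, hfe⟩ := Finset.mem_filter.1 he
    obtain ⟨i, -, -, rfl⟩ := hp.exists_edge_mem_Ico (List.mem_toFinset.1 heC) 0
    obtain ⟨v, a, b, -, -, h⟩ := exists_faceIv hp S.iso S.left hfY hf hfe
    have hab := h.numCEdges hp
    have h' := h.shift a
    rw [sub_self, show b - a = 7 by omega] at h'
    exact (S.shift a).le_wFace h'
  obtain ⟨Y, hY, hfY⟩ := (drawingH_eq hp S.iso ▸ hf.1 :
    IsFaceOf (drawEdges emb (Hgraph C).edgeSet) f).exists_superset
      (drawC_subset_drawEdges (C := C))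
  rcases heq Y hY with rfl | rfl
  exacts [key S hfY, key S.symm hfY]

end
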